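/- Let n ≥ 1 and 0 ≤ k ≤ 2n. For each q with max(0, k−n) ≤ q ≤ ⌊k/2⌋ let μ_{k,q} be the hermitian intrinsic volume, i.e. the unique element of Val_k^{U(n)} whose restriction to nonempty compact convex subsets of any subspace of type (k,q') equals δ_{q q'} times k-dimensional Hausdorff measure. Then the valuations μ_{k,q}, for q = max(0, k−n), …, ⌊k/2⌋, form a basis of Val_k^{U(n)}. -/

import Mathlib

open MeasureTheory Pointwise
open scoped NNReal ENNReal

noncomputable section

/-- Euclidean `n`-space `ℝⁿ`. -/
abbrev Eucl (n : ℕ) : Type := EuclideanSpace ℝ (Fin n)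

section Generic

variable {V : Type*} [NormedAddCommGroup V] [NormedSpace ℝ V]

/-- `μ` is a valuation: whenever the union of two convex bodies `K`, `L` is again a convex
body `M` (with intersection the convex body `I`), one has `μ M + μ I = μ K + μ L`. -/
def IsValuation (μ : ConvexBody V → ℝ) : Prop :=
  ∀ K L M I : ConvexBody V,
    (M : Set V) = (K : Set V) ∪ (L : Set V) → (I : Set V) = (K : Set V) ∩ (L : Set V) →
      μ M + μ I = μ K + μ L

/-- The translate `K + x` of a convex body. -/
def ConvexBody.translate (K : ConvexBody V) (x : V) : ConvexBody V :=
  ⟨(K : Set V) + {x}, K.convex.add (convex_singleton x),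
    K.isCompact.add isCompact_singleton, K.nonempty.add (Set.singleton_nonempty x)⟩

/-- Translation invariance of a valuation. -/
def TransInv (μ : ConvexBody V → ℝ) : Prop :=
  ∀ (K : ConvexBody V) (x : V), μ (K.translate x) = μ K

/-- The dilate `t • K` of a convex body. -/
def ConvexBody.dilate (t : ℝ) (K : ConvexBody V) : ConvexBody V :=
  ⟨t • (K : Set V), K.convex.smul t, K.isCompact.smul t, K.nonempty.smul_set⟩

/-- Homogeneity of degree `k` of a valuation: `μ (t • K) = t ^ k * μ K` for `t > 0`. -/
def Homog (k : ℕ) (μ : ConvexBody V → ℝ) : Prop :=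
  ∀ (K : ConvexBody V) (t : ℝ), 0 < t → μ (ConvexBody.dilate t K) = t ^ k * μ K

/-- The reflection `-K` of a convex body. -/
def ConvexBody.reflect (K : ConvexBody V) : ConvexBody V :=
  ⟨-(K : Set V), K.convex.neg, K.isCompact.neg, K.nonempty.neg⟩

/-- Even valuations: `μ (-K) = μ K`. -/
def EvenVal (μ : ConvexBody V → ℝ) : Prop := ∀ K : ConvexBody V, μ K.reflect = μ K

/-- Odd valuations: `μ (-K) = -μ K`. -/
def OddVal (μ : ConvexBody V → ℝ) : Prop := ∀ K : ConvexBody V, μ K.reflect = -μ K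

end Generic

/-- Hermitian `n`-space `ℂⁿ`, viewed with its underlying real Euclidean structure coming
from the real inner product `⟨z,w⟩ = Re ⟪z,w⟫`. -/
abbrev Ecl (n : ℕ) : Type := EuclideanSpace ℂ (Fin n)

instance (n : ℕ) : MeasurableSpace (Ecl n) := borel _
instance (n : ℕ) : BorelSpace (Ecl n) := ⟨rfl⟩

/-- The image of a convex body in `ℂⁿ` under the `ℂ`-linear map given by a complex matrix. -/
def matBodyC {n : ℕ} (A : Matrix (Fin n) (Fin n) ℂ) (K : ConvexBody (Ecl n)) :
    ConvexBody (Ecl n) :=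
  ⟨Matrix.toEuclideanLin A '' (K : Set (Ecl n)),
    K.convex.linear_image ((Matrix.toEuclideanLin A).restrictScalars ℝ),
    K.isCompact.image (Matrix.toEuclideanLin A).continuous_of_finiteDimensional,
    K.nonempty.image _⟩

/-- Invariance of a valuation on `ℂⁿ` under the unitary group `U(n)`. -/
def UInv {n : ℕ} (μ : ConvexBody (Ecl n) → ℝ) : Prop :=
  ∀ A : Matrix (Fin n) (Fin n) ℂ, A ∈ Matrix.unitaryGroup (Fin n) ℂ →
    ∀ K : ConvexBody (Ecl n), μ (matBodyC A K) = μ K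

/-- A real subspace of `ℂⁿ` which is complex (closed under multiplication by `i`). -/
def IsComplexSubspace {n : ℕ} (F : Submodule ℝ (Ecl n)) : Prop :=
  ∀ v ∈ F, Complex.I • v ∈ F

/-- A real subspace `W` of `ℂⁿ` is isotropic if `⟨iv, w⟩ = 0` for all `v, w ∈ W`, where
`⟨·,·⟩` is the real inner product. -/
def IsIsotropicSubspace {n : ℕ} (W : Submodule ℝ (Ecl n)) : Prop :=
  ∀ v ∈ W, ∀ w ∈ W, @inner ℝ _ _ (Complex.I • v) w = 0

/-- A real `k`-dimensional subspace `E ⊆ ℂⁿ` is of type `(k,q)` if it is the orthogonal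
direct sum of a complex subspace of complex dimension `q` and an isotropic real subspace of
dimension `k − 2q`. -/
def IsTypeSubspace {n : ℕ} (k q : ℕ) (E : Submodule ℝ (Ecl n)) : Prop :=
  Module.finrank ℝ E = k ∧
    ∃ F W : Submodule ℝ (Ecl n), IsComplexSubspace F ∧ Module.finrank ℝ F = 2 * q ∧
      IsIsotropicSubspace W ∧ Module.finrank ℝ W = k - 2 * q ∧
      (∀ v ∈ F, ∀ w ∈ W, @inner ℝ _ _ v w = 0) ∧ E = F ⊔ W

/-- The Klain-type normalization of the hermitian intrinsic volume `μ_{k,q}`: on convex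
bodies inside a subspace of type `(k,q')` it equals `δ_{qq'}` times the `k`-dimensional
Hausdorff measure. -/
def HermKlainCond {n : ℕ} (k q : ℕ) (μ : ConvexBody (Ecl n) → ℝ) : Prop :=
  ∀ q' : ℕ, k - n ≤ q' → q' ≤ k / 2 →
    ∀ E : Submodule ℝ (Ecl n), IsTypeSubspace k q' E →
      ∀ K : ConvexBody (Ecl n), (K : Set (Ecl n)) ⊆ (E : Set (Ecl n)) →
        μ K = if q' = q then (μH[(k : ℝ)] (K : Set (Ecl n))).toReal else 0

section Support

variable {V : Type*} [NormedAddCommGroup V] [InnerProductSpace ℝ V]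

namespace ConvexBody

/-- The support function of a convex body. -/
def supp (K : ConvexBody V) (x : V) : ℝ := sSup ((fun y => inner ℝ y x) '' (K : Set V))

theorem exists_supp (K : ConvexBody V) (x : V) :
    ∃ y ∈ K, inner ℝ y x = K.supp x ∧ ∀ z ∈ K, inner ℝ z x ≤ inner ℝ y x := by
  obtain ⟨y, hy, hm⟩ := K.isCompact.exists_isMaxOn (f := fun y => inner ℝ y x) K.nonempty
    (by fun_prop)
  have hg : IsGreatest ((fun y => inner ℝ y x) '' (K : Set V)) (inner ℝ y x) :=
    ⟨⟨y, hy, rfl⟩, by rintro _ ⟨z, hz, rfl⟩; exact hm hz⟩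
  exact ⟨y, hy, hg.csSup_eq.symm, fun z hz => hm hz⟩

theorem le_supp {K : ConvexBody V} {y : V} (hy : y ∈ K) (x : V) : inner ℝ y x ≤ K.supp x := by
  obtain ⟨z, _, h, hm⟩ := K.exists_supp x
  exact (hm y hy).trans h.le

theorem supp_le {K : ConvexBody V} {x : V} {r : ℝ} (h : ∀ y ∈ K, inner ℝ y x ≤ r) :
    K.supp x ≤ r := by
  obtain ⟨z, hz, h', _⟩ := K.exists_supp x
  exact h' ▸ h z hz

theorem supp_eq {K : ConvexBody V} {x y : V} (hy : y ∈ K) (h : ∀ z ∈ K, inner ℝ z x ≤ inner ℝ y x) :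
    K.supp x = inner ℝ y x := le_antisymm (supp_le h) (le_supp hy x)

theorem supp_add_body (K L : ConvexBody V) (x : V) : (K + L).supp x = K.supp x + L.supp x := by
  obtain ⟨y, hy, h, _⟩ := K.exists_supp x
  obtain ⟨z, hz, h', _⟩ := L.exists_supp x
  apply le_antisymm
  · apply supp_le
    rintro _ ⟨a, ha, b, hb, rfl⟩
    rw [inner_add_left]
    exact add_le_add (le_supp ha x) (le_supp hb x)
  · rw [← h, ← h', ← inner_add_left]
    exact le_supp (Set.add_mem_add hy hz) x

theorem supp_smul_body (t : ℝ) (K : ConvexBody V) (x : V) : (t • K).supp x = K.supp (t • x) := by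
  obtain ⟨y, hy, h, _⟩ := K.exists_supp (t • x)
  apply le_antisymm
  · apply supp_le
    rintro _ ⟨a, ha, rfl⟩
    simpa [inner_smul_left, inner_smul_right] using le_supp ha (t • x)
  · have := le_supp (K := t • K) (Set.smul_mem_smul_set hy) x
    rw [← h]
    simpa [inner_smul_left, inner_smul_right] using this

theorem supp_smul (K : ConvexBody V) {t : ℝ} (ht : 0 ≤ t) (x : V) :
    K.supp (t • x) = t * K.supp x := by
  obtain ⟨y, hy, h, hm⟩ := K.exists_supp x
  rw [← h, supp_eq hy fun z hz => ?_, inner_smul_right]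
  simp only [inner_smul_right]
  exact mul_le_mul_of_nonneg_left (hm z hz) ht

theorem supp_add_le (K : ConvexBody V) (x y : V) : K.supp (x + y) ≤ K.supp x + K.supp y := by
  apply supp_le
  intro z hz
  rw [inner_add_right]
  exact add_le_add (le_supp hz x) (le_supp hz y)

@[simp] theorem supp_apply_zero (K : ConvexBody V) : K.supp 0 = 0 := by
  simpa using K.supp_smul le_rfl (0 : V)

@[simp] theorem supp_zero (x : V) : (0 : ConvexBody V).supp x = 0 := by
  have := supp_eq (K := (0 : ConvexBody V)) (x := x) (y := 0) rfl (by
    intro z hz; obtain rfl : z = 0 := hz; rfl)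
  simpa using this

theorem supp_mono {K L : ConvexBody V} (h : (K : Set V) ⊆ L) (x : V) : K.supp x ≤ L.supp x :=
  supp_le fun _ hy => le_supp (h hy) x

section Complete
variable [CompleteSpace V]

theorem mem_of_inner_le_supp {K : ConvexBody V} {y : V} (h : ∀ x, inner ℝ y x ≤ K.supp x) :
    y ∈ K := by
  by_contra hy
  obtain ⟨f, u, h1, h2⟩ := geometric_hahn_banach_closed_point K.convex K.isClosed hy
  obtain ⟨w, rfl⟩ := (InnerProductSpace.toDual ℝ V).surjective f
  simp only [InnerProductSpace.toDual_apply_apply] at h1 h2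
  have h3 := h w
  obtain ⟨z, hz, h', _⟩ := K.exists_supp w
  have := h1 z hz
  rw [real_inner_comm] at this h2
  linarith

theorem subset_of_supp_le {K L : ConvexBody V} (h : ∀ x, K.supp x ≤ L.supp x) :
    (K : Set V) ⊆ L := fun _ hy => mem_of_inner_le_supp fun x => (le_supp hy x).trans (h x)

theorem ext_supp {K L : ConvexBody V} (h : ∀ x, K.supp x = L.supp x) : K = L :=
  ConvexBody.ext ((subset_of_supp_le fun x => (h x).le).antisymm
    (subset_of_supp_le fun x => (h x).ge))

end Complete

theorem supp_sub_le_dist (K L : ConvexBody V) (x : V) :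
    K.supp x - L.supp x ≤ dist K L * ‖x‖ := by
  obtain ⟨y, hy, h, _⟩ := K.exists_supp x
  obtain ⟨z, hz, hd⟩ := L.isCompact.exists_infDist_eq_dist L.nonempty y
  have h1 : dist y z ≤ dist K L := by
    rw [← hd, ← ConvexBody.hausdorffDist_coe]
    exact Metric.infDist_le_hausdorffDist_of_mem hy ConvexBody.hausdorffEDist_ne_top
  have h2 := le_supp hz x
  have h3 : inner ℝ (y - z) x ≤ ‖y - z‖ * ‖x‖ := real_inner_le_norm _ _
  rw [inner_sub_left, ← dist_eq_norm] at h3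
  have := mul_le_mul_of_nonneg_right h1 (norm_nonneg x)
  linarith

theorem abs_supp_sub_le (K L : ConvexBody V) (x : V) :
    |K.supp x - L.supp x| ≤ dist K L * ‖x‖ := by
  rw [abs_le]
  have := supp_sub_le_dist L K x
  rw [dist_comm] at this
  exact ⟨by linarith, supp_sub_le_dist K L x⟩

/-- The segment from `0` to `v`. -/
def seg (v : V) : ConvexBody V :=
  ⟨segment ℝ 0 v, convex_segment _ _, by
    rw [segment_eq_image_lineMap]
    exact isCompact_Icc.image (by fun_prop), ⟨0, left_mem_segment _ _ _⟩⟩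

theorem mem_seg {v x : V} : x ∈ seg v ↔ ∃ t : ℝ, 0 ≤ t ∧ t ≤ 1 ∧ t • v = x := by
  change x ∈ segment ℝ 0 v ↔ _
  rw [segment_eq_image]
  simp [and_assoc]

theorem supp_seg (v x : V) : (seg v).supp x = max 0 (inner ℝ v x) := by
  apply le_antisymm
  · apply supp_le
    intro y hy
    obtain ⟨t, h0, h1, rfl⟩ := mem_seg.1 hy
    rw [real_inner_smul_left]
    rcases le_total 0 (inner ℝ v x) with h | h
    · rw [max_eq_right h]; nlinarith
    · rw [max_eq_left h]; nlinarith
  · apply max_le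
    · simpa using le_supp (show (0 : V) ∈ seg v from left_mem_segment ℝ 0 v) x
    · exact le_supp (show v ∈ seg v from right_mem_segment ℝ 0 v) x

/-- The one-point body. -/
def point (v : V) : ConvexBody V :=
  ⟨{v}, convex_singleton v, isCompact_singleton, Set.singleton_nonempty v⟩

theorem supp_point (v x : V) : (point v).supp x = inner ℝ v x :=
  supp_eq rfl fun z hz => by obtain rfl : z = v := hz; rfl

theorem translate_eq (K : ConvexBody V) (v : V) : K.translate v = K + point v := rfl

theorem dilate_eq (K : ConvexBody V) (t : ℝ) : K.dilate t = t • K := rfl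

theorem reflect_eq (K : ConvexBody V) : K.reflect = (-1 : ℝ) • K := by
  apply ConvexBody.ext
  change -(K : Set V) = (-1 : ℝ) • (K : Set V)
  simp

theorem supp_reflect (K : ConvexBody V) (x : V) : K.reflect.supp x = K.supp (-x) := by
  rw [reflect_eq, supp_smul_body]; simp

/-- The image of a convex body under a continuous linear map. -/
def map {W : Type*} [NormedAddCommGroup W] [InnerProductSpace ℝ W] (f : V →L[ℝ] W)
    (K : ConvexBody V) : ConvexBody W :=
  ⟨f '' K, K.convex.linear_image f.toLinearMap, K.isCompact.image f.continuous,
    K.nonempty.image f⟩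

section Map
variable {W : Type*} [NormedAddCommGroup W] [InnerProductSpace ℝ W]

@[simp] theorem coe_map (f : V →L[ℝ] W) (K : ConvexBody V) : (K.map f : Set W) = f '' K := rfl

theorem supp_map' {f : V →L[ℝ] W} {x : W} {y : V} (h : ∀ v, inner ℝ (f v) x = inner ℝ v y)
    (K : ConvexBody V) : (K.map f).supp x = K.supp y := by
  obtain ⟨z, hz, h', hm⟩ := K.exists_supp y
  rw [← h', supp_eq (K := K.map f) ⟨z, hz, rfl⟩, h]
  rintro _ ⟨a, ha, rfl⟩
  rw [h, h]
  exact hm a ha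

theorem supp_map [CompleteSpace V] [CompleteSpace W] (f : V →L[ℝ] W) (K : ConvexBody V) (x : W) :
    (K.map f).supp x = K.supp (f.adjoint x) :=
  supp_map' (fun v => by rw [ContinuousLinearMap.adjoint_inner_right]) K

theorem map_add (f : V →L[ℝ] W) (K L : ConvexBody V) :
    (K + L).map f = K.map f + L.map f := ConvexBody.ext (Set.image_add f)

theorem map_smul (f : V →L[ℝ] W) (t : ℝ) (K : ConvexBody V) :
    (t • K).map f = t • K.map f := ConvexBody.ext (image_smul_set ..)

theorem map_seg (f : V →L[ℝ] W) (v : V) : (seg v).map f = seg (f v) := by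
  apply ConvexBody.ext
  change f '' segment ℝ 0 v = segment ℝ 0 (f v)
  have := image_segment ℝ f.toLinearMap.toAffineMap 0 v
  simpa using this

theorem map_point (f : V →L[ℝ] W) (v : V) : (point v).map f = point (f v) :=
  ConvexBody.ext Set.image_singleton

@[simp] theorem map_zero (f : V →L[ℝ] W) : (0 : ConvexBody V).map f = 0 := by
  apply ConvexBody.ext
  change f '' {0} = {0}
  simp

end Map

theorem supp_lipschitz (K : ConvexBody V) : ∃ C : ℝ≥0, LipschitzWith C K.supp := by
  obtain ⟨C, hC⟩ := K.isBounded.exists_norm_le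
  refine ⟨C.toNNReal, LipschitzWith.of_le_add_mul _ fun x y => ?_⟩
  apply supp_le
  intro z hz
  have h1 := le_supp hz y
  have h2 := real_inner_le_norm z (x - y)
  rw [inner_sub_right] at h2
  have h3 : ‖z‖ ≤ C.toNNReal := (hC z hz).trans (Real.le_coe_toNNReal C)
  have := mul_le_mul_of_nonneg_right h3 (norm_nonneg (x - y))
  rw [dist_eq_norm]
  linarith

theorem continuous_supp (K : ConvexBody V) : Continuous K.supp :=
  let ⟨_, h⟩ := K.supp_lipschitz
  h.continuous

section FiniteDim
variable [FiniteDimensional ℝ V]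

/-- The closed ball of radius `r ≥ 0` around the origin. -/
def ball (r : ℝ≥0) : ConvexBody V :=
  ⟨Metric.closedBall 0 r, convex_closedBall _ _, isCompact_closedBall _ _,
    ⟨0, by simp⟩⟩

theorem supp_ball (r : ℝ≥0) (x : V) : (ball r : ConvexBody V).supp x = r * ‖x‖ := by
  apply le_antisymm
  · apply supp_le
    intro y hy
    have : ‖y‖ ≤ r := by simpa using (show y ∈ Metric.closedBall (0 : V) r from hy)
    exact (real_inner_le_norm _ _).trans (mul_le_mul_of_nonneg_right this (norm_nonneg _))
  · by_cases hx : x = 0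
    · simp [hx]
    have hx' : 0 < ‖x‖ := norm_pos_iff.2 hx
    have hm : (r / ‖x‖ : ℝ) • x ∈ (ball r : ConvexBody V) := by
      change _ ∈ Metric.closedBall (0 : V) r
      simp [norm_smul, hx'.ne']
    have := le_supp hm x
    rw [real_inner_smul_left, real_inner_self_eq_norm_sq] at this
    calc (r : ℝ) * ‖x‖ = r / ‖x‖ * ‖x‖ ^ 2 := by field_simp
      _ ≤ _ := this

theorem dist_le_of_supp {K L : ConvexBody V} {r : ℝ} (hr : 0 ≤ r)
    (h : ∀ x, |K.supp x - L.supp x| ≤ r * ‖x‖) : dist K L ≤ r := by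
  have key : ∀ K L : ConvexBody V, (∀ x, |K.supp x - L.supp x| ≤ r * ‖x‖) → ∀ y ∈ K, ∃ z ∈ L,
      dist y z ≤ r := by
    intro K L h y hy
    have : y ∈ L + ball (NNReal.mk r hr) := by
      apply mem_of_inner_le_supp
      intro x
      rw [supp_add_body, supp_ball]
      have h1 := le_supp hy x
      have h2 := abs_le.1 (h x)
      rw [NNReal.coe_mk]
      linarith
    obtain ⟨z, hz, b, hb, rfl⟩ := this
    refine ⟨z, hz, ?_⟩
    simpa [dist_eq_norm] using (show b ∈ Metric.closedBall (0 : V) r from hb)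
  rw [← ConvexBody.hausdorffDist_coe]
  apply Metric.hausdorffDist_le_of_mem_dist hr (key K L h)
  apply key L K
  intro x
  rw [abs_sub_comm]
  exact h x

theorem dist_add_add_body_le (K L K' L' : ConvexBody V) :
    dist (K + L) (K' + L') ≤ dist K K' + dist L L' := by
  apply dist_le_of_supp (by positivity)
  intro x
  rw [supp_add_body, supp_add_body]
  have h1 := abs_supp_sub_le K K' x
  have h2 := abs_supp_sub_le L L' x
  calc _ = |(K.supp x - K'.supp x) + (L.supp x - L'.supp x)| := by ring_nf
    _ ≤ _ := abs_add_le _ _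
    _ ≤ _ := by linarith

instance : ContinuousAdd (ConvexBody V) := by
  refine ⟨?_⟩
  have : LipschitzWith 2 fun p : ConvexBody V × ConvexBody V => p.1 + p.2 := by
    apply LipschitzWith.of_dist_le_mul
    rintro ⟨K, L⟩ ⟨K', L'⟩
    refine (dist_add_add_body_le ..).trans ?_
    have h1 : dist K K' ≤ dist (K, L) (K', L') := le_max_left _ _
    have h2 : dist L L' ≤ dist (K, L) (K', L') := le_max_right _ _
    push_cast
    linarith
  exact this.continuous

theorem continuous_seg : Continuous (seg : V → ConvexBody V) := by
  have : LipschitzWith 1 (seg : V → ConvexBody V) := by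
    apply LipschitzWith.of_dist_le_mul
    intro v w
    rw [NNReal.coe_one, one_mul]
    apply dist_le_of_supp (by positivity)
    intro x
    rw [supp_seg, supp_seg]
    refine (abs_max_sub_max_le_max _ _ _ _).trans ?_
    rw [sub_self, abs_zero, ← inner_sub_left, dist_eq_norm]
    exact max_le (by positivity) (abs_real_inner_le_norm _ _)
  exact this.continuous

theorem continuous_smul_body (t : ℝ) : Continuous fun K : ConvexBody V => t • K := by
  have : LipschitzWith ‖t‖₊ fun K : ConvexBody V => t • K := by
    apply LipschitzWith.of_dist_le_mul
    intro K L
    apply dist_le_of_supp (by positivity)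
    intro x
    rw [supp_smul_body, supp_smul_body]
    refine (abs_supp_sub_le K L (t • x)).trans (le_of_eq ?_)
    rw [norm_smul, coe_nnnorm]; ring
  exact this.continuous

theorem continuous_smul_left (K : ConvexBody V) : Continuous fun t : ℝ => t • K := by
  obtain ⟨C, hC⟩ := K.supp_lipschitz
  have : LipschitzWith C fun t : ℝ => t • K := by
    apply LipschitzWith.of_dist_le_mul
    intro s t
    apply dist_le_of_supp (by positivity)
    intro x
    rw [supp_smul_body, supp_smul_body, ← Real.dist_eq]
    refine (hC.dist_le_mul _ _).trans (le_of_eq ?_)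
    rw [dist_eq_norm, ← sub_smul, norm_smul, dist_eq_norm, mul_assoc]
  exact this.continuous

theorem continuous_map {W : Type*} [NormedAddCommGroup W] [InnerProductSpace ℝ W]
    [FiniteDimensional ℝ W] (f : V →L[ℝ] W) : Continuous fun K : ConvexBody V => K.map f := by
  have : LipschitzWith ‖f‖₊ fun K : ConvexBody V => K.map f := by
    apply LipschitzWith.of_dist_le_mul
    intro K L
    apply dist_le_of_supp (by positivity)
    intro x
    rw [supp_map, supp_map]
    refine (abs_supp_sub_le K L _).trans ?_
    have h := f.adjoint.le_opNorm x
    rw [LinearIsometryEquiv.norm_map] at h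
    have := mul_le_mul_of_nonneg_left h (dist_nonneg (x := K) (y := L))
    rw [coe_nnnorm]
    linarith
  exact this.continuous

theorem exists_supp_eq {h : V → ℝ} (h_smul : ∀ t : ℝ, 0 < t → ∀ x, h (t • x) = t * h x)
    (h_add : ∀ x y, h (x + y) ≤ h x + h y) : ∃ K : ConvexBody V, ∀ x, K.supp x = h x := by
  have h0 : h 0 = 0 := by
    have := h_smul 2 (by norm_num) 0
    rw [smul_zero] at this
    linarith
  have hsub : ∀ x, ∃ y : V, (∀ z, inner ℝ y z ≤ h z) ∧ inner ℝ y x = h x := by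
    intro x
    by_cases hx : x = 0
    · obtain ⟨g, -, hg⟩ := exists_extension_of_le_sublinear (E := V) ⊥ h h_smul h_add (by
        rintro ⟨y, hy⟩
        obtain rfl : y = 0 := (Submodule.mem_bot ℝ).1 hy
        exact ((LinearMap.map_zero _).trans h0.symm).le)
      refine ⟨(InnerProductSpace.toDual ℝ V).symm (LinearMap.toContinuousLinearMap g),
        fun z => ?_, ?_⟩
      · simpa using hg z
      · simp [hx, h0]
    · obtain ⟨g, h1, hg⟩ := exists_extension_of_le_sublinear
        (LinearPMap.mkSpanSingleton (K := ℝ) x (h x) hx) h h_smul h_add (by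
        rintro ⟨y, hy⟩
        obtain ⟨c, rfl⟩ := Submodule.mem_span_singleton.1 hy
        have e : LinearPMap.mkSpanSingleton (K := ℝ) x (h x) hx ⟨c • x, hy⟩ = c * h x :=
          LinearPMap.mkSpanSingleton'_apply ..
        rw [e]
        change c * h x ≤ h (c • x)
        rcases lt_trichotomy c 0 with hc | rfl | hc
        · have e1 := h_smul (-c) (by linarith) x
          have e2 := h_add (c • x) (-c • x)
          rw [← add_smul, add_neg_cancel, zero_smul, h0] at e2
          linarith
        · simp [h0]
        · rw [h_smul c hc])
      refine ⟨(InnerProductSpace.toDual ℝ V).symm (LinearMap.toContinuousLinearMap g),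
        fun z => ?_, ?_⟩
      · simpa using hg z
      · have h2 := h1 ⟨x, Submodule.mem_span_singleton_self x⟩
        have h3 : LinearPMap.mkSpanSingleton (σ := RingHom.id ℝ) x (h x) hx
            ⟨x, Submodule.mem_span_singleton_self x⟩ = h x :=
          LinearPMap.mkSpanSingleton_apply ℝ ℝ hx (h x)
        rw [h3] at h2
        simpa using h2
  let S : Set V := {y | ∀ z, inner ℝ y z ≤ h z}
  have hSc : Convex ℝ S := by
    intro a ha b hb s t hs ht hst z
    rw [inner_add_left, real_inner_smul_left, real_inner_smul_left]
    calc s * inner ℝ a z + t * inner ℝ b z ≤ s * h z + t * h z :=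
          add_le_add (mul_le_mul_of_nonneg_left (ha z) hs) (mul_le_mul_of_nonneg_left (hb z) ht)
      _ = h z := by rw [← add_mul, hst, one_mul]
  have hScl : IsClosed S := by
    have : S = ⋂ z, {y | inner ℝ y z ≤ h z} := by ext; simp [S]
    rw [this]
    exact isClosed_iInter fun z => isClosed_le (by fun_prop) continuous_const
  have hSb : Bornology.IsBounded S := by
    let b := stdOrthonormalBasis ℝ V
    refine isBounded_iff_forall_norm_le.2 ⟨∑ i, (|h (b i)| + |h (-b i)|), fun y hy => ?_⟩
    rw [← b.sum_repr y]
    refine (norm_sum_le _ _).trans (Finset.sum_le_sum fun i _ => ?_)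
    rw [norm_smul, b.norm_eq_one, mul_one, b.repr_apply_apply, real_inner_comm, Real.norm_eq_abs,
      abs_le]
    have h1 := hy (b i)
    have h2 := hy (-b i)
    rw [inner_neg_right] at h2
    have := le_abs_self (h (b i))
    have := le_abs_self (h (-b i))
    have := abs_nonneg (h (b i))
    have := abs_nonneg (h (-b i))
    constructor <;> linarith
  obtain ⟨y0, hy0, _⟩ := hsub 0
  refine ⟨⟨S, hSc, Metric.isCompact_of_isClosed_isBounded hScl hSb, ⟨y0, hy0⟩⟩, fun x => ?_⟩
  obtain ⟨y, hy, hyx⟩ := hsub x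
  rw [← hyx]
  exact supp_eq (y := y) hy fun z hz => by rw [hyx]; exact hz x

end FiniteDim

end ConvexBody

end Support

section Valuations

variable {V : Type*} [NormedAddCommGroup V] [InnerProductSpace ℝ V]

/-- Continuous translation invariant valuations, homogeneous of degree `k`. -/
structure IsVal (k : ℕ) (μ : ConvexBody V → ℝ) : Prop where
  val : IsValuation μ
  cont : Continuous μ
  ti : TransInv μ
  hom : Homog k μ

/-- The difference of a functional on convex bodies along a segment. -/
def segDiff (v : V) (μ : ConvexBody V → ℝ) (K : ConvexBody V) : ℝ :=
  μ (K + ConvexBody.seg v) - μ K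

/-- The zonotope spanned by a list of vectors. -/
def zon (l : List V) : ConvexBody V := (l.map ConvexBody.seg).sum

@[simp] theorem zon_nil : zon ([] : List V) = 0 := rfl

@[simp] theorem zon_cons (v : V) (l : List V) : zon (v :: l) = ConvexBody.seg v + zon l := by
  simp [zon]

@[simp] theorem zon_append (l m : List V) : zon (l ++ m) = zon l + zon m := by
  simp [zon]

theorem zon_perm {l m : List V} (h : l.Perm m) : zon l = zon m :=
  (h.map ConvexBody.seg).sum_eq

/-- The support function determines when two closed convex pieces overlap after adding a body. -/
theorem inter_add_eq {A B C : Set V} (hA : IsClosed A) (hB : IsClosed B)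
    (hAB : Convex ℝ (A ∪ B)) (hC : Convex ℝ C) : (A ∩ B) + C = (A + C) ∩ (B + C) := by
  apply Set.Subset.antisymm (Set.inter_add_subset)
  rintro z ⟨⟨a, ha, c, hc, h1⟩, ⟨b, hb, d, hd, h2⟩⟩
  let f : ℝ → V := fun t => (1 - t) • a + t • b
  have hf : Continuous f := by fun_prop
  have hcov : Set.Icc (0 : ℝ) 1 ⊆ f ⁻¹' A ∪ f ⁻¹' B := fun t ht =>
    hAB (Or.inl ha) (Or.inr hb) (sub_nonneg.2 ht.2) ht.1 (by ring)
  obtain ⟨t, ht, htA, htB⟩ := isPreconnected_closed_iff.1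
    (isPreconnected_Icc (a := (0 : ℝ)) (b := 1))
    _ _ (hA.preimage hf) (hB.preimage hf) hcov ⟨0, by simp, by simpa [f] using ha⟩
    ⟨1, by simp, by simpa [f] using hb⟩
  refine ⟨f t, ⟨htA, htB⟩, (1 - t) • c + t • d,
    hC hc hd (sub_nonneg.2 ht.2) ht.1 (by ring), ?_⟩
  calc f t + ((1 - t) • c + t • d) = (1 - t) • (a + c) + t • (b + d) := by
        simp only [f, smul_add]; abel
    _ = z := by
        change a + c = z at h1
        change b + d = z at h2
        rw [h1, h2, ← add_smul]; simp

theorem IsValuation.add_body {μ : ConvexBody V → ℝ} (h : IsValuation μ) (C : ConvexBody V) :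
    IsValuation fun K => μ (K + C) := by
  intro K L M I hM hI
  apply h
  · simp [hM, Set.union_add]
  · rw [ConvexBody.coe_add, hI, inter_add_eq K.isClosed L.isClosed (hM ▸ M.convex) C.convex]
    rfl

theorem TransInv.add_point {μ : ConvexBody V → ℝ} (h : TransInv μ) (K : ConvexBody V) (x : V) :
    μ (K + ConvexBody.point x) = μ K := h K x

namespace ConvexBody

@[simp] theorem seg_zero : seg (0 : V) = 0 := by
  apply ConvexBody.ext
  change segment ℝ (0 : V) 0 = {0}
  simp

theorem seg_add_smul {a b : ℝ} (ha : 0 ≤ a) (hb : 0 ≤ b) (v : V) :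
    seg (a • v) + seg (b • v) = seg ((a + b) • v) := by
  apply ConvexBody.ext
  ext x
  constructor
  · rintro ⟨y, hy, z, hz, rfl⟩
    obtain ⟨s, hs0, hs1, rfl⟩ := mem_seg.1 hy
    obtain ⟨t, ht0, ht1, rfl⟩ := mem_seg.1 hz
    change s • a • v + t • b • v ∈ seg ((a + b) • v)
    rcases eq_or_lt_of_le (add_nonneg ha hb) with h | h
    · obtain rfl : a = 0 := by linarith
      obtain rfl : b = 0 := by linarith
      exact mem_seg.2 ⟨0, by simp⟩
    · refine mem_seg.2 ⟨(s * a + t * b) / (a + b), by positivity, ?_, ?_⟩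
      · rw [div_le_one h]; nlinarith
      · rw [smul_smul, div_mul_cancel₀ _ h.ne', add_smul, smul_smul, smul_smul]
  · intro hx
    obtain ⟨s, hs0, hs1, rfl⟩ := mem_seg.1 hx
    refine ⟨s • a • v, mem_seg.2 ⟨s, hs0, hs1, rfl⟩, s • b • v, mem_seg.2 ⟨s, hs0, hs1, rfl⟩, ?_⟩
    simp only [add_smul, smul_add]

theorem seg_neg_add (v : V) : seg (-v) + point v = seg v := by
  apply ConvexBody.ext
  ext x
  constructor
  · rintro ⟨y, hy, z, hz, rfl⟩
    obtain ⟨s, hs0, hs1, rfl⟩ := mem_seg.1 hy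
    obtain rfl : z = v := hz
    exact mem_seg.2 ⟨1 - s, by linarith, by linarith, by module⟩
  · intro hx
    obtain ⟨s, hs0, hs1, rfl⟩ := mem_seg.1 hx
    exact ⟨(1 - s) • -v, mem_seg.2 ⟨1 - s, by linarith, by linarith, rfl⟩, v, rfl, by
      simp only; module⟩

theorem smul_seg (t : ℝ) (v : V) : t • seg v = seg (t • v) := by
  apply ConvexBody.ext
  ext x
  constructor
  · rintro ⟨y, hy, rfl⟩
    obtain ⟨s, hs0, hs1, rfl⟩ := mem_seg.1 hy
    exact mem_seg.2 ⟨s, hs0, hs1, smul_comm _ _ _⟩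
  · intro hx
    obtain ⟨s, hs0, hs1, rfl⟩ := mem_seg.1 hx
    exact ⟨s • v, mem_seg.2 ⟨s, hs0, hs1, rfl⟩, smul_comm _ _ _⟩

end ConvexBody

open ConvexBody

theorem map_zon {W : Type*} [NormedAddCommGroup W] [InnerProductSpace ℝ W] (f : V →L[ℝ] W)
    (l : List V) : (zon l).map f = zon (l.map f) := by
  induction l with
  | nil => simp
  | cons v l ih => rw [zon_cons, ConvexBody.map_add, ih, map_seg, List.map_cons, zon_cons]

theorem smul_zon (t : ℝ) (l : List V) : t • zon l = zon (l.map (t • ·)) := by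
  induction l with
  | nil => simp
  | cons v l ih => rw [zon_cons, smul_add, ih, smul_seg, List.map_cons, zon_cons]

theorem IsValuation.add_seg {μ : ConvexBody V → ℝ} (h : IsValuation μ) (ht : TransInv μ)
    (K : ConvexBody V) (v : V) {a b : ℝ} (ha : 0 ≤ a) (hb : 0 ≤ b) :
    μ (K + seg ((a + b) • v)) + μ K = μ (K + seg (a • v)) + μ (K + seg (b • v)) := by
  by_cases hv : v = 0
  · simp [hv]
  have := h.add_body K (seg (a • v)) (seg (b • v) + point (a • v)) (seg ((a + b) • v))
    (point (a • v)) ?_ ?_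
  · simp only at this
    rw [add_comm (point _) K, ht.add_point, add_right_comm, ht.add_point, add_comm _ K,
      add_comm _ K, add_comm _ K] at this
    exact this
  · ext x
    constructor
    · intro hx
      obtain ⟨s, hs0, hs1, rfl⟩ := mem_seg.1 hx
      rcases le_total (s * (a + b)) a with h1 | h1
      · left
        refine mem_seg.2 ?_
        rcases eq_or_lt_of_le ha with rfl | ha
        · refine ⟨0, le_rfl, zero_le_one, ?_⟩
          rw [smul_smul s, show s * (0 + b) = 0 from le_antisymm h1 (by positivity)]; simp
        · refine ⟨s * (a + b) / a, by positivity, (div_le_one ha).2 h1, ?_⟩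
          rw [smul_smul, smul_smul, div_mul_cancel₀ _ ha.ne']
      · right
        rcases eq_or_lt_of_le hb with rfl | hb
        · refine ⟨0, mem_seg.2 ⟨0, by simp⟩, a • v, rfl, ?_⟩
          have : s * a = a := by nlinarith
          simp [smul_smul, this]
        · refine ⟨((s * (a + b) - a) / b) • b • v, mem_seg.2 ⟨_, ?_, ?_, rfl⟩, a • v, rfl, ?_⟩
          · apply div_nonneg <;> linarith
          · rw [div_le_one hb]; nlinarith
          · simp only [smul_smul, div_mul_cancel₀ _ hb.ne', ← add_smul]
            ring_nf
    · rw [← seg_add_smul ha hb]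
      rintro (hx | ⟨y, hy, z, hz, rfl⟩)
      · exact ⟨x, hx, 0, mem_seg.2 ⟨0, by simp⟩, by simp⟩
      · obtain rfl : z = a • v := hz
        exact ⟨a • v, mem_seg.2 ⟨1, by simp⟩, y, hy, add_comm _ _⟩
  · ext x
    constructor
    · intro hx
      obtain rfl : x = a • v := hx
      exact ⟨mem_seg.2 ⟨1, by simp⟩, 0, mem_seg.2 ⟨0, by simp⟩, a • v, rfl, by simp⟩
    · rintro ⟨hx, y, hy, z, hz, rfl⟩
      obtain rfl : z = a • v := hz
      obtain ⟨s, hs0, hs1, rfl⟩ := mem_seg.1 hy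
      obtain ⟨t, ht0, ht1, h2⟩ := mem_seg.1 hx
      simp only [smul_smul, ← add_smul] at h2 ⊢
      have h3 := smul_left_injective ℝ hv h2
      have : s * b + a = a := by nlinarith [mul_nonneg hs0 hb]
      rw [this]
      rfl

theorem linear_of_additive_of_nonneg {f : ℝ → ℝ} (hf : Continuous f)
    (hadd : ∀ a b, 0 ≤ a → 0 ≤ b → f (a + b) = f a + f b) {a : ℝ} (ha : 0 ≤ a) :
    f a = a * f 1 := by
  let F : ℝ → ℝ := fun a => f (max a 0) - f (max (-a) 0)
  have key : ∀ x y, 0 ≤ x → 0 ≤ y → F (x - y) = f x - f y := by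
    intro x y hx hy
    have h1 := hadd (max (x - y) 0) y (le_max_right _ _) hy
    have h2 := hadd (max (-(x - y)) 0) x (le_max_right _ _) hx
    have : max (x - y) 0 + y = max (-(x - y)) 0 + x := by
      rcases le_total x y with h | h
      · rw [max_eq_right (by linarith), max_eq_left (by linarith)]; ring
      · rw [max_eq_left (by linarith), max_eq_right (by linarith)]; ring
    rw [this] at h1
    simp only [F]
    linarith
  have hsplit : ∀ a : ℝ, a = max a 0 - max (-a) 0 := by
    intro a
    rcases le_total a 0 with h | h
    · rw [max_eq_right h, max_eq_left (by linarith)]; ring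
    · rw [max_eq_left h, max_eq_right (by linarith)]; ring
  let G : ℝ →+ ℝ := AddMonoidHom.mk' F (by
    intro a b
    have h1 := key (max a 0 + max b 0) (max (-a) 0 + max (-b) 0) (by positivity) (by positivity)
    rw [hadd _ _ (le_max_right _ _) (le_max_right _ _),
      hadd _ _ (le_max_right _ _) (le_max_right _ _)] at h1
    have : max a 0 + max b 0 - (max (-a) 0 + max (-b) 0) = a + b := by
      rw [add_sub_add_comm, ← hsplit, ← hsplit]
    rw [this] at h1
    rw [h1]
    simp only [F]; ring)
  have hG : Continuous G := by
    change Continuous F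
    fun_prop
  have h0 : f 0 = 0 := by simpa using hadd 0 0 le_rfl le_rfl
  have h := map_real_smul G hG a 1
  have e : ∀ a, 0 ≤ a → G a = f a := by
    intro a ha
    change f (max a 0) - f (max (-a) 0) = f a
    rw [max_eq_left ha, max_eq_right (by linarith), h0, sub_zero]
  simpa [e a ha, e 1 zero_le_one] using h

variable [FiniteDimensional ℝ V]

theorem segDiff_smul {μ : ConvexBody V → ℝ} (h : IsValuation μ) (hc : Continuous μ)
    (ht : TransInv μ) (K : ConvexBody V) (v : V) {a : ℝ} (ha : 0 ≤ a) :
    segDiff (a • v) μ K = a * segDiff v μ K := by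
  have := linear_of_additive_of_nonneg (f := fun a => segDiff (a • v) μ K) ?_ ?_ ha
  · simpa using this
  · unfold segDiff
    refine (hc.comp (continuous_const.add (continuous_seg.comp ?_))).sub continuous_const
    fun_prop
  · intro a b ha hb
    have := h.add_seg ht K v ha hb
    simp only [segDiff]
    linarith

omit [FiniteDimensional ℝ V] in
theorem segDiff_neg {μ : ConvexBody V → ℝ} (ht : TransInv μ) (K : ConvexBody V) (v : V) :
    segDiff (-v) μ K = segDiff v μ K := by
  unfold segDiff
  rw [← seg_neg_add v, ← add_assoc, ht.add_point]

theorem segDiff_smul_abs {μ : ConvexBody V → ℝ} (h : IsValuation μ) (hc : Continuous μ)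
    (ht : TransInv μ) (K : ConvexBody V) (v : V) (a : ℝ) :
    segDiff (a • v) μ K = |a| * segDiff v μ K := by
  rw [← segDiff_smul h hc ht K v (abs_nonneg a)]
  rcases abs_choice a with h | h <;> rw [h]
  rw [neg_smul, segDiff_neg ht]

theorem IsVal.isVal_segDiff {k : ℕ} {μ : ConvexBody V → ℝ} (h : IsVal (k + 1) μ) (v : V) :
    IsVal k (segDiff v μ) where
  val := by
    intro K L M I hM hI
    have h1 := h.val.add_body (seg v) K L M I hM hI
    have h2 := h.val K L M I hM hI
    simp only [segDiff] at h1 ⊢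
    linarith
  cont := by
    unfold segDiff
    exact (h.cont.comp (continuous_id.add continuous_const)).sub h.cont
  ti := by
    intro K x
    unfold segDiff
    rw [translate_eq, add_right_comm, h.ti.add_point, h.ti.add_point]
  hom := by
    intro K t ht
    have h1 := h.hom (K + seg (t⁻¹ • v)) t ht
    have h2 := h.hom K t ht
    have h3 := segDiff_smul h.val h.cont h.ti K v (inv_pos.2 ht).le
    simp only [dilate_eq, smul_add, smul_seg, smul_smul, mul_inv_cancel₀ ht.ne', one_smul]
      at h1 h2 ⊢
    unfold segDiff at h3 ⊢
    rw [h1, h2, ← mul_sub, h3, pow_succ, mul_assoc, mul_inv_cancel_left₀ ht.ne']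

theorem IsVal.eq_const {μ : ConvexBody V → ℝ} (h : IsVal 0 μ) (K : ConvexBody V) : μ K = μ 0 := by
  have h1 : Filter.Tendsto (fun t : ℝ => μ (t • K)) (nhdsWithin 0 (Set.Ioi 0)) (nhds (μ 0)) := by
    have := (h.cont.comp (continuous_smul_left K)).tendsto 0
    simp only [Function.comp_apply] at this
    have e : (0 : ℝ) • K = 0 := by
      apply ConvexBody.ext
      change (0 : ℝ) • (K : Set V) = {0}
      exact Set.zero_smul_set K.nonempty
    rw [e] at this
    exact this.mono_left nhdsWithin_le_nhds
  refine tendsto_nhds_unique (tendsto_const_nhds.congr' ?_) h1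
  filter_upwards [self_mem_nhdsWithin] with t ht
  have := h.hom K t ht
  simpa [dilate_eq] using this.symm

omit [FiniteDimensional ℝ V] in
theorem IsVal.apply_zero {k : ℕ} {μ : ConvexBody V → ℝ} (h : IsVal (k + 1) μ) : μ 0 = 0 := by
  have := h.hom 0 2 (by norm_num)
  rw [dilate_eq, smul_zero] at this
  have h2 : (1 : ℝ) < 2 ^ (k + 1) := one_lt_pow₀ (by norm_num) (by simp)
  nlinarith

theorem IsVal.zon_eq_zero {k : ℕ} {μ : ConvexBody V → ℝ} (h : IsVal k μ) {l : List V}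
    (hl : l.length < k) : μ (zon l) = 0 := by
  induction l generalizing k μ with
  | nil =>
    obtain ⟨k, rfl⟩ : ∃ j, k = j + 1 := ⟨k - 1, by simp at hl; omega⟩
    exact h.apply_zero
  | cons v l ih =>
    obtain ⟨k, rfl⟩ : ∃ j, k = j + 1 := ⟨k - 1, by simp at hl; omega⟩
    simp only [List.length_cons] at hl
    have h1 := ih (h.isVal_segDiff v) (by omega)
    have h2 := ih h (by omega)
    unfold segDiff at h1
    rw [zon_cons, add_comm]
    linarith

theorem IsVal.apply_zon_cons {k : ℕ} {μ : ConvexBody V → ℝ} (h : IsVal k μ) {l : List V}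
    (hl : l.length < k) (v : V) : μ (zon (v :: l)) = segDiff v μ (zon l) := by
  rw [segDiff, h.zon_eq_zero hl, sub_zero, zon_cons, add_comm]

omit [FiniteDimensional ℝ V] in
theorem segDiff_segDiff_self {μ : ConvexBody V → ℝ} (h : IsValuation μ)
    (ht : TransInv μ) (v : V) (K : ConvexBody V) : segDiff v (segDiff v μ) K = 0 := by
  have h1 := h.add_seg ht K v zero_le_one zero_le_one
  have h2 := seg_add_smul zero_le_one zero_le_one v
  simp only [one_smul] at h1 h2
  simp only [segDiff, add_assoc, h2]
  linarith

/-- Cutting a parallelogram along its diagonals. -/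
theorem IsVal.shear_aux {μ : ConvexBody V → ℝ} (h : IsVal 2 μ) (u v : V) :
    μ (seg (u + v) + seg v) = μ (seg u + seg v) := by
  have hs : ∀ w, μ (seg w) = 0 := fun w => by
    simpa using h.zon_eq_zero (l := [w]) (by simp)
  by_cases hli : LinearIndependent ℝ ![u, v]
  · let L : ℝ × ℝ →ₗ[ℝ] V := (LinearMap.toSpanSingleton ℝ V u).coprod
      (LinearMap.toSpanSingleton ℝ V v)
    have hL : ∀ p, L p = p.1 • u + p.2 • v := fun p => by simp [L]
    have hinj : Function.Injective L := by
      rw [injective_iff_map_eq_zero]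
      rintro ⟨a, b⟩ hab
      rw [hL] at hab
      have := LinearIndependent.pair_iff.1 hli a b hab
      simp [this]
    have hLc : Continuous L := L.continuous_of_finiteDimensional
    let body : ∀ S : Set (ℝ × ℝ), Convex ℝ S → IsCompact S → S.Nonempty → ConvexBody V :=
      fun S h1 h2 h3 => ⟨L '' S, h1.linear_image L, h2.image hLc, h3.image L⟩
    let S1 : Set (ℝ × ℝ) := {p | 0 ≤ p.2 ∧ p.2 ≤ p.1 ∧ p.1 ≤ 1}
    let S2 : Set (ℝ × ℝ) := {p | 0 ≤ p.1 ∧ p.1 ≤ p.2 ∧ p.2 ≤ 1}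
    have c1 : Convex ℝ S1 := by
      rintro ⟨a, b⟩ ⟨h1, h2, h3⟩ ⟨c, d⟩ ⟨h4, h5, h6⟩ s t hs ht hst
      simp only at h1 h2 h3 h4 h5 h6
      simp only [S1, Set.mem_ofPred_eq, Prod.smul_mk, smul_eq_mul, Prod.mk_add_mk]
      exact ⟨by positivity, by nlinarith, by nlinarith⟩
    have c2 : Convex ℝ S2 := by
      rintro ⟨a, b⟩ ⟨h1, h2, h3⟩ ⟨c, d⟩ ⟨h4, h5, h6⟩ s t hs ht hst
      simp only at h1 h2 h3 h4 h5 h6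
      simp only [S2, Set.mem_ofPred_eq, Prod.smul_mk, smul_eq_mul, Prod.mk_add_mk]
      exact ⟨by positivity, by nlinarith, by nlinarith⟩
    have k1 : IsCompact S1 := by
      apply (isCompact_Icc (a := ((0 : ℝ), (0 : ℝ))) (b := (1, 1))).of_isClosed_subset
      · exact (isClosed_le continuous_const continuous_snd).inter
          ((isClosed_le continuous_snd continuous_fst).inter
            (isClosed_le continuous_fst continuous_const))
      · rintro ⟨a, b⟩ ⟨h1, h2, h3⟩
        simp only at h1 h2 h3
        exact ⟨⟨by simp; linarith, h1⟩, ⟨h3, by simp; linarith⟩⟩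
    have k2 : IsCompact S2 := by
      apply (isCompact_Icc (a := ((0 : ℝ), (0 : ℝ))) (b := (1, 1))).of_isClosed_subset
      · exact (isClosed_le continuous_const continuous_fst).inter
          ((isClosed_le continuous_fst continuous_snd).inter
            (isClosed_le continuous_snd continuous_const))
      · rintro ⟨a, b⟩ ⟨h1, h2, h3⟩
        simp only at h1 h2 h3
        exact ⟨⟨h1, by simp; linarith⟩, ⟨by simp; linarith, h3⟩⟩
    let T1 := body S1 c1 k1 ⟨0, by simp [S1]⟩
    let T2 := body S2 c2 k2 ⟨0, by simp [S2]⟩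
    have e1 := h.val T1 T2 (seg u + seg v) (seg (u + v)) ?_ ?_
    have e2 := h.val (T1 + point v) T2 (seg (u + v) + seg v) (seg u + point v) ?_ ?_
    · rw [h.ti.add_point, h.ti.add_point, hs] at e2
      rw [hs] at e1
      linarith
    · ext x
      constructor
      · rintro ⟨y, hy, z, hz, rfl⟩
        obtain ⟨a, ha0, ha1, rfl⟩ := mem_seg.1 hy
        obtain ⟨b, hb0, hb1, rfl⟩ := mem_seg.1 hz
        rcases le_total (a + b) 1 with h1 | h1
        · exact Or.inr ⟨(a, a + b), ⟨ha0, by simpa using hb0, h1⟩, by simp only [hL]; module⟩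
        · exact Or.inl ⟨L (a, a + b - 1), ⟨_, ⟨by simp; linarith, by simp; linarith, ha1⟩, rfl⟩,
            v, rfl, by simp only [hL]; module⟩
      · rintro (⟨y, ⟨⟨a, b⟩, ⟨h1, h2, h3⟩, rfl⟩, z, hz, rfl⟩ | ⟨⟨a, b⟩, ⟨h1, h2, h3⟩, rfl⟩)
        · obtain rfl : z = v := hz
          simp only at h1 h2 h3
          exact ⟨_, mem_seg.2 ⟨a, by linarith, h3, rfl⟩, _, mem_seg.2 ⟨1 + b - a, by linarith,
            by linarith, rfl⟩, by simp only [hL]; module⟩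
        · simp only at h1 h2 h3
          exact ⟨_, mem_seg.2 ⟨a, by linarith, by linarith, rfl⟩, _, mem_seg.2 ⟨b - a, by linarith,
            by linarith, rfl⟩, by simp only [hL]; module⟩
    · ext x
      constructor
      · rintro ⟨y, hy, z, hz, rfl⟩
        obtain rfl : z = v := hz
        obtain ⟨a, ha0, ha1, rfl⟩ := mem_seg.1 hy
        exact ⟨⟨L (a, 0), ⟨_, ⟨by simp, by simpa using ha0, by simpa using ha1⟩, rfl⟩, z, rfl,
          by simp only [hL]; module⟩, ⟨(a, 1), ⟨ha0, ha1, by simp⟩, by simp only [hL]; module⟩⟩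
      · rintro ⟨⟨y, ⟨⟨a, b⟩, ⟨h1, h2, h3⟩, rfl⟩, z, hz, h7⟩, ⟨⟨c, d⟩, ⟨h4, h5, h6⟩, rfl⟩⟩
        obtain rfl : z = v := hz
        have : L (a, b + 1) = L (c, d) := by rw [← h7, hL, hL]; module
        have := hinj this
        simp only [Prod.mk.injEq] at this
        obtain ⟨rfl, rfl⟩ := this
        simp only at h1 h2 h3 h4 h5 h6
        obtain rfl : b = 0 := by linarith
        exact ⟨_, mem_seg.2 ⟨a, h4, h3, rfl⟩, z, rfl, by simp only [hL]; module⟩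
    · ext x
      constructor
      · rintro ⟨y, hy, z, hz, rfl⟩
        obtain ⟨a, ha0, ha1, rfl⟩ := mem_seg.1 hy
        obtain ⟨b, hb0, hb1, rfl⟩ := mem_seg.1 hz
        rcases le_total a b with h1 | h1
        · exact Or.inr ⟨(a, b), ⟨ha0, h1, hb1⟩, hL _⟩
        · exact Or.inl ⟨(a, b), ⟨hb0, h1, ha1⟩, hL _⟩
      · rintro (⟨⟨a, b⟩, ⟨h1, h2, h3⟩, rfl⟩ | ⟨⟨a, b⟩, ⟨h1, h2, h3⟩, rfl⟩) <;>
        · simp only at h1 h2 h3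
          exact ⟨_, mem_seg.2 ⟨a, by linarith, by linarith, rfl⟩, _, mem_seg.2 ⟨b, by linarith,
            by linarith, rfl⟩, by simp only [hL]⟩
    · ext x
      constructor
      · intro hx
        obtain ⟨a, ha0, ha1, rfl⟩ := mem_seg.1 hx
        exact ⟨⟨(a, a), ⟨ha0, le_rfl, ha1⟩, by rw [hL, smul_add]⟩,
          ⟨(a, a), ⟨ha0, le_rfl, ha1⟩, by rw [hL, smul_add]⟩⟩
      · rintro ⟨⟨⟨a, b⟩, ⟨h1, h2, h3⟩, rfl⟩, ⟨⟨c, d⟩, ⟨h4, h5, h6⟩, h7⟩⟩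
        obtain h8 := hinj h7
        simp only [Prod.mk.injEq] at h8
        obtain ⟨rfl, rfl⟩ := h8
        simp only at h1 h2 h3 h4 h5 h6
        obtain rfl : c = d := by linarith
        exact mem_seg.2 ⟨c, h1, h3, by rw [hL, smul_add]⟩
  · by_cases hv : v = 0
    · simp [hv]
    have hz : ∀ c : ℝ, μ (seg (c • v) + seg v) = 0 := by
      intro c
      have h1 := h.apply_zon_cons (l := [v]) (by simp) (c • v)
      have h2 := h.apply_zon_cons (l := [v]) (by simp) v
      have h3 := segDiff_segDiff_self h.val h.ti v 0
      simp only [zon_nil, zon_cons, add_zero] at h1 h2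
      rw [h1, segDiff_smul_abs h.val h.cont h.ti, ← h2]
      simp only [segDiff, zero_add, hs] at h3
      have h4 := h.apply_zero
      rw [show μ (seg v + seg v) = 0 by linarith, mul_zero]
    obtain ⟨c, rfl⟩ : ∃ c : ℝ, u = c • v := by
      by_contra hne
      apply hli
      rw [LinearIndependent.pair_iff]
      intro s t hst
      have hs0 : s = 0 := by
        by_contra hs0
        apply hne
        refine ⟨-(s⁻¹ * t), ?_⟩
        have : s⁻¹ • (s • u + t • v) = 0 := by rw [hst, smul_zero]
        rw [smul_add, smul_smul, inv_mul_cancel₀ hs0, one_smul, smul_smul] at this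
        rw [neg_smul]
        exact eq_neg_of_add_eq_zero_left this
      subst hs0
      simpa [hv] using hst
    rw [hz, show c • v + v = (c + 1) • v by module, hz]

theorem IsVal.shear {μ : ConvexBody V → ℝ} (h : IsVal 2 μ) (u v : V) (c : ℝ) :
    μ (seg (u + c • v) + seg v) = μ (seg u + seg v) := by
  by_cases hc : c = 0
  · simp [hc]
  have key : ∀ u, μ (seg (c • v) + seg u) = |c| * μ (seg v + seg u) := by
    intro u
    have h1 := h.apply_zon_cons (l := [u]) (by simp) (c • v)
    have h2 := h.apply_zon_cons (l := [u]) (by simp) v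
    simp only [zon_nil, zon_cons, add_zero] at h1 h2
    rw [h1, segDiff_smul_abs h.val h.cont h.ti, ← h2]
  have h1 := h.shear_aux u (c • v)
  rw [add_comm, key, add_comm (seg u), key] at h1
  rw [add_comm, add_comm (seg u)]
  exact mul_left_cancel₀ (abs_ne_zero.2 hc) h1

theorem IsVal.zon_shear {μ : ConvexBody V → ℝ} {l : List V} (h : IsVal (l.length + 2) μ) (u v : V)
    (c : ℝ) : μ (zon (l ++ [u + c • v, v])) = μ (zon (l ++ [u, v])) := by
  induction l generalizing μ with
  | nil => simpa using h.shear u v c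
  | cons w l ih =>
    rw [List.cons_append, List.cons_append, h.apply_zon_cons (by simp), h.apply_zon_cons (by simp)]
    exact ih (h.isVal_segDiff w)

theorem IsVal.zon_smul {μ : ConvexBody V → ℝ} {l : List V} (h : IsVal (l.length + 1) μ) (v : V)
    (c : ℝ) : μ (zon ((c • v) :: l)) = |c| * μ (zon (v :: l)) := by
  rw [h.apply_zon_cons (by simp), h.apply_zon_cons (by simp), segDiff_smul_abs h.val h.cont h.ti]

omit [FiniteDimensional ℝ V] in
theorem sum_seg_eq_zon {ι : Type*} (s : Finset ι) (v : ι → V) :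
    ∑ i ∈ s, seg (v i) = zon (s.toList.map v) := by
  rw [zon, List.map_map, ← Finset.sum_map_toList]; rfl

theorem IsVal.sum_seg_mulVec {k : ℕ} {μ : ConvexBody V → ℝ} (h : IsVal k μ)
    (M : Matrix (Fin k) (Fin k) ℝ) : ∀ v : Fin k → V,
      μ (∑ i, seg (∑ j, M i j • v j)) = |M.det| * μ (∑ i, seg (v i)) := by
  induction M using Matrix.diagonal_transvection_induction with
  | hdiag D _ =>
    intro v
    have e : ∀ i, ∑ j, Matrix.diagonal D i j • v j = D i • v i := by
      intro i
      rw [Finset.sum_eq_single i] <;> simp +contextual [eq_comm]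
    simp only [e, Matrix.det_diagonal, Finset.abs_prod]
    have key : ∀ s : Finset (Fin k), μ (∑ i, seg ((if i ∈ s then D i else 1) • v i)) =
        (∏ i ∈ s, |D i|) * μ (∑ i, seg (v i)) := by
      intro s
      induction s using Finset.induction_on with
      | empty => simp
      | insert a s ha ih =>
        rw [Finset.prod_insert ha, mul_assoc, ← ih]
        rw [← Finset.add_sum_erase _ _ (Finset.mem_univ a),
          ← Finset.add_sum_erase _ (fun i => seg ((if i ∈ s then D i else 1) • v i))
            (Finset.mem_univ a)]
        rw [Finset.sum_congr rfl (g := fun i => seg ((if i ∈ s then D i else 1) • v i)) (by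
          intro i hi
          have := Finset.ne_of_mem_erase hi
          simp [this])]
        rw [sum_seg_eq_zon, ← zon_cons, ← zon_cons]
        simp only [Finset.mem_insert_self, if_true, ha, if_false, one_smul]
        apply IsVal.zon_smul
        convert h using 1
        simp only [List.length_map, Finset.length_toList, Finset.mem_univ,
          Finset.card_erase_of_mem, Finset.card_univ, Fintype.card_fin]
        have := a.pos
        omega
    simpa using key Finset.univ
  | htransvec t =>
    intro v
    obtain ⟨i, j, hij, c⟩ := t
    have e : ∀ l, ∑ m, Matrix.transvection i j c l m • v m =
        if l = i then v i + c • v j else v l := by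
      intro l
      simp only [Matrix.transvection, Matrix.add_apply, add_smul, Finset.sum_add_distrib]
      have e1 : ∑ m, (1 : Matrix (Fin k) (Fin k) ℝ) l m • v m = v l := by
        rw [Finset.sum_eq_single l] <;> simp +contextual [eq_comm]
      rw [e1]
      split_ifs with hl
      · subst hl
        congr 1
        rw [Finset.sum_eq_single j] <;> simp +contextual [eq_comm]
      · rw [Finset.sum_eq_zero, add_zero]
        intro m _
        simp [Ne.symm hl]
    simp only [Matrix.TransvectionStruct.toMatrix, e, Matrix.det_transvection_of_ne i j hij,
      abs_one, one_mul]
    have hj : j ∈ Finset.univ.erase i := by simp [hij.symm]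
    rw [← Finset.add_sum_erase _ _ (Finset.mem_univ i), ← Finset.add_sum_erase _ _ hj,
      ← Finset.add_sum_erase _ (fun i => seg (v i)) (Finset.mem_univ i),
      ← Finset.add_sum_erase _ (fun i => seg (v i)) hj]
    rw [Finset.sum_congr rfl (g := fun i => seg (v i)) (by
      intro l hl
      have := Finset.ne_of_mem_erase (Finset.mem_of_mem_erase hl)
      simp [this])]
    rw [sum_seg_eq_zon]
    simp only [if_true, hij.symm, if_false]
    have := IsVal.zon_shear (μ := μ) (l := ((Finset.univ.erase i).erase j).toList.map v) ?_
      (v i) (v j) c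
    · simp only [zon_append, zon_cons, zon_nil, add_zero] at this
      rw [← add_assoc, ← add_assoc, add_comm _ (zon _), add_comm _ (zon _)]
      exact this
    · convert h using 1
      simp only [List.length_map, Finset.length_toList, hj, Finset.mem_univ,
        Finset.card_erase_of_mem, Finset.card_univ, Fintype.card_fin]
      have := i.2
      have := j.2
      have : (i : ℕ) ≠ j := fun h => hij (Fin.ext h)
      omega
  | hmul A B hA hB =>
    intro v
    have e : ∀ i, ∑ j, (A * B) i j • v j = ∑ j, A i j • ∑ l, B j l • v l := by
      intro i
      simp only [Matrix.mul_apply, Finset.sum_smul, Finset.smul_sum, smul_smul]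
      exact Finset.sum_comm
    simp only [e]
    rw [hA fun j => ∑ l, B j l • v l, hB, Matrix.det_mul, abs_mul, mul_assoc]

theorem IsVal.sum_seg_eq_zero_of_mem_span {k : ℕ} {μ : ConvexBody V → ℝ} (h : IsVal k μ)
    {v w : Fin k → V} (hw : μ (∑ i, seg (w i)) = 0)
    (hv : ∀ i, v i ∈ Submodule.span ℝ (Set.range w)) : μ (∑ i, seg (v i)) = 0 := by
  choose M hM using fun i => (Submodule.mem_span_range_iff_exists_fun ℝ).1 (hv i)
  have := h.sum_seg_mulVec M w
  simp only [hM] at this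
  rw [this, hw, mul_zero]

end Valuations

section EvenValuations

open ConvexBody

theorem IsValuation.map {V W : Type*} [NormedAddCommGroup V] [InnerProductSpace ℝ V]
    [NormedAddCommGroup W] [InnerProductSpace ℝ W] {μ : ConvexBody W → ℝ} (h : IsValuation μ)
    {f : V →L[ℝ] W} (hf : Function.Injective f) : IsValuation fun K => μ (K.map f) := by
  intro K L M I hM hI
  apply h
  · simp [hM, Set.image_union]
  · simp [hI, Set.image_inter hf]

theorem TransInv.map {V W : Type*} [NormedAddCommGroup V] [InnerProductSpace ℝ V]
    [NormedAddCommGroup W] [InnerProductSpace ℝ W] {μ : ConvexBody W → ℝ} (h : TransInv μ)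
    (f : V →L[ℝ] W) : TransInv fun K => μ (K.map f) := by
  intro K x
  simp only [translate_eq, ConvexBody.map_add, map_point, h.add_point]

theorem IsVal.map {V W : Type*} [NormedAddCommGroup V] [InnerProductSpace ℝ V]
    [NormedAddCommGroup W] [InnerProductSpace ℝ W] [FiniteDimensional ℝ V] [FiniteDimensional ℝ W]
    {k : ℕ} {μ : ConvexBody W → ℝ} (h : IsVal k μ) {f : V →L[ℝ] W} (hf : Function.Injective f) :
    IsVal k fun K => μ (K.map f) where
  val := h.val.map hf
  cont := h.cont.comp (continuous_map f)
  ti := h.ti.map f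
  hom K t ht := by
    have := h.hom (K.map f) t ht
    simpa only [dilate_eq, ConvexBody.map_smul] using this

variable {V : Type*} [NormedAddCommGroup V] [InnerProductSpace ℝ V]

theorem exists_map_subtype_eq [FiniteDimensional ℝ V] (H : Submodule ℝ V) {K : ConvexBody V}
    (h : ∀ y ∈ K, y ∈ H) : ∃ K' : ConvexBody H, K'.map H.subtypeL = K := by
  refine ⟨⟨H.subtypeL ⁻¹' (K : Set V), K.convex.linear_preimage H.subtype,
    (Submodule.closed_of_finiteDimensional H).isClosedEmbedding_subtypeVal.isCompact_preimage
      K.isCompact, ?_⟩, ?_⟩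
  · obtain ⟨y, hy⟩ := K.nonempty
    exact ⟨⟨y, h y hy⟩, hy⟩
  · apply ConvexBody.ext
    rw [coe_map]
    apply Set.image_preimage_eq_of_subset
    intro y hy
    exact ⟨⟨y, h y hy⟩, rfl⟩

open Classical in
/-- The value of a functional at the convex body with a given carrier, and zero for sets which are
not convex bodies. -/
def onSet (μ : ConvexBody V → ℝ) (S : Set V) : ℝ :=
  if h : Convex ℝ S ∧ IsCompact S ∧ S.Nonempty then μ ⟨S, h.1, h.2.1, h.2.2⟩ else 0

theorem onSet_coe (μ : ConvexBody V → ℝ) (K : ConvexBody V) : onSet μ K = μ K :=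
  dif_pos ⟨K.convex, K.isCompact, K.nonempty⟩

@[simp] theorem onSet_empty (μ : ConvexBody V → ℝ) : onSet μ ∅ = 0 := dif_neg (by simp)

/-- A convex cone given as a set. -/
structure IsConeSet (C : Set V) : Prop where
  convex : Convex ℝ C
  closed : IsClosed C
  zero_mem : (0 : V) ∈ C
  smul_mem : ∀ t : ℝ, 0 < t → ∀ x ∈ C, t • x ∈ C

/-- An even valuation vanishing on all symmetric bodies and on all flat bodies. -/
structure EvenNull (μ : ConvexBody V → ℝ) : Prop where
  val : IsValuation μ
  ti : TransInv μ
  even : EvenVal μ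
  symm : ∀ K : ConvexBody V, K.reflect = K → μ K = 0
  flat : ∀ (K : ConvexBody V) (H : Submodule ℝ V), H ≠ ⊤ → (∀ x ∈ K, x ∈ H) → μ K = 0

namespace EvenNull
variable {μ : ConvexBody V → ℝ}

theorem onSet_reflect_add (h : EvenNull μ) (S : Set V) (w : V) :
    onSet μ ((fun x => w - x) '' S) = onSet μ S := by
  by_cases hS : Convex ℝ S ∧ IsCompact S ∧ S.Nonempty
  · let K : ConvexBody V := ⟨S, hS.1, hS.2.1, hS.2.2⟩
    have e : (fun x => w - x) '' S = (K.reflect.translate w : ConvexBody V) := by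
      ext y
      constructor
      · rintro ⟨x, hx, rfl⟩
        exact ⟨-x, by simpa [ConvexBody.reflect, K] using hx, w, rfl, by simp only; abel⟩
      · rintro ⟨x, hx, z, hz, rfl⟩
        obtain rfl : z = w := hz
        exact ⟨-x, hx, by simp only; abel⟩
    rw [e, onSet_coe, h.ti, h.even]
    exact (onSet_coe μ K).symm
  · rw [onSet, onSet, dif_neg hS, dif_neg]
    rintro ⟨h1, h2, h3⟩
    apply hS
    have e : S = (fun x => w - x) '' ((fun x => w - x) '' S) := by
      rw [Set.image_image]; simp
    rw [e]
    refine ⟨?_, h2.image (by fun_prop), h3.image _⟩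
    rintro _ ⟨a, ha, rfl⟩ _ ⟨b, hb, rfl⟩ s t hs ht hst
    refine ⟨s • a + t • b, h1 ha hb hs ht hst, ?_⟩
    have : w = (s + t) • w := by rw [hst, one_smul]
    simp only
    conv_lhs => rw [this]
    module

theorem onSet_symm (h : EvenNull μ) {S : Set V} {w : V} (hS : ∀ x ∈ S, w - x ∈ S) :
    onSet μ S = 0 := by
  by_cases hS' : Convex ℝ S ∧ IsCompact S ∧ S.Nonempty
  · let K : ConvexBody V := ⟨S, hS'.1, hS'.2.1, hS'.2.2⟩
    have e : (K.translate (-(2⁻¹ : ℝ) • w)).reflect = K.translate (-(2⁻¹ : ℝ) • w) := by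
      apply ConvexBody.ext
      have hsub : ∀ y, y ∈ K.translate (-(2⁻¹ : ℝ) • w) → -y ∈ K.translate (-(2⁻¹ : ℝ) • w) := by
        rintro _ ⟨x, hx, z, hz, rfl⟩
        obtain rfl : z = -(2⁻¹ : ℝ) • w := hz
        exact ⟨w - x, hS x hx, _, rfl, by simp only; module⟩
      ext y
      exact ⟨fun hy => by simpa using hsub _ hy, fun hy => hsub y hy⟩
    have := h.symm _ e
    rw [h.ti] at this
    rw [← this, ← onSet_coe μ K]
    rfl
  · exact dif_neg hS'

theorem onSet_flat (h : EvenNull μ) {S : Set V} {f : V →L[ℝ] ℝ} (hf : f ≠ 0) {c : ℝ}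
    (hS : ∀ x ∈ S, f x = c) : onSet μ S = 0 := by
  by_cases hS' : Convex ℝ S ∧ IsCompact S ∧ S.Nonempty
  · let K : ConvexBody V := ⟨S, hS'.1, hS'.2.1, hS'.2.2⟩
    obtain ⟨x0, hx0⟩ := hS'.2.2
    have := h.flat (K.translate (-x0)) (LinearMap.ker f.toLinearMap) ?_ ?_
    · rw [h.ti, ← onSet_coe μ K] at this
      exact this
    · intro htop
      apply hf
      ext x
      have : x ∈ LinearMap.ker f.toLinearMap := htop ▸ Submodule.mem_top
      simpa using this
    · rintro _ ⟨x, hx, z, hz, rfl⟩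
      obtain rfl : z = -x0 := hz
      simp [hS x hx, hS x0 hx0]
  · exact dif_neg hS'

theorem onSet_cut (h : EvenNull μ) {S : Set V} (hc : Convex ℝ S) (hk : IsCompact S)
    {f : V →L[ℝ] ℝ} (hf : f ≠ 0) (c : ℝ) :
    onSet μ S = onSet μ (S ∩ {x | f x ≤ c}) + onSet μ (S ∩ {x | c ≤ f x}) := by
  have cl1 : IsClosed {x | f x ≤ c} := isClosed_le f.continuous continuous_const
  have cl2 : IsClosed {x | c ≤ f x} := isClosed_le continuous_const f.continuous
  have cv1 : Convex ℝ {x | f x ≤ c} := convex_halfSpace_le f.isLinear c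
  have cv2 : Convex ℝ {x | c ≤ f x} := convex_halfSpace_ge f.isLinear c
  rcases (S ∩ {x | f x ≤ c}).eq_empty_or_nonempty with e1 | n1
  · have : S ∩ {x | c ≤ f x} = S := by
      apply Set.inter_eq_left.2
      intro x hx
      by_contra hx'
      have : x ∈ S ∩ {x | f x ≤ c} := ⟨hx, (lt_of_not_ge hx' : f x < c).le⟩
      rw [e1] at this
      exact this
    rw [e1, this]; simp
  rcases (S ∩ {x | c ≤ f x}).eq_empty_or_nonempty with e2 | n2
  · have : S ∩ {x | f x ≤ c} = S := by
      apply Set.inter_eq_left.2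
      intro x hx
      by_contra hx'
      have : x ∈ S ∩ {x | c ≤ f x} := ⟨hx, (lt_of_not_ge hx' : c < f x).le⟩
      rw [e2] at this
      exact this
    rw [e2, this]; simp
  let K : ConvexBody V := ⟨_, hc.inter cv1, hk.inter_right cl1, n1⟩
  let L : ConvexBody V := ⟨_, hc.inter cv2, hk.inter_right cl2, n2⟩
  let M : ConvexBody V := ⟨S, hc, hk, n1.mono Set.inter_subset_left⟩
  have hn : ((K : Set V) ∩ L).Nonempty := by
    obtain ⟨a, ha, ha'⟩ := n1
    obtain ⟨b, hb, hb'⟩ := n2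
    obtain ⟨x, hx, hx'⟩ := hc.isPreconnected.intermediate_value ha hb f.continuous.continuousOn
      ⟨ha', hb'⟩
    exact ⟨x, ⟨hx, hx'.le⟩, ⟨hx, hx'.ge⟩⟩
  let I : ConvexBody V := ⟨_, K.convex.inter L.convex, K.isCompact.inter_right L.isClosed, hn⟩
  have := h.val K L M I ?_ rfl
  · rw [← onSet_coe μ I, h.onSet_flat hf (c := c), add_zero] at this
    · rw [← onSet_coe μ M, ← onSet_coe μ K, ← onSet_coe μ L] at this
      exact this
    · rintro x ⟨hx, hx'⟩
      exact le_antisymm hx.2 hx'.2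
  · ext x
    constructor
    · intro hx
      rcases le_total (f x) c with h | h
      · exact Or.inl ⟨hx, h⟩
      · exact Or.inr ⟨hx, h⟩
    · rintro (hx | hx)
      exacts [hx.1, hx.1]

variable [FiniteDimensional ℝ V]

theorem onSet_cap (h : EvenNull μ) {C : Set V} (hC : IsConeSet C) {f : V →L[ℝ] ℝ}
    (hk : IsCompact (C ∩ {x | f x ≤ 1})) : onSet μ (C ∩ {x | f x ≤ 1}) = 0 := by
  have cv1 : ∀ c, Convex ℝ {x | f x ≤ c} := fun c => convex_halfSpace_le f.isLinear c
  have cv2 : ∀ c, Convex ℝ {x | c ≤ f x} := fun c => convex_halfSpace_ge f.isLinear c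
  have cl2 : ∀ c, IsClosed {x | c ≤ f x} := fun c => isClosed_le continuous_const f.continuous
  have hpos : ∀ x ∈ C, x ≠ 0 → 0 < f x := by
    intro x hx hx0
    by_contra hle
    obtain ⟨R, hR⟩ := hk.isBounded.exists_norm_le
    have hR0 : 0 ≤ R := by simpa using hR 0 ⟨hC.zero_mem, by simp⟩
    have hxn : 0 < ‖x‖ := norm_pos_iff.2 hx0
    have := hR (((R + 1) / ‖x‖) • x) ⟨hC.smul_mem _ (by positivity) x hx, by
      change f _ ≤ 1
      rw [_root_.map_smul, smul_eq_mul]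
      have : 0 < (R + 1) / ‖x‖ := by positivity
      nlinarith⟩
    rw [norm_smul, Real.norm_of_nonneg (by positivity), div_mul_cancel₀ _ hxn.ne'] at this
    linarith
  by_cases h_int : (interior C).Nonempty
  swap
  · have hspan : Submodule.span ℝ C ≠ ⊤ := by
      intro htop
      apply h_int
      rw [hC.convex.interior_nonempty_iff_affineSpan_eq_top]
      rw [AffineSubspace.affineSpan_eq_top_iff_vectorSpan_eq_top_of_nonempty ℝ V V ⟨0, hC.zero_mem⟩,
        vectorSpan_eq_span_vsub_set_right ℝ hC.zero_mem]
      simpa using htop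
    by_cases hS' : Convex ℝ (C ∩ {x | f x ≤ 1}) ∧ IsCompact (C ∩ {x | f x ≤ 1}) ∧
        (C ∩ {x | f x ≤ 1}).Nonempty
    · rw [onSet, dif_pos hS']
      exact h.flat _ _ hspan fun x hx => Submodule.subset_span hx.1
    · exact dif_neg hS'
  obtain ⟨w0, hw0⟩ := h_int
  obtain ⟨ε, hε, hball⟩ := Metric.isOpen_iff.1 isOpen_interior w0 hw0
  replace hball := hball.trans interior_subset
  have hw0C : w0 ∈ C := interior_subset hw0
  by_cases hfw : f w0 = 0
  · have h0 : w0 = 0 := by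
      by_contra h0
      exact (hpos w0 hw0C h0).ne' hfw
    subst h0
    have hall : ∀ x, x ∈ C := by
      intro x
      by_cases hx : x = 0
      · rw [hx]; exact hC.zero_mem
      have hxn : 0 < ‖x‖ := norm_pos_iff.2 hx
      have := hC.smul_mem (‖x‖ * 2 / ε) (by positivity) ((ε / (‖x‖ * 2)) • x) (hball (by
        rw [mem_ball_zero_iff, norm_smul, Real.norm_of_nonneg (by positivity)]
        field_simp
        norm_num))
      rw [smul_smul] at this
      convert this
      field_simp
      simp
    have htriv : ∀ x : V, x = 0 := by
      intro x
      by_contra hx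
      have h1 := hpos x (hall x) hx
      have h2 := hpos (-x) (hall _) (neg_ne_zero.2 hx)
      rw [map_neg] at h2
      linarith
    apply h.onSet_symm (w := 0)
    intro x hx
    rw [htriv x] at hx ⊢
    simpa using hx
  have hfw0 : 0 < f w0 := hpos w0 hw0C fun h0 => hfw (by rw [h0, _root_.map_zero])
  have hf : f ≠ 0 := by
    rintro rfl
    simp at hfw
  obtain ⟨R, hR⟩ := hk.isBounded.exists_norm_le
  have hR0 : 0 ≤ R := by simpa using hR 0 ⟨hC.zero_mem, by simp⟩
  obtain ⟨t, ht0, htR, htf⟩ : ∃ t : ℝ, 0 < t ∧ R < t * ε ∧ 2 ≤ t * f w0 := by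
    refine ⟨(R + 1) / ε + 2 / f w0, by positivity, ?_, ?_⟩
    · rw [add_mul, div_mul_cancel₀ _ hε.ne']
      have : 0 < 2 / f w0 * ε := by positivity
      linarith
    · rw [add_mul, div_mul_cancel₀ _ hfw0.ne']
      have : 0 < (R + 1) / ε * f w0 := by positivity
      linarith
  set w := t • w0 with hw
  have hfwt : f w = t * f w0 := by rw [hw, _root_.map_smul, smul_eq_mul]
  have hwK : ∀ y ∈ C ∩ {x | f x ≤ 1}, w - y ∈ C := by
    intro y hy
    have := hC.smul_mem t ht0 (w0 - t⁻¹ • y) (hball (by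
      rw [mem_ball_iff_norm, sub_sub_cancel_left, norm_neg, norm_smul,
        Real.norm_of_nonneg (by positivity), inv_mul_lt_iff₀ ht0]
      exact (hR y hy).trans_lt htR))
    rwa [smul_sub, smul_smul, mul_inv_cancel₀ ht0.ne', one_smul] at this
  let S : Set V := C ∩ (fun x => w - x) ⁻¹' C
  have hSc : Convex ℝ S := by
    refine hC.convex.inter ?_
    intro a ha b hb r s hr hs hrs
    have := hC.convex ha hb hr hs hrs
    change w - (r • a + s • b) ∈ C
    have e : w - (r • a + s • b) = r • (w - a) + s • (w - b) := by
      have : w = (r + s) • w := by rw [hrs, one_smul]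
      conv_lhs => rw [this]
      module
    rwa [e]
  have hSk : IsCompact S := by
    have hwpos : 0 < f w := by rw [hfwt]; positivity
    refine (hk.smul (f w)).of_isClosed_subset
      (hC.closed.inter (hC.closed.preimage (by fun_prop))) ?_
    rintro x ⟨hx, hx'⟩
    refine ⟨(f w)⁻¹ • x, ⟨hC.smul_mem _ (by positivity) x hx, ?_⟩, ?_⟩
    · change f _ ≤ 1
      have : f x ≤ f w := by
        by_cases h0 : w - x = 0
        · rw [sub_eq_zero.1 h0]
        · have := hpos _ hx' h0
          rw [map_sub] at this
          linarith
      rw [_root_.map_smul, smul_eq_mul, inv_mul_le_iff₀ hwpos]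
      simpa using this
    · simp only
      rw [smul_smul, mul_inv_cancel₀ hwpos.ne', one_smul]
  have hsym : ∀ x ∈ S, w - x ∈ S := fun x hx => ⟨hx.2, by simpa using hx.1⟩
  have e1 := h.onSet_cut hSc hSk hf 1
  have e2 := h.onSet_cut (hSc.inter (cv2 1)) (hSk.inter_right (cl2 1)) hf (f w - 1)
  rw [h.onSet_symm hsym] at e1
  rw [h.onSet_symm (S := S ∩ {x | 1 ≤ f x} ∩ {x | f x ≤ f w - 1}) (w := w) (by
    rintro x ⟨⟨hx, hx1⟩, hx2⟩
    simp only [Set.mem_ofPred_eq] at hx1 hx2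
    refine ⟨⟨hsym x hx, ?_⟩, ?_⟩
    · change 1 ≤ f (w - x)
      rw [map_sub]; linarith
    · change f (w - x) ≤ _
      rw [map_sub]; linarith)] at e2
  have e3 : S ∩ {x | f x ≤ 1} = C ∩ {x | f x ≤ 1} := by
    ext x
    exact ⟨fun hx => ⟨hx.1.1, hx.2⟩, fun hx => ⟨⟨hx.1, hwK x hx⟩, hx.2⟩⟩
  have e4 : S ∩ {x | 1 ≤ f x} ∩ {x | f w - 1 ≤ f x} =
      (fun x => w - x) '' (C ∩ {x | f x ≤ 1}) := by
    ext x
    constructor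
    · rintro ⟨⟨hx, -⟩, hx2⟩
      simp only [Set.mem_ofPred_eq] at hx2
      refine ⟨w - x, ⟨hx.2, ?_⟩, by simp⟩
      change f (w - x) ≤ 1
      rw [map_sub]; linarith
    · rintro ⟨y, hy, rfl⟩
      have hy2 : f y ≤ 1 := hy.2
      refine ⟨⟨hsym y (e3 ▸ hy : y ∈ S ∩ {x | f x ≤ 1}).1, ?_⟩, ?_⟩
      · change 1 ≤ f (w - y)
        rw [map_sub]; linarith
      · change _ ≤ f (w - y)
        rw [map_sub]; linarith
  rw [e4, h.onSet_reflect_add] at e2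
  rw [e3] at e1
  linarith

theorem onSet_polytope_inter_cone (h : EvenNull μ) {F : Set (V →L[ℝ] ℝ)}
    (hP : IsCompact {x | ∀ f ∈ F, f x ≤ 1}) (l : List (V →L[ℝ] ℝ)) (hl : ∀ f ∈ l, f ∈ F)
    {D : Set V} (hD : IsConeSet D) {f : V →L[ℝ] ℝ} (hf : f ∈ F)
    (hfD : ∀ g ∈ F, g ∈ l ∨ ∀ x ∈ D, g x ≤ f x) :
    onSet μ ({x | ∀ f ∈ F, f x ≤ 1} ∩ D) = 0 := by
  have hPc : Convex ℝ {x | ∀ f ∈ F, f x ≤ 1} := by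
    have : {x | ∀ f ∈ F, f x ≤ 1} = ⋂ f ∈ F, {x | f x ≤ 1} := by ext; simp
    rw [this]
    exact convex_iInter₂ fun f _ => convex_halfSpace_le f.isLinear 1
  induction l generalizing D f with
  | nil =>
    have e : {x | ∀ f ∈ F, f x ≤ 1} ∩ D = D ∩ {x | f x ≤ 1} := by
      ext x
      constructor
      · rintro ⟨h1, h2⟩
        exact ⟨h2, h1 f hf⟩
      · rintro ⟨h1, h2⟩
        refine ⟨fun g hg => ?_, h1⟩
        rcases hfD g hg with h3 | h3
        · simp at h3
        · exact (h3 x h1).trans h2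
    rw [e]
    exact h.onSet_cap hD (e ▸ hP.inter_right hD.closed)
  | cons g l ih =>
    have hl' : ∀ f ∈ l, f ∈ F := fun f hf => hl f (List.mem_cons_of_mem _ hf)
    have hcone : ∀ a b : V →L[ℝ] ℝ, IsConeSet (D ∩ {x | a x ≤ b x}) := by
      intro a b
      refine ⟨hD.convex.inter ?_, hD.closed.inter (isClosed_le a.continuous b.continuous),
        ⟨hD.zero_mem, by simp⟩, ?_⟩
      · intro x hx y hy s t hs ht hst
        simp only [Set.mem_ofPred_eq, _root_.map_add, _root_.map_smul, smul_eq_mul] at hx hy ⊢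
        exact add_le_add (mul_le_mul_of_nonneg_left hx hs) (mul_le_mul_of_nonneg_left hy ht)
      · rintro t ht x ⟨hx, hx'⟩
        refine ⟨hD.smul_mem t ht x hx, ?_⟩
        simp only [Set.mem_ofPred_eq, _root_.map_smul, smul_eq_mul] at hx' ⊢
        exact mul_le_mul_of_nonneg_left hx' ht.le
    by_cases hfg : g - f = 0
    · apply ih hl' hD hf
      intro a ha
      rcases hfD a ha with h1 | h1
      · rcases List.mem_cons.1 h1 with rfl | h1
        · right
          intro x _
          rw [sub_eq_zero.1 hfg]
        · exact Or.inl h1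
      · exact Or.inr h1
    rw [h.onSet_cut (hPc.inter hD.convex) (hP.inter_right hD.closed) hfg 0, Set.inter_assoc,
      Set.inter_assoc]
    have e1 : {x | (g - f) x ≤ 0} = {x | g x ≤ f x} := by ext; simp
    have e2 : {x | 0 ≤ (g - f) x} = {x | f x ≤ g x} := by ext; simp
    rw [e1, e2, ih hl' (hcone g f) hf, ih hl' (hcone f g) (hl g (by simp)), add_zero]
    · intro a ha
      rcases hfD a ha with h1 | h1
      · rcases List.mem_cons.1 h1 with rfl | h1
        · exact Or.inr fun x _ => le_rfl
        · exact Or.inl h1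
      · exact Or.inr fun x hx => (h1 x hx.1).trans hx.2
    · intro a ha
      rcases hfD a ha with h1 | h1
      · rcases List.mem_cons.1 h1 with rfl | h1
        · exact Or.inr fun x hx => hx.2
        · exact Or.inl h1
      · exact Or.inr fun x hx => h1 x hx.1

theorem onSet_polytope (h : EvenNull μ) {F : Finset (V →L[ℝ] ℝ)} (hF : F.Nonempty)
    (hP : IsCompact {x | ∀ f ∈ F, f x ≤ 1}) : onSet μ {x | ∀ f ∈ F, f x ≤ 1} = 0 := by
  obtain ⟨f, hf⟩ := hF
  have := h.onSet_polytope_inter_cone (F := (F : Set (V →L[ℝ] ℝ))) hP F.toList (by simp)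
    (D := Set.univ) ⟨convex_univ, isClosed_univ, trivial, by simp⟩ hf (fun g hg => by
      left; simpa using hg)
  simpa using this

theorem eq_zero (h : EvenNull μ) (hc : Continuous μ) (K : ConvexBody V) : μ K = 0 := by
  by_cases h_int : (interior (K : Set V)).Nonempty
  swap
  · obtain ⟨x0, hx0⟩ := K.nonempty
    have hspan : vectorSpan ℝ (K : Set V) ≠ ⊤ := by
      intro htop
      apply h_int
      rw [K.convex.interior_nonempty_iff_affineSpan_eq_top]
      rwa [AffineSubspace.affineSpan_eq_top_iff_vectorSpan_eq_top_of_nonempty ℝ V V K.nonempty]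
    rw [← h.ti K (-x0)]
    apply h.flat _ _ hspan
    rintro _ ⟨x, hx, z, hz, rfl⟩
    obtain rfl : z = -x0 := hz
    change x + -x0 ∈ _
    rw [← sub_eq_add_neg]
    exact vsub_mem_vectorSpan ℝ hx hx0
  obtain ⟨x0, hx0⟩ := h_int
  suffices H : ∀ K : ConvexBody V, (K : Set V) ∈ nhds (0 : V) → μ K = 0 by
    rw [← h.ti K (-x0)]
    apply H
    change (K : Set V) + {-x0} ∈ nhds (0 : V)
    rw [Set.add_singleton]
    have h1 : (K : Set V) ∈ nhds x0 := mem_interior_iff_mem_nhds.1 hx0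
    have h2 := (Homeomorph.addRight (-x0)).isOpenMap.image_mem_nhds h1
    simpa using h2
  clear hx0 x0 K
  intro K hK0
  have h0K : (0 : V) ∈ K := mem_of_mem_nhds hK0
  have habs : Absorbent ℝ (K : Set V) := absorbent_nhds_zero hK0
  have happ : ∀ ε : ℝ, 0 < ε → ∃ P : ConvexBody V, μ P = 0 ∧ (K : Set V) ⊆ P ∧
      (P : Set V) ⊆ ((1 + ε) • K : ConvexBody V) := by
    intro ε hε
    have hgc : Continuous (gauge (K : Set V)) := continuous_gauge K.convex hK0
    have hgle : ∀ x, gauge (K : Set V) x ≤ 1 ↔ x ∈ K := by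
      intro x
      rw [gauge_le_one_iff_mem_closure K.convex hK0, K.isClosed.closure_eq]; rfl
    have hmem : ∀ x, gauge (K : Set V) x ≤ 1 + ε → x ∈ (1 + ε) • K := by
      intro x hx
      refine ⟨(1 + ε)⁻¹ • x, (hgle _).1 ?_, ?_⟩
      · rw [gauge_smul_of_nonneg (by positivity), smul_eq_mul, inv_mul_le_iff₀ (by positivity)]
        simpa using hx
      · simp only
        rw [smul_smul, mul_inv_cancel₀ (by positivity), one_smul]
    let A : Set V := {x | gauge (K : Set V) x = 1 + ε}
    have hA : IsCompact A := ((1 + ε) • K).isCompact.of_isClosed_subset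
      (isClosed_eq hgc continuous_const) fun x hx => hmem x (le_of_eq hx)
    have hsep : ∀ y ∈ A, ∃ f : V →L[ℝ] ℝ, (∀ x ∈ K, f x ≤ 1) ∧ 1 < f y := by
      intro y hy
      have hyK : y ∉ K := by
        rw [← hgle, show gauge (K : Set V) y = 1 + ε from hy]
        linarith
      obtain ⟨f, u, h1, h2⟩ := geometric_hahn_banach_closed_point K.convex K.isClosed hyK
      have hu : 0 < u := by simpa using h1 0 h0K
      refine ⟨u⁻¹ • f, fun x hx => ?_, ?_⟩
      · simp only [FunLike.coe_smul, Pi.smul_apply, smul_eq_mul]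
        rw [inv_mul_le_iff₀ hu]
        simpa using (h1 x hx).le
      · simp only [FunLike.coe_smul, Pi.smul_apply, smul_eq_mul]
        rw [lt_inv_mul_iff₀ hu]
        simpa using h2
    choose! f hfK hfy using hsep
    obtain ⟨T, hTA, hT⟩ := hA.elim_nhds_subcover (fun y => {x | 1 < f y x}) (fun y hy =>
      (isOpen_lt continuous_const (f y).continuous).mem_nhds (hfy y hy))
    classical
    let F : Finset (V →L[ℝ] ℝ) := insert 0 (T.image f)
    let P : Set V := {x | ∀ g ∈ F, g x ≤ 1}
    have hKP : (K : Set V) ⊆ P := by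
      intro x hx g hg
      rcases Finset.mem_insert.1 hg with rfl | hg
      · simp
      · obtain ⟨y, hy, rfl⟩ := Finset.mem_image.1 hg
        exact hfK y (hTA y hy) x hx
    have hPK : P ⊆ ((1 + ε) • K : ConvexBody V) := by
      intro x hx
      by_contra hx'
      have hgx : 1 + ε < gauge (K : Set V) x := by
        by_contra hle
        exact hx' (hmem x (not_lt.1 hle))
      set s := (1 + ε) / gauge (K : Set V) x with hs
      have hg0 : 0 < gauge (K : Set V) x := by linarith
      have hs0 : 0 < s := by positivity
      have hs1 : s < 1 := (div_lt_one hg0).2 hgx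
      have hy : s • x ∈ A := by
        change gauge _ _ = _
        rw [gauge_smul_of_nonneg hs0.le, smul_eq_mul, hs, div_mul_cancel₀ _ hg0.ne']
      obtain ⟨y, hyT, hy2⟩ := Set.mem_iUnion₂.1 (hT hy)
      have h1 : f y x ≤ 1 := hx _ (Finset.mem_insert_of_mem (Finset.mem_image_of_mem f hyT))
      have h2 : 1 < f y (s • x) := hy2
      rw [_root_.map_smul, smul_eq_mul] at h2
      nlinarith
    have hPcl : IsClosed P := by
      have : P = ⋂ g ∈ F, {x | g x ≤ 1} := by ext; simp [P]
      rw [this]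
      exact isClosed_biInter fun g _ => isClosed_le g.continuous continuous_const
    have hPcv : Convex ℝ P := by
      have : P = ⋂ g ∈ F, {x | g x ≤ 1} := by ext; simp [P]
      rw [this]
      exact convex_iInter₂ fun g _ => convex_halfSpace_le g.isLinear 1
    have hPk : IsCompact P := ((1 + ε) • K).isCompact.of_isClosed_subset hPcl hPK
    refine ⟨⟨P, hPcv, hPk, K.nonempty.mono hKP⟩, ?_, hKP, hPK⟩
    refine (onSet_coe μ _).symm.trans ?_
    exact h.onSet_polytope ⟨0, Finset.mem_insert_self _ _⟩ hPk
  obtain ⟨C, hC⟩ := K.supp_lipschitz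
  choose! P hP0 hP1 hP2 using happ
  have hlim : Filter.Tendsto P (nhdsWithin 0 (Set.Ioi 0)) (nhds K) := by
    rw [tendsto_iff_dist_tendsto_zero]
    have hb : ∀ ε : ℝ, 0 < ε → dist (P ε) K ≤ ε * C := by
      intro ε hε
      apply dist_le_of_supp (by positivity)
      intro x
      have h1 := supp_mono (hP1 ε hε) x
      have h2 := supp_mono (hP2 ε hε) x
      rw [supp_smul_body, supp_smul _ (by positivity)] at h2
      have h3 := hC.dist_le_mul x 0
      rw [supp_apply_zero, dist_zero_right, dist_zero_right, Real.norm_eq_abs] at h3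
      have h4 := (le_abs_self _).trans h3
      rw [abs_of_nonneg (by linarith)]
      nlinarith
    have : Filter.Tendsto (fun ε : ℝ => ε * C) (nhdsWithin 0 (Set.Ioi 0)) (nhds 0) := by
      have : Filter.Tendsto (fun ε : ℝ => ε * C) (nhds 0) (nhds (0 * C)) :=
        (continuous_id.mul continuous_const).tendsto 0
      rw [zero_mul] at this
      exact this.mono_left nhdsWithin_le_nhds
    refine squeeze_zero' (Filter.Eventually.of_forall fun _ => dist_nonneg) ?_ this
    filter_upwards [self_mem_nhdsWithin] with ε hε using hb ε hε
  refine tendsto_nhds_unique ((hc.tendsto K).comp hlim) (tendsto_const_nhds.congr' ?_)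
  filter_upwards [self_mem_nhdsWithin] with ε hε
  exact (hP0 ε hε).symm

end EvenNull

theorem eq_zero_of_even_of_symm_aux (n : ℕ) : ∀ (V : Type*) [NormedAddCommGroup V]
    [InnerProductSpace ℝ V] [FiniteDimensional ℝ V], Module.finrank ℝ V = n →
    ∀ μ : ConvexBody V → ℝ, IsValuation μ → Continuous μ → TransInv μ → EvenVal μ →
    (∀ K : ConvexBody V, K.reflect = K → μ K = 0) → ∀ K, μ K = 0 := by
  induction n using Nat.strong_induction_on with
  | _ n ih =>
    intro V _ _ _ hn μ hv hc ht he hs K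
    refine EvenNull.eq_zero ⟨hv, ht, he, hs, ?_⟩ hc K
    intro K H hH hKH
    obtain ⟨K', rfl⟩ := exists_map_subtype_eq H hKH
    refine ih (Module.finrank ℝ H) ?_ H rfl (fun K => μ (K.map H.subtypeL))
      (hv.map Subtype.val_injective) (hc.comp (continuous_map _)) (ht.map _) ?_ ?_ K'
    · rw [← hn]
      exact Submodule.finrank_lt hH
    · intro K
      simp only
      rw [reflect_eq, ConvexBody.map_smul, ← reflect_eq, he]
    · intro K hK
      apply hs
      rw [reflect_eq, ← ConvexBody.map_smul, ← reflect_eq, hK]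

/-- An even valuation is determined by its values on symmetric bodies. -/
theorem eq_zero_of_even_of_symm [FiniteDimensional ℝ V] {μ : ConvexBody V → ℝ}
    (hv : IsValuation μ) (hc : Continuous μ) (ht : TransInv μ) (he : EvenVal μ)
    (hs : ∀ K : ConvexBody V, K.reflect = K → μ K = 0) (K : ConvexBody V) : μ K = 0 :=
  eq_zero_of_even_of_symm_aux _ V rfl μ hv hc ht he hs K

end EvenValuations

section Integration

open ConvexBody

variable {V : Type*} [NormedAddCommGroup V] [InnerProductSpace ℝ V]

/-- The support function as a continuous function on the unit ball. -/
def suppOn (K : ConvexBody V) : C(Metric.closedBall (0 : V) 1, ℝ) :=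
  ⟨fun x => K.supp x, K.continuous_supp.comp continuous_subtype_val⟩

theorem suppOn_apply (K : ConvexBody V) (x : Metric.closedBall (0 : V) 1) :
    suppOn K x = K.supp x := rfl

theorem smul_inv_norm_smul (x : V) : ‖x‖ • (‖x‖⁻¹ • x) = x := by
  rcases eq_or_ne x 0 with rfl | hx
  · simp
  · rw [smul_smul, mul_inv_cancel₀ (norm_ne_zero_iff.2 hx), one_smul]

theorem inv_norm_smul_mem (x : V) : ‖x‖⁻¹ • x ∈ Metric.closedBall (0 : V) 1 := by
  rw [mem_closedBall_zero_iff, norm_smul, norm_inv, norm_norm]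
  exact inv_mul_le_one

theorem supp_eq_norm_mul (K : ConvexBody V) (x : V) :
    K.supp x = ‖x‖ * suppOn K ⟨‖x‖⁻¹ • x, inv_norm_smul_mem x⟩ := by
  rw [suppOn_apply, ← supp_smul _ (norm_nonneg x), smul_inv_norm_smul]

variable [FiniteDimensional ℝ V]

theorem continuous_suppOn : Continuous (suppOn : ConvexBody V → _) := by
  have : LipschitzWith 1 (suppOn : ConvexBody V → _) := by
    apply LipschitzWith.of_dist_le_mul
    intro K L
    rw [NNReal.coe_one, one_mul, ContinuousMap.dist_le dist_nonneg]
    intro x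
    rw [Real.dist_eq]
    refine (abs_supp_sub_le K L x).trans ?_
    exact mul_le_of_le_one_right dist_nonneg (mem_closedBall_zero_iff.1 x.2)
  exact this.continuous

theorem dist_le_dist_suppOn (K L : ConvexBody V) : dist K L ≤ dist (suppOn K) (suppOn L) := by
  apply dist_le_of_supp dist_nonneg
  intro x
  rw [supp_eq_norm_mul, supp_eq_norm_mul, ← mul_sub, abs_mul, abs_norm, mul_comm]
  gcongr
  exact ContinuousMap.dist_apply_le_dist (f := suppOn K) (g := suppOn L) _

theorem exists_suppOn_of_tendsto {K : ℕ → ConvexBody V} {f : C(Metric.closedBall (0 : V) 1, ℝ)}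
    (h : Filter.Tendsto (fun n => suppOn (K n)) Filter.atTop (nhds f)) :
    ∃ L : ConvexBody V, suppOn L = f ∧ Filter.Tendsto K Filter.atTop (nhds L) := by
  let g : V → ℝ := fun x => ‖x‖ * f ⟨‖x‖⁻¹ • x, inv_norm_smul_mem x⟩
  have hg : ∀ x, Filter.Tendsto (fun n => (K n).supp x) Filter.atTop (nhds (g x)) := by
    intro x
    simp only [supp_eq_norm_mul]
    exact ((continuous_eval_const _).continuousAt.tendsto.comp h).const_mul _
  obtain ⟨L, hL⟩ := exists_supp_eq (h := g)
    (fun t ht x => tendsto_nhds_unique (hg _)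
      (by simpa only [supp_smul _ ht.le] using (hg x).const_mul t))
    (fun x y => le_of_tendsto_of_tendsto' (hg _) ((hg x).add (hg y))
      fun n => supp_add_le _ _ _)
  have e : suppOn L = f := by
    ext x
    refine tendsto_nhds_unique (?_ : Filter.Tendsto (fun n => suppOn (K n) x) _ _)
      ((continuous_eval_const x).continuousAt.tendsto.comp h)
    rw [suppOn_apply, hL]
    exact hg x
  refine ⟨L, e, ?_⟩
  rw [tendsto_iff_dist_tendsto_zero] at h ⊢
  refine squeeze_zero (fun _ => dist_nonneg) (fun n => ?_) h
  rw [← e]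
  exact dist_le_dist_suppOn _ _

/-- A closed convex cone of convex bodies. -/
structure IsBodyCone (𝒞 : Set (ConvexBody V)) : Prop where
  zero_mem : 0 ∈ 𝒞
  add_mem : ∀ {K L}, K ∈ 𝒞 → L ∈ 𝒞 → K + L ∈ 𝒞
  smul_mem : ∀ {t : ℝ} {K}, 0 ≤ t → K ∈ 𝒞 → t • K ∈ 𝒞
  closed : IsClosed 𝒞

/-- A continuous functional which is additive and homogeneous on a cone of convex bodies. -/
structure IsLinOn (𝒞 : Set (ConvexBody V)) (R : ConvexBody V → ℝ) : Prop where
  cont : Continuous R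
  add : ∀ {K L}, K ∈ 𝒞 → L ∈ 𝒞 → R (K + L) = R K + R L
  smul : ∀ {t : ℝ} {K}, 0 ≤ t → K ∈ 𝒞 → R (t • K) = t * R K

omit [FiniteDimensional ℝ V] in
theorem suppOn_add (K L : ConvexBody V) : suppOn (K + L) = suppOn K + suppOn L := by
  ext x; exact supp_add_body K L x

omit [FiniteDimensional ℝ V] in
theorem suppOn_smul {t : ℝ} (ht : 0 ≤ t) (K : ConvexBody V) :
    suppOn (t • K) = t • suppOn K := by
  ext x
  rw [suppOn_apply, supp_smul_body, supp_smul _ ht]; rfl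

/-- Integrals of families of bodies in a closed convex cone. -/
theorem IsBodyCone.exists_integral {𝒞 : Set (ConvexBody V)} (h𝒞 : IsBodyCone 𝒞)
    {R : ConvexBody V → ℝ} (hR : IsLinOn 𝒞 R) {Ω : Type*} [MeasurableSpace Ω] {P : Measure Ω}
    [IsFiniteMeasure P] {K : Ω → ConvexBody V} (hK : ∀ ω, K ω ∈ 𝒞)
    (hi : Integrable (fun ω => suppOn (K ω)) P) (hiR : Integrable (fun ω => R (K ω)) P) :
    ∃ L ∈ 𝒞, (∀ x, L.supp x = ∫ ω, (K ω).supp x ∂P) ∧ R L = ∫ ω, R (K ω) ∂P := by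
  have key : ∃ L ∈ 𝒞, suppOn L = ∫ ω, suppOn (K ω) ∂P ∧ R L = ∫ ω, R (K ω) ∂P := by
    let S : Set (C(Metric.closedBall (0 : V) 1, ℝ) × ℝ) := (fun K => (suppOn K, R K)) '' 𝒞
    have hS : Convex ℝ S := by
      rintro _ ⟨K, hK, rfl⟩ _ ⟨L, hL, rfl⟩ a b ha hb _
      refine ⟨a • K + b • L, h𝒞.add_mem (h𝒞.smul_mem ha hK) (h𝒞.smul_mem hb hL), ?_⟩
      ext1
      · simp [suppOn_add, suppOn_smul ha, suppOn_smul hb]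
      · simp [hR.add (h𝒞.smul_mem ha hK) (h𝒞.smul_mem hb hL), hR.smul ha hK, hR.smul hb hL]
    have hSc : IsClosed S := by
      apply IsSeqClosed.isClosed
      intro s p hs hp
      choose K hK hKs using hs
      obtain rfl : s = fun n => (suppOn (K n), R (K n)) := funext fun n => (hKs n).symm
      rw [nhds_prod_eq, Filter.tendsto_prod_iff'] at hp
      obtain ⟨L, hL, hlim⟩ := exists_suppOn_of_tendsto hp.1
      refine ⟨L, h𝒞.closed.mem_of_tendsto hlim (Filter.Eventually.of_forall hK), ?_⟩
      ext1
      · exact hL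
      · exact tendsto_nhds_unique (hR.cont.continuousAt.tendsto.comp hlim) hp.2
    rcases eq_or_ne P 0 with rfl | hP
    · refine ⟨0, h𝒞.zero_mem, ?_, ?_⟩
      · rw [integral_zero_measure]; ext x; exact supp_zero _
      · rw [integral_zero_measure]
        simpa using hR.smul (le_refl (0 : ℝ)) h𝒞.zero_mem
    have : NeZero P := ⟨hP⟩
    obtain ⟨L, hL, hLe⟩ := hS.average_mem hSc (μ := P) (f := fun ω => (suppOn (K ω), R (K ω)))
      (Filter.Eventually.of_forall fun ω => ⟨K ω, hK ω, rfl⟩) (hi.prodMk hiR)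
    have hpos : 0 < P.real Set.univ := measureReal_univ_pos
    rw [average_eq, integral_pair hi hiR] at hLe
    simp only [Prod.mk.injEq, Prod.smul_mk] at hLe
    refine ⟨P.real Set.univ • L, h𝒞.smul_mem hpos.le hL, ?_, ?_⟩
    · rw [suppOn_smul hpos.le, hLe.1, smul_smul, mul_inv_cancel₀ hpos.ne', one_smul]
    · rw [hR.smul hpos.le hL, hLe.2, smul_eq_mul, mul_inv_cancel_left₀ hpos.ne']
  obtain ⟨L, hL, h1, h2⟩ := key
  refine ⟨L, hL, fun x => ?_, h2⟩
  have h3 : ∀ y : Metric.closedBall (0 : V) 1, suppOn L y = ∫ ω, suppOn (K ω) y ∂P := by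
    intro y
    rw [h1, ContinuousMap.integral_apply hi]
  rw [supp_eq_norm_mul, h3, ← integral_const_mul]
  simp only [← supp_eq_norm_mul]

end Integration

section CosineTransform

open ConvexBody Set

/-- The set of zonoids. -/
def zonoids (V : Type*) [NormedAddCommGroup V] [InnerProductSpace ℝ V] : Set (ConvexBody V) :=
  closure (range zon)

theorem integrableOn_one_sub_cos_div_sq :
    IntegrableOn (fun s : ℝ => (1 - Real.cos s) / s ^ 2) (Ioi 0) := by
  refine Integrable.mono' ((integrable_inv_one_add_sq.const_mul (5 / 2)).integrableOn)
    (Measurable.aestronglyMeasurable (by fun_prop)) ?_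
  refine (ae_restrict_iff' measurableSet_Ioi).2 (Filter.Eventually.of_forall fun s hs => ?_)
  have hs : 0 < s := hs
  have h1 := Real.one_sub_sq_div_two_le_cos (x := s)
  have h2 := Real.neg_one_le_cos s
  have h3 := Real.cos_le_one s
  rw [Real.norm_eq_abs, abs_of_nonneg (by have := sub_nonneg.2 h3; positivity), ← div_eq_mul_inv,
    div_le_div_iff₀ (by positivity) (by positivity)]
  nlinarith [mul_le_mul_of_nonneg_right h2 (sq_nonneg s)]

theorem integrableOn_one_sub_cos_mul_div_sq (a : ℝ) :
    IntegrableOn (fun s : ℝ => (1 - Real.cos (a * s)) / s ^ 2) (Ioi 0) := by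
  rcases eq_or_ne a 0 with rfl | ha
  · simp
  have := (integrableOn_Ioi_comp_mul_left_iff (fun s : ℝ => (1 - Real.cos s) / s ^ 2) 0
    (abs_pos.2 ha)).2 (by simpa using integrableOn_one_sub_cos_div_sq)
  refine IntegrableOn.congr_fun (this.const_mul (|a| ^ 2)) (fun s hs => ?_) measurableSet_Ioi
  have hs : s ≠ 0 := (mem_Ioi.1 hs).ne'
  have e : Real.cos (|a| * s) = Real.cos (a * s) := by
    rcases abs_choice a with h | h <;> rw [h]
    rw [neg_mul, Real.cos_neg]
  have ha' := abs_ne_zero.2 ha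
  simp only [e]
  field_simp

theorem integral_one_sub_cos_mul_div_sq (a : ℝ) :
    ∫ s in Ioi (0 : ℝ), (1 - Real.cos (a * s)) / s ^ 2
      = |a| * ∫ s in Ioi (0 : ℝ), (1 - Real.cos s) / s ^ 2 := by
  rcases eq_or_ne a 0 with rfl | ha
  · simp
  have ha' := abs_ne_zero.2 ha
  have := integral_comp_mul_left_Ioi (fun s : ℝ => (1 - Real.cos s) / s ^ 2) 0
    (abs_pos.2 ha)
  rw [mul_zero, smul_eq_mul] at this
  rw [show (|a| * ∫ s in Ioi (0 : ℝ), (1 - Real.cos s) / s ^ 2)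
    = |a| ^ 2 * (|a|⁻¹ * ∫ s in Ioi (0 : ℝ), (1 - Real.cos s) / s ^ 2) by field_simp, ← this,
    ← integral_const_mul]
  refine setIntegral_congr_fun measurableSet_Ioi fun s hs => ?_
  have hs : s ≠ 0 := (mem_Ioi.1 hs).ne'
  have e : Real.cos (|a| * s) = Real.cos (a * s) := by
    rcases abs_choice a with h | h <;> rw [h]
    rw [neg_mul, Real.cos_neg]
  simp only [e]
  field_simp

variable {V : Type*} [NormedAddCommGroup V] [InnerProductSpace ℝ V]

theorem zon_mem_zonoids (l : List V) : zon l ∈ zonoids V := subset_closure ⟨l, rfl⟩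

theorem seg_mem_zonoids (v : V) : seg v ∈ zonoids V := by
  simpa using zon_mem_zonoids [v]

/-- The symmetric segment with endpoints `v` and `-v`. -/
def symSeg (v : V) : ConvexBody V := seg v + seg (-v)

theorem supp_symSeg (v x : V) : (symSeg v).supp x = |inner ℝ v x| := by
  rw [symSeg, supp_add_body, supp_seg, supp_seg, inner_neg_left]
  rcases le_total 0 (inner ℝ v x) with h | h
  · rw [abs_of_nonneg h, max_eq_right h, max_eq_left (by linarith), add_zero]
  · rw [abs_of_nonpos h, max_eq_left h, max_eq_right (by linarith), zero_add]

variable [FiniteDimensional ℝ V]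

theorem norm_suppOn_symSeg_le (v : V) : ‖suppOn (symSeg v)‖ ≤ ‖v‖ := by
  rw [ContinuousMap.norm_le _ (norm_nonneg v)]
  intro x
  rw [suppOn_apply, supp_symSeg, Real.norm_eq_abs, abs_abs]
  exact (abs_real_inner_le_norm _ _).trans
    (mul_le_of_le_one_right (norm_nonneg _) (mem_closedBall_zero_iff.1 x.2))

theorem continuous_symSeg : Continuous (symSeg : V → ConvexBody V) :=
  continuous_seg.add (continuous_seg.comp continuous_neg)

theorem isBodyCone_zonoids : IsBodyCone (zonoids V) where
  zero_mem := by simpa using zon_mem_zonoids ([] : List V)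
  add_mem hK hL := map_mem_closure₂ continuous_add hK hL (by
    rintro _ ⟨l, rfl⟩ _ ⟨m, rfl⟩
    exact ⟨l ++ m, zon_append l m⟩)
  smul_mem {t K} _ hK := map_mem_closure (continuous_smul_body t) hK (by
    rintro _ ⟨l, rfl⟩
    exact ⟨_, (smul_zon t l).symm⟩)
  closed := isClosed_closure

theorem symSeg_mem_zonoids (v : V) : symSeg v ∈ zonoids V :=
  isBodyCone_zonoids.add_mem (seg_mem_zonoids _) (seg_mem_zonoids _)

omit [FiniteDimensional ℝ V] in
theorem isLinOn_zero (𝒞 : Set (ConvexBody V)) : IsLinOn 𝒞 fun _ => 0 where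
  cont := continuous_const
  add _ _ := by simp
  smul _ _ := by simp

variable [MeasurableSpace V] [BorelSpace V]

theorem exists_zonoid_of_density {ρ : V → ℝ≥0} (hρ : Continuous ρ)
    (h0 : Integrable fun v => (ρ v : ℝ)) (h1 : Integrable fun v => (ρ v : ℝ) * ‖v‖) :
    ∃ Z ∈ zonoids V, ∀ x, Z.supp x = ∫ v, ρ v * |inner ℝ v x| := by
  let P : Measure V := volume.withDensity fun v => ρ v
  have : IsFiniteMeasure P := by
    refine isFiniteMeasure_withDensity ?_
    have := h0.2
    rw [hasFiniteIntegral_iff_enorm] at this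
    simpa using this.ne
  have hi : Integrable (fun v => suppOn (symSeg v)) P := by
    rw [integrable_withDensity_iff_integrable_smul hρ.measurable]
    refine h1.mono' ?_ (Filter.Eventually.of_forall fun v => ?_)
    · exact (hρ.smul (continuous_suppOn.comp continuous_symSeg)).aestronglyMeasurable
    · rw [NNReal.smul_def, norm_smul, NNReal.norm_eq]
      gcongr
      exact norm_suppOn_symSeg_le v
  obtain ⟨Z, hZ, hs, -⟩ := isBodyCone_zonoids.exists_integral (isLinOn_zero _)
    symSeg_mem_zonoids hi (integrable_zero _ _ _)
  refine ⟨Z, hZ, fun x => ?_⟩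
  rw [hs, integral_withDensity_eq_integral_smul hρ.measurable]
  simp only [supp_symSeg, NNReal.smul_def, smul_eq_mul]

open scoped FourierTransform SchwartzMap

theorem SchwartzMap.re_eq_integral_cos {F : 𝓢(V, ℂ)} (hF : ∀ x, F (-x) = F x) (x : V) :
    (F x).re = ∫ v, Real.cos (2 * Real.pi * inner ℝ v x) * (𝓕 F v).re := by
  have h_int : ∀ y, Integrable fun v =>
      Complex.exp (↑(2 * Real.pi * inner ℝ v y) * Complex.I) • 𝓕 F v := by
    intro y
    refine ((𝓕 F).integrable (μ := volume)).norm.mono' (Continuous.aestronglyMeasurable ?_) ?_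
    · have := (𝓕 F).continuous
      fun_prop
    · refine Filter.Eventually.of_forall fun v => ?_
      rw [norm_smul, Complex.norm_exp_ofReal_mul_I, one_mul]
  have h : ∀ y, F y = ∫ v, Complex.exp (↑(2 * Real.pi * inner ℝ v y) * Complex.I) • 𝓕 F v := by
    intro y
    rw [← Real.fourierInv_eq' (⇑(𝓕 F : 𝓢(V, ℂ))) y, ← SchwartzMap.fourierInv_coe,
      FourierTransform.fourierInv_fourier_eq]
  have h2 : F x = ∫ v, (Real.cos (2 * Real.pi * inner ℝ v x) : ℂ) * 𝓕 F v := by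
    have : F x = (1 / 2 : ℂ) * (F x + F (-x)) := by rw [hF]; ring
    rw [this, h x, h (-x), ← integral_add (h_int x) (h_int (-x)), ← integral_const_mul]
    congr 1
    ext v
    rw [Complex.ofReal_cos, Complex.cos, inner_neg_right, smul_eq_mul, smul_eq_mul]
    push_cast
    ring_nf
  have h3 : Integrable fun v => (Real.cos (2 * Real.pi * inner ℝ v x) : ℂ) * 𝓕 F v := by
    refine ((𝓕 F).integrable (μ := volume)).norm.mono' (Continuous.aestronglyMeasurable ?_) ?_
    · have := (𝓕 F).continuous
      fun_prop
    · refine Filter.Eventually.of_forall fun v => ?_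
      rw [norm_mul, Complex.norm_real, Real.norm_eq_abs]
      exact mul_le_of_le_one_left (norm_nonneg _) (Real.abs_cos_le_one _)
  rw [h2, ← Complex.reCLM_apply, ← ContinuousLinearMap.integral_comp_comm _ h3]
  simp only [Complex.reCLM_apply, Complex.re_ofReal_mul]

end CosineTransform

section GeneralizedZonoids

open ConvexBody Set

variable {V : Type*} [NormedAddCommGroup V] [InnerProductSpace ℝ V]

/-- Generalized zonoids: bodies which become zonoids after adding a zonoid. -/
def IsGZ (K : ConvexBody V) : Prop := ∃ Z ∈ zonoids V, K + Z ∈ zonoids V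

/-- A smooth cut-off function supported in `[1, 3]`. -/
def annulusBump : ContDiffBump (2 : ℝ) := ⟨1 / 2, 1, by norm_num, by norm_num⟩

theorem annulusBump_eq_zero {t : ℝ} (h : t ≤ 1 ∨ 3 ≤ t) : annulusBump t = 0 := by
  apply annulusBump.zero_of_le_dist
  change 1 ≤ dist t 2
  rw [Real.dist_eq]
  rcases h with h | h
  · rw [abs_of_nonpos (by linarith)]; linarith
  · rw [abs_of_nonneg (by linarith)]; linarith

theorem integrableOn_annulusBump : IntegrableOn (fun s : ℝ => annulusBump (s ^ 2) / s) (Ioi 0) := by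
  have hc : Continuous fun s : ℝ => annulusBump (s ^ 2) :=
    annulusBump.continuous.comp (continuous_pow 2)
  have h1 : Integrable fun s : ℝ => annulusBump (s ^ 2) := by
    refine hc.integrable_of_hasCompactSupport
      (HasCompactSupport.intro (isCompact_Icc (a := (-2 : ℝ)) (b := 2)) fun x hx => ?_)
    apply annulusBump_eq_zero
    right
    by_contra! h
    exact hx ⟨by nlinarith, by nlinarith⟩
  refine h1.integrableOn.mono' ((hc.measurable.div measurable_id).aestronglyMeasurable) ?_
  refine (ae_restrict_iff' measurableSet_Ioi).2 (Filter.Eventually.of_forall fun s hs => ?_)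
  have hs : 0 < s := hs
  rw [Real.norm_of_nonneg (div_nonneg annulusBump.nonneg hs.le)]
  rcases le_or_gt s 1 with h | h
  · rw [annulusBump_eq_zero (Or.inl (by nlinarith))]; simp
  · exact div_le_self annulusBump.nonneg h.le

theorem integral_annulusBump_pos : 0 < ∫ s in Ioi (0 : ℝ), annulusBump (s ^ 2) / s := by
  rw [setIntegral_pos_iff_support_of_nonneg_ae _ integrableOn_annulusBump]
  · have : Ioo (3 / 2 : ℝ) (8 / 5) ⊆
        Function.support (fun s : ℝ => annulusBump (s ^ 2) / s) ∩ Ioi 0 := by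
      intro s hs
      have h0 : 0 < s := by linarith [hs.1]
      refine ⟨?_, h0⟩
      refine (div_pos (annulusBump.pos_of_mem_ball ?_) h0).ne'
      rw [Real.ball_eq_Ioo]
      change s ^ 2 ∈ Ioo (2 - 1 : ℝ) (2 + 1)
      constructor <;> nlinarith [hs.1, hs.2]
    refine lt_of_lt_of_le ?_ (measure_mono this)
    rw [Real.volume_Ioo]
    norm_num
  · refine (ae_restrict_iff' measurableSet_Ioi).2 (Filter.Eventually.of_forall fun s hs => ?_)
    exact div_nonneg annulusBump.nonneg (le_of_lt hs)

theorem integral_mul_annulusBump (K : ConvexBody V) {x : V} (hx : x ≠ 0) :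
    ∫ s in Ioi (0 : ℝ), K.supp (s • x) * annulusBump (‖s • x‖ ^ 2) / s ^ 2
      = K.supp x * ∫ s in Ioi (0 : ℝ), annulusBump (s ^ 2) / s := by
  have hx' := norm_pos_iff.2 hx
  have := integral_comp_mul_left_Ioi (fun s : ℝ => annulusBump (s ^ 2) / s) 0 hx'
  rw [mul_zero, smul_eq_mul] at this
  rw [show (∫ s in Ioi (0 : ℝ), annulusBump (s ^ 2) / s)
    = ‖x‖ * (‖x‖⁻¹ * ∫ s in Ioi (0 : ℝ), annulusBump (s ^ 2) / s) by field_simp, ← this,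
    ← integral_const_mul, ← integral_const_mul]
  refine setIntegral_congr_fun measurableSet_Ioi fun s hs => ?_
  have hs : 0 < s := hs
  simp only [supp_smul _ hs.le, norm_smul, Real.norm_of_nonneg hs.le, mul_comm ‖x‖ s]
  field_simp

variable [FiniteDimensional ℝ V]

open scoped FourierTransform SchwartzMap ContDiff

theorem exists_schwartz_mul_annulusBump {K : ConvexBody V}
    (hs : ∀ x ≠ 0, ContDiffAt ℝ ∞ K.supp x) :
    ∃ F : 𝓢(V, ℂ), ∀ x, F x = ((K.supp x * annulusBump (‖x‖ ^ 2) : ℝ) : ℂ) := by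
  have hb : ContDiff ℝ ∞ fun x : V => annulusBump (‖x‖ ^ 2) :=
    annulusBump.contDiff.comp (contDiff_norm_sq ℝ)
  have hF : ContDiff ℝ ∞ fun x : V => K.supp x * annulusBump (‖x‖ ^ 2) := by
    rw [contDiff_iff_contDiffAt]
    intro x
    rcases eq_or_ne x 0 with rfl | hx
    · refine (contDiffAt_const (c := (0 : ℝ))).congr_of_eventuallyEq ?_
      filter_upwards [Metric.ball_mem_nhds (0 : V) one_pos] with x hx
      rw [mem_ball_zero_iff] at hx
      rw [annulusBump_eq_zero (Or.inl (by nlinarith [norm_nonneg x])), mul_zero]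
    · exact (hs x hx).mul hb.contDiffAt
  have hc : HasCompactSupport fun x : V => ((K.supp x * annulusBump (‖x‖ ^ 2) : ℝ) : ℂ) := by
    refine HasCompactSupport.intro (isCompact_closedBall (0 : V) 2) fun x hx => ?_
    rw [mem_closedBall_zero_iff, not_le] at hx
    rw [annulusBump_eq_zero (Or.inr (by nlinarith [norm_nonneg x]))]
    simp
  exact ⟨hc.toSchwartzMap (Complex.ofRealCLM.contDiff.comp hF), fun x => rfl⟩

variable [MeasurableSpace V] [BorelSpace V]

theorem exists_density_of_smooth {K : ConvexBody V} (hsym : ∀ x, K.supp (-x) = K.supp x)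
    (hs : ∀ x ≠ 0, ContDiffAt ℝ ∞ K.supp x) :
    ∃ F : 𝓢(V, ℂ), ∀ x, K.supp x = ∫ v, (F v).re * |inner ℝ v x| := by
  obtain ⟨F, hF⟩ := exists_schwartz_mul_annulusBump hs
  set C := ∫ s in Ioi (0 : ℝ), annulusBump (s ^ 2) / s with hC
  have hCpos : 0 < C := integral_annulusBump_pos
  set c₀ := ∫ s in Ioi (0 : ℝ), (1 - Real.cos s) / s ^ 2 with hc₀
  have hFneg : ∀ x, F (-x) = F x := fun x => by rw [hF, hF, hsym, norm_neg]
  have h_int : ∀ x, Integrable fun v => Real.cos (2 * Real.pi * inner ℝ v x) * (𝓕 F v).re := by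
    intro x
    refine ((𝓕 F).integrable (μ := volume)).norm.mono' (Continuous.aestronglyMeasurable ?_) ?_
    · have := (𝓕 F).continuous
      fun_prop
    · refine Filter.Eventually.of_forall fun v => ?_
      rw [norm_mul, Real.norm_eq_abs]
      exact (mul_le_of_le_one_left (norm_nonneg _) (Real.abs_cos_le_one _)).trans
        (Complex.abs_re_le_norm _)
  have h1 : ∀ x, K.supp x * annulusBump (‖x‖ ^ 2)
      = ∫ v, (Real.cos (2 * Real.pi * inner ℝ v x) - 1) * (𝓕 F v).re := by
    intro x
    have e0 : (F 0).re = 0 := by rw [hF, supp_apply_zero]; simp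
    have e1 : (F x).re = K.supp x * annulusBump (‖x‖ ^ 2) := by rw [hF, Complex.ofReal_re]
    rw [← e1, ← sub_zero (F x).re, ← e0, F.re_eq_integral_cos hFneg x,
      F.re_eq_integral_cos hFneg 0, ← integral_sub (h_int x) (h_int 0)]
    simp [sub_mul]
  have hre : Integrable fun v => ‖v‖ * ‖(𝓕 F v).re‖ := by
    refine ((𝓕 F).integrable_pow_mul volume 1).mono' (Continuous.aestronglyMeasurable ?_) ?_
    · have := (𝓕 F).continuous
      fun_prop
    · refine Filter.Eventually.of_forall fun v => ?_
      rw [pow_one, norm_mul, norm_norm, norm_norm]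
      gcongr
      exact Complex.abs_re_le_norm _
  have key : ∀ x, x ≠ 0 → K.supp x * C = ∫ v, -(2 * Real.pi * c₀) * (𝓕 F v).re * |inner ℝ v x| := by
    intro x hx
    rw [hC, ← integral_mul_annulusBump K hx]
    have h2 : ∀ s : ℝ, K.supp (s • x) * annulusBump (‖s • x‖ ^ 2) / s ^ 2
        = ∫ v, -((1 - Real.cos (2 * Real.pi * inner ℝ v x * s)) / s ^ 2 * (𝓕 F v).re) := by
      intro s
      rw [h1, ← integral_div]
      congr 1
      ext v
      rw [inner_smul_right,
        show 2 * Real.pi * (s * inner ℝ v x) = 2 * Real.pi * inner ℝ v x * s by ring]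
      ring
    simp only [h2]
    rw [integral_integral_swap]
    · congr 1
      ext v
      rw [integral_neg, integral_mul_const, integral_one_sub_cos_mul_div_sq, abs_mul,
        abs_of_pos Real.two_pi_pos]
      ring
    · have hm : AEStronglyMeasurable (Function.uncurry fun (s : ℝ) (v : V) =>
          -((1 - Real.cos (2 * Real.pi * inner ℝ v x * s)) / s ^ 2 * (𝓕 F v).re))
          ((volume.restrict (Ioi 0)).prod volume) := by
        have h3 : Measurable fun v => (𝓕 F v).re :=
          (Complex.continuous_re.comp (𝓕 F).continuous).measurable
        have h4 : Measurable fun v : V => inner ℝ v x := by fun_prop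
        apply Measurable.aestronglyMeasurable
        unfold Function.uncurry
        fun_prop
      rw [integrable_prod_iff' hm]
      constructor
      · refine Filter.Eventually.of_forall fun v => ?_
        exact ((integrableOn_one_sub_cos_mul_div_sq (2 * Real.pi * inner ℝ v x)).mul_const
          (𝓕 F v).re).neg
      · have : ∀ v : V, ∫ s in Ioi (0 : ℝ),
            ‖-((1 - Real.cos (2 * Real.pi * inner ℝ v x * s)) / s ^ 2 * (𝓕 F v).re)‖
            = |2 * Real.pi * inner ℝ v x| * c₀ * ‖(𝓕 F v).re‖ := by
          intro v
          rw [← integral_one_sub_cos_mul_div_sq, ← integral_mul_const]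
          congr 1
          ext s
          rw [norm_neg, norm_mul, Real.norm_of_nonneg]
          exact div_nonneg (sub_nonneg.2 (Real.cos_le_one _)) (sq_nonneg s)
        simp only [Function.uncurry_apply_pair, this]
        refine (hre.const_mul (2 * Real.pi * ‖x‖ * |c₀|)).mono' (Continuous.aestronglyMeasurable ?_)
          (Filter.Eventually.of_forall fun v => ?_)
        · have := (𝓕 F).continuous
          fun_prop
        · rw [norm_mul, norm_mul, norm_norm, Real.norm_eq_abs, abs_abs, abs_mul,
            abs_of_pos Real.two_pi_pos, Real.norm_eq_abs c₀]
          calc 2 * Real.pi * |inner ℝ v x| * |c₀| * ‖(𝓕 F v).re‖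
              ≤ 2 * Real.pi * (‖v‖ * ‖x‖) * |c₀| * ‖(𝓕 F v).re‖ := by
                gcongr; exact abs_real_inner_le_norm _ _
            _ = _ := by ring
  refine ⟨((-(2 * Real.pi * c₀) / C : ℝ) : ℂ) • 𝓕 F, fun x => ?_⟩
  rcases eq_or_ne x 0 with rfl | hx
  · simp
  rw [← mul_div_cancel_right₀ (K.supp x) hCpos.ne', key x hx, ← integral_div]
  congr 1
  ext v
  rw [smul_apply, smul_eq_mul, Complex.re_ofReal_mul]
  ring

omit [MeasurableSpace V] [BorelSpace V] in
theorem isGZ_of_smooth {K : ConvexBody V} (hsym : ∀ x, K.supp (-x) = K.supp x)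
    (hs : ∀ x ≠ 0, ContDiffAt ℝ ∞ K.supp x) : IsGZ K := by
  borelize V
  obtain ⟨F, hF⟩ := exists_density_of_smooth hsym hs
  have hre : Continuous fun v => (F v).re := Complex.continuous_re.comp F.continuous
  have key : ∀ g : ℝ → ℝ≥0, Continuous g → (∀ t, g t ≤ |t|) →
      (∀ x, Integrable fun v => (g (F v).re : ℝ) * |inner ℝ v x|) ∧
      ∃ Z ∈ zonoids V, ∀ x, Z.supp x = ∫ v, g (F v).re * |inner ℝ v x| := by
    intro g hg hgl
    have hb : ∀ v, (g (F v).re : ℝ) ≤ ‖F v‖ := fun v => (hgl _).trans (Complex.abs_re_le_norm _)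
    have hgc : Continuous fun v => g (F v).re := hg.comp hre
    have h1 : Integrable fun v => (g (F v).re : ℝ) * ‖v‖ := by
      refine (F.integrable_pow_mul volume 1).mono' (Continuous.aestronglyMeasurable ?_) ?_
      · fun_prop
      · refine Filter.Eventually.of_forall fun v => ?_
        rw [pow_one, norm_mul, norm_norm, NNReal.norm_eq, mul_comm]
        gcongr
        exact hb v
    refine ⟨fun x => ?_, exists_zonoid_of_density hgc ?_ h1⟩
    · refine (h1.mul_const ‖x‖).mono' (Continuous.aestronglyMeasurable ?_) ?_
      · fun_prop
      · refine Filter.Eventually.of_forall fun v => ?_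
        rw [norm_mul, NNReal.norm_eq, mul_assoc, Real.norm_eq_abs, abs_abs]
        gcongr
        exact abs_real_inner_le_norm _ _
    · refine (F.integrable (μ := volume)).norm.mono' (Continuous.aestronglyMeasurable ?_) ?_
      · fun_prop
      · refine Filter.Eventually.of_forall fun v => ?_
        rw [NNReal.norm_eq]
        exact hb v
  obtain ⟨h1, Z₁, hZ₁, e1⟩ := key Real.toNNReal continuous_real_toNNReal fun t => by
    rw [Real.coe_toNNReal']; exact max_le (le_abs_self t) (abs_nonneg t)
  obtain ⟨h2, Z₂, hZ₂, e2⟩ := key (fun t => Real.toNNReal (-t))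
    (continuous_real_toNNReal.comp continuous_neg) fun t => by
    rw [Real.coe_toNNReal']; exact max_le (neg_le_abs t) (abs_nonneg t)
  refine ⟨Z₂, hZ₂, ?_⟩
  convert hZ₁
  apply ext_supp
  intro x
  rw [supp_add_body, e1, e2, hF, ← eq_sub_iff_add_eq, ← integral_sub (h1 x) (h2 x)]
  congr 1
  ext v
  rw [← sub_mul, Real.coe_toNNReal', Real.coe_toNNReal']
  congr 1
  rcases le_total 0 (F v).re with h | h
  · rw [max_eq_left h, max_eq_right (by linarith), sub_zero]
  · rw [max_eq_right h, max_eq_left (by linarith), zero_sub, neg_neg]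

end GeneralizedZonoids

section Density

open ConvexBody Set

variable {V : Type*} [NormedAddCommGroup V] [InnerProductSpace ℝ V] [FiniteDimensional ℝ V]

open scoped ContDiff

theorem exists_isGZ_lp (A : Finset V) (hA : ∀ x, (∀ a ∈ A, inner ℝ a x = 0) → x = 0) (m : ℕ) :
    ∃ K : ConvexBody V, IsGZ K ∧ (∀ x, K.supp (-x) = K.supp x) ∧ ∀ x, K.supp x =
      (∑ a ∈ A, |inner ℝ a x| ^ (2 * (m + 1 : ℕ) : ℝ)) ^ (1 / (2 * (m + 1 : ℕ) : ℝ)) := by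
  set p : ℝ := 2 * (m + 1 : ℕ) with hp
  have hp1 : 1 ≤ p := by rw [hp]; push_cast; linarith [(Nat.cast_nonneg m : (0 : ℝ) ≤ m)]
  have hp0 : 0 < p := by linarith
  obtain ⟨K, hK⟩ := exists_supp_eq (h := fun x => (∑ a ∈ A, |inner ℝ a x| ^ p) ^ (1 / p))
    (fun t ht x => by
      simp only [inner_smul_right, abs_mul, abs_of_pos ht]
      simp only [Real.mul_rpow ht.le (abs_nonneg _), ← Finset.mul_sum]
      rw [Real.mul_rpow (by positivity) (Finset.sum_nonneg fun _ _ => by positivity),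
        ← Real.rpow_mul ht.le, mul_one_div_cancel hp0.ne', Real.rpow_one])
    (fun x y => by
      simp only [inner_add_right]
      exact Real.Lp_add_le A _ _ hp1)
  have hsym : ∀ x, K.supp (-x) = K.supp x := fun x => by
    simp only [hK, inner_neg_right, abs_neg]
  refine ⟨K, isGZ_of_smooth hsym ?_, hsym, hK⟩
  intro x hx
  rw [show K.supp = _ from funext hK]
  apply ContDiffAt.rpow_const_of_ne
  · have : ∀ t : ℝ, |t| ^ p = t ^ (2 * (m + 1)) := by
      intro t
      rw [← Even.pow_abs (even_two_mul _), ← Real.rpow_natCast]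
      congr 1
      rw [hp]; push_cast; ring
    simp only [this]
    exact (ContDiff.sum fun a _ => (contDiff_const.inner ℝ contDiff_id).pow _).contDiffAt
  · intro h
    rw [Finset.sum_eq_zero_iff_of_nonneg fun _ _ => by positivity] at h
    refine hx (hA x fun a ha => ?_)
    have := h a ha
    rwa [Real.rpow_eq_zero (abs_nonneg _) hp0.ne', abs_eq_zero] at this

theorem mem_closure_isGZ {K : ConvexBody V} (hK : ∀ x, K.supp (-x) = K.supp x) :
    K ∈ closure {L : ConvexBody V | IsGZ L ∧ ∀ x, L.supp (-x) = L.supp x} := by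
  classical
  rw [Metric.mem_closure_iff]
  intro ε' hε'
  obtain ⟨ε, hε, hεe⟩ : ∃ ε, 0 < ε ∧ 2 * ε < ε' := ⟨ε' / 3, by positivity, by linarith⟩
  obtain ⟨D, hD0, hD⟩ : ∃ D : ℝ, 0 ≤ D ∧ ∀ x, K.supp x ≤ D * ‖x‖ := by
    refine ⟨dist K 0, dist_nonneg, fun x => ?_⟩
    simpa using supp_sub_le_dist K 0 x
  obtain ⟨t, htK, htf, htc⟩ := K.isCompact.finite_cover_balls hε
  let b := stdOrthonormalBasis ℝ V
  let A : Finset V := htf.toFinset ∪ Finset.univ.image fun i => ε • b i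
  have hA : ∀ x, (∀ a ∈ A, inner ℝ a x = 0) → x = 0 := by
    intro x h
    apply b.repr.injective
    ext i
    simp only [b.repr_apply_apply, _root_.map_zero, PiLp.zero_apply]
    have := h (ε • b i) (Finset.mem_union_right _ (Finset.mem_image_of_mem _ (Finset.mem_univ i)))
    rw [inner_smul_left] at this
    simpa [hε.ne'] using this
  have hAle : ∀ a ∈ A, ∀ x, |inner ℝ a x| ≤ K.supp x + ε * ‖x‖ := by
    intro a ha x
    have hK0 : 0 ≤ K.supp x := by
      have := supp_add_le K x (-x)
      rw [add_neg_cancel, supp_apply_zero, hK] at this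
      linarith
    rcases Finset.mem_union.1 ha with ha | ha
    · have ha : a ∈ K := htK (htf.mem_toFinset.1 ha)
      have h1 := le_supp ha x
      have h2 := le_supp ha (-x)
      rw [inner_neg_right, hK] at h2
      have : |inner ℝ a x| ≤ K.supp x := abs_le.2 ⟨by linarith, h1⟩
      have := mul_nonneg hε.le (norm_nonneg x)
      linarith
    · obtain ⟨i, -, rfl⟩ := Finset.mem_image.1 ha
      have := abs_real_inner_le_norm (ε • b i) x
      rw [norm_smul, b.norm_eq_one, mul_one, Real.norm_of_nonneg hε.le] at this
      linarith
  obtain ⟨a₀, ha₀⟩ : A.Nonempty := by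
    obtain ⟨y, hy⟩ := K.nonempty
    obtain ⟨a, ha, -⟩ := mem_iUnion₂.1 (htc hy)
    exact ⟨a, Finset.mem_union_left _ (htf.mem_toFinset.2 ha)⟩
  have hN : 1 ≤ (A.card : ℝ) := by exact_mod_cast Finset.card_pos.2 ⟨a₀, ha₀⟩
  have hlim : Filter.Tendsto (fun m : ℕ => (A.card : ℝ) ^ (1 / (2 * (m + 1 : ℕ) : ℝ)))
      Filter.atTop (nhds 1) := by
    have h0 : Filter.Tendsto (fun m : ℕ => 1 / (2 * (m + 1 : ℕ) : ℝ)) Filter.atTop (nhds 0) := by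
      have := (tendsto_one_div_add_atTop_nhds_zero_nat (𝕜 := ℝ)).const_mul (1 / 2)
      rw [mul_zero] at this
      refine this.congr fun m => ?_
      push_cast
      field_simp
    have := (Real.continuous_const_rpow (a := (A.card : ℝ)) (by positivity)).tendsto 0
    rw [Real.rpow_zero] at this
    exact this.comp h0
  obtain ⟨m, hm⟩ : ∃ m : ℕ, (A.card : ℝ) ^ (1 / (2 * (m + 1 : ℕ) : ℝ)) < 1 + ε / (D + ε) :=
    (hlim.eventually_lt_const (lt_add_of_pos_right 1 (by positivity))).exists
  obtain ⟨L, hL, hLsym, hLs⟩ := exists_isGZ_lp A hA m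
  refine ⟨L, ⟨hL, hLsym⟩, lt_of_le_of_lt (dist_le_of_supp (by positivity) fun x => ?_) hεe⟩
  set p : ℝ := 2 * (m + 1 : ℕ) with hp
  have hp0 : 0 < p := by rw [hp]; positivity
  have hM : 0 ≤ K.supp x + ε * ‖x‖ := (abs_nonneg _).trans (hAle a₀ ha₀ x)
  have hup : L.supp x ≤ (A.card : ℝ) ^ (1 / p) * (K.supp x + ε * ‖x‖) := by
    rw [hLs]
    calc _ ≤ ((A.card : ℝ) * (K.supp x + ε * ‖x‖) ^ p) ^ (1 / p) := by
          apply Real.rpow_le_rpow (Finset.sum_nonneg fun _ _ => by positivity) _ (by positivity)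
          rw [← nsmul_eq_mul]
          apply Finset.sum_le_card_nsmul
          intro a ha
          exact Real.rpow_le_rpow (abs_nonneg _) (hAle a ha x) hp0.le
      _ = _ := by
          rw [Real.mul_rpow (by positivity) (by positivity), ← Real.rpow_mul hM,
            mul_one_div_cancel hp0.ne', Real.rpow_one]
  have hlow : K.supp x ≤ L.supp x + ε * ‖x‖ := by
    obtain ⟨y, hy, hyx, -⟩ := K.exists_supp x
    obtain ⟨a, ha, hya⟩ := mem_iUnion₂.1 (htc hy)
    have haA : a ∈ A := Finset.mem_union_left _ (htf.mem_toFinset.2 ha)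
    have h1 : |inner ℝ a x| ≤ L.supp x := by
      rw [hLs]
      calc |inner ℝ a x| = (|inner ℝ a x| ^ p) ^ (1 / p) := by
            rw [← Real.rpow_mul (abs_nonneg _), mul_one_div_cancel hp0.ne', Real.rpow_one]
        _ ≤ _ := by
            refine Real.rpow_le_rpow (by positivity) ?_ (by positivity)
            exact Finset.single_le_sum (f := fun a => |inner ℝ a x| ^ p)
              (fun _ _ => by positivity) haA
    have h2 : inner ℝ (y - a) x ≤ ε * ‖x‖ := by
      refine (real_inner_le_norm _ _).trans ?_
      gcongr
      rw [← dist_eq_norm]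
      exact (Metric.mem_ball.1 hya).le
    rw [inner_sub_left] at h2
    linarith [le_abs_self (inner ℝ a x)]
  have h3 : (K.supp x + ε * ‖x‖) ≤ (D + ε) * ‖x‖ := by linarith [hD x]
  have h4 : ε / (D + ε) * (K.supp x + ε * ‖x‖) ≤ ε * ‖x‖ := by
    calc _ ≤ ε / (D + ε) * ((D + ε) * ‖x‖) := by gcongr
      _ = ε * ‖x‖ := by field_simp
  rw [abs_le]
  constructor
  · nlinarith [mul_le_mul_of_nonneg_right hm.le hM]
  · linarith [mul_nonneg hε.le (norm_nonneg x)]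

/-- A condition which is stable under limits and which can be checked after adding zonoids on both
sides holds for all symmetric bodies. -/
theorem symm_induction {P : ConvexBody V → Prop} (hcl : IsClosed {K | P K})
    (hGZ : ∀ K, (∀ x, K.supp (-x) = K.supp x) → ∀ Z ∈ zonoids V, K + Z ∈ zonoids V → P K)
    {K : ConvexBody V} (hK : ∀ x, K.supp (-x) = K.supp x) : P K := by
  have : closure {L : ConvexBody V | IsGZ L ∧ ∀ x, L.supp (-x) = L.supp x} ⊆ {K | P K} :=
    closure_minimal (fun L ⟨⟨Z, hZ, hLZ⟩, hL⟩ => hGZ L hL Z hZ hLZ) hcl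
  exact this (mem_closure_isGZ hK)

omit [FiniteDimensional ℝ V] in
theorem zonoid_induction {P : ConvexBody V → Prop} (hcl : IsClosed {K | P K})
    (h : ∀ l, P (zon l)) {K : ConvexBody V} (hK : K ∈ zonoids V) : P K :=
  closure_minimal (by rintro _ ⟨l, rfl⟩; exact h l) hcl hK

/-- Valuations of degree one are additive. -/
theorem IsVal.add_of_mem_zonoids {T : ConvexBody V → ℝ} (h : IsVal 1 T) (K : ConvexBody V)
    {Z : ConvexBody V} (hZ : Z ∈ zonoids V) : T (K + Z) = T K + T Z := by
  refine zonoid_induction (P := fun Z => T (K + Z) = T K + T Z) (isClosed_eq ?_ ?_) ?_ hZ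
  · exact h.cont.comp (continuous_const.add continuous_id)
  · exact continuous_const.add h.cont
  · intro l
    induction l with
    | nil => simp [h.apply_zero]
    | cons v l ih =>
      have h1 := (h.isVal_segDiff v).eq_const (K + zon l)
      have h2 := (h.isVal_segDiff v).eq_const (zon l)
      rw [← h2, segDiff, segDiff] at h1
      rw [zon_cons, add_comm (seg v), ← add_assoc]
      linarith

theorem IsVal.add_of_symm {T : ConvexBody V → ℝ} (h : IsVal 1 T) (K : ConvexBody V)
    {L : ConvexBody V} (hL : ∀ x, L.supp (-x) = L.supp x) : T (K + L) = T K + T L := by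
  refine symm_induction (P := fun L => T (K + L) = T K + T L) (isClosed_eq ?_ ?_) ?_ hL
  · exact h.cont.comp (continuous_const.add continuous_id)
  · exact continuous_const.add h.cont
  · intro L _ Z hZ hLZ
    have h1 := h.add_of_mem_zonoids K hLZ
    have h2 := h.add_of_mem_zonoids L hZ
    have h3 := h.add_of_mem_zonoids (K + L) hZ
    rw [← add_assoc] at h1
    linarith

omit [FiniteDimensional ℝ V] in
theorem exists_symm_zon (l : List V) :
    ∃ w, ∀ x, (zon l + point w).supp (-x) = (zon l + point w).supp x := by
  refine ⟨-(1 / 2 : ℝ) • l.sum, fun x => ?_⟩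
  induction l with
  | nil => simp [supp_point]
  | cons v l ih =>
    simp only [supp_add_body, zon_cons, supp_point, supp_seg, List.sum_cons, smul_add,
      inner_add_left, inner_smul_left, inner_neg_right, conj_trivial] at ih ⊢
    rcases le_total 0 (inner ℝ v x) with h' | h'
    · rw [max_eq_right h', max_eq_left (by linarith)]; linarith
    · rw [max_eq_left h', max_eq_right (by linarith)]; linarith

/-- A valuation vanishing on all parallelotopes of the right dimension vanishes on symmetric
bodies. -/
theorem IsVal.eq_zero_of_zon {k : ℕ} {μ : ConvexBody V → ℝ} (h : IsVal k μ)
    (hz : ∀ l : List V, l.length = k → μ (zon l) = 0) {K : ConvexBody V}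
    (hK : ∀ x, K.supp (-x) = K.supp x) : μ K = 0 := by
  induction k generalizing μ K with
  | zero => rw [h.eq_const, ← h.eq_const (zon []), hz _ rfl]
  | succ k ih =>
    have hd : ∀ (v : V) (L : ConvexBody V) (w : V),
        (∀ x, (L + point w).supp (-x) = (L + point w).supp x) → segDiff v μ L = 0 := by
      intro v L w hL
      have hv := h.isVal_segDiff v
      rw [← hv.ti.add_point L w]
      refine ih hv (fun l hl => ?_) hL
      rw [← h.apply_zon_cons (by omega), hz _ (by simp [hl])]
    have hadd : ∀ L : ConvexBody V, (∀ x, L.supp (-x) = L.supp x) → ∀ Z ∈ zonoids V,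
        μ (L + Z) = μ L := by
      intro L hL Z hZ
      refine zonoid_induction (P := fun Z => μ (L + Z) = μ L) (isClosed_eq ?_ ?_) ?_ hZ
      · exact h.cont.comp (continuous_const.add continuous_id)
      · exact continuous_const
      · intro l
        induction l with
        | nil => simp
        | cons v l ih =>
          obtain ⟨w, hw⟩ := exists_symm_zon l
          have := hd v (L + zon l) w fun x => by
            simp only [add_assoc, supp_add_body L, hL, hw]
          rw [segDiff, add_assoc, sub_eq_zero] at this
          rw [zon_cons, add_comm (seg v), this, ih]
    refine symm_induction (isClosed_eq h.cont continuous_const) (fun L hL Z hZ hLZ => ?_) hK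
    rw [← hadd L hL Z hZ, ← zero_add (L + Z), hadd 0 (fun x => by simp) _ hLZ, h.apply_zero]

end Density

section Locality
open ConvexBody Set

variable {V : Type*} [NormedAddCommGroup V] [InnerProductSpace ℝ V] [FiniteDimensional ℝ V]

/-- If the maximum and the minimum of two support functions are support functions, then the
union of the two bodies is convex. -/
theorem coe_eq_union_of_supp {K L M I : ConvexBody V}
    (hM : ∀ x, M.supp x = max (K.supp x) (L.supp x))
    (hI : ∀ x, I.supp x = min (K.supp x) (L.supp x)) : (M : Set V) = (K : Set V) ∪ L := by
  apply Subset.antisymm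
  · intro z hz
    by_contra hzn
    have h1 : ¬ ∀ x, inner ℝ z x ≤ K.supp x := fun h => hzn (Or.inl (mem_of_inner_le_supp h))
    have h2 : ¬ ∀ x, inner ℝ z x ≤ L.supp x := fun h => hzn (Or.inr (mem_of_inner_le_supp h))
    push Not at h1 h2
    obtain ⟨x, hx⟩ := h1
    obtain ⟨y, hy⟩ := h2
    have hzM : ∀ w, inner ℝ z w ≤ max (K.supp w) (L.supp w) := fun w => hM w ▸ le_supp hz w
    have hxL : inner ℝ z x ≤ L.supp x := (le_max_iff.1 (hzM x)).resolve_left hx.not_ge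
    have hyK : inner ℝ z y ≤ K.supp y := (le_max_iff.1 (hzM y)).resolve_right hy.not_ge
    obtain ⟨t, ht, hte⟩ : ∃ t ∈ Icc (0 : ℝ) 1,
        K.supp ((1 - t) • x + t • y) - L.supp ((1 - t) • x + t • y) = 0 := by
      refine intermediate_value_Icc zero_le_one (f := fun t : ℝ =>
        K.supp ((1 - t) • x + t • y) - L.supp ((1 - t) • x + t • y)) ?_ ⟨?_, ?_⟩
      · have := K.continuous_supp
        have := L.continuous_supp
        fun_prop
      · simp; linarith
      · simp; linarith
    have e1 := hzM ((1 - t) • x + t • y)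
    have e2 := I.supp_add_le ((1 - t) • x) (t • y)
    rw [supp_smul _ (sub_nonneg.2 ht.2), supp_smul _ ht.1, hI, hI x, hI y] at e2
    rw [sub_eq_zero.1 hte] at e1 e2
    rw [max_self, inner_add_right, inner_smul_right, inner_smul_right] at e1
    rw [min_self] at e2
    have e3 : min (K.supp x) (L.supp x) < inner ℝ z x := (min_le_left _ _).trans_lt hx
    have e4 : min (K.supp y) (L.supp y) < inner ℝ z y := (min_le_right _ _).trans_lt hy
    rcases ht.1.lt_or_eq with h | h
    · nlinarith [mul_lt_mul_of_pos_left e4 h, mul_le_mul_of_nonneg_left e3.le (sub_nonneg.2 ht.2)]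
    · subst h; simp at e1 e2; linarith
  · exact union_subset (subset_of_supp_le fun x => hM x ▸ le_max_left _ _)
      (subset_of_supp_le fun x => hM x ▸ le_max_right _ _)

theorem coe_eq_inter_of_supp {K L I : ConvexBody V}
    (hI : ∀ x, I.supp x = min (K.supp x) (L.supp x)) : (I : Set V) = (K : Set V) ∩ L := by
  apply Subset.antisymm
  · exact subset_inter (subset_of_supp_le fun x => hI x ▸ min_le_left _ _)
      (subset_of_supp_le fun x => hI x ▸ min_le_right _ _)
  · exact fun y hy => mem_of_inner_le_supp fun x => hI x ▸ le_min (le_supp hy.1 x) (le_supp hy.2 x)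

theorem IsValuation.exchange {μ : ConvexBody V → ℝ} (h : IsValuation μ) {Q D Z Y : ConvexBody V}
    (hD : ∀ x, D.supp x ≤ Q.supp x) (hZ : ∀ x, Z.supp x ≤ Y.supp x)
    (hor : ∀ x, Q.supp x = D.supp x ∨ Z.supp x = Y.supp x) :
    μ (Q + Y) + μ (D + Z) = μ (Q + Z) + μ (D + Y) := by
  have hI : ∀ x, (D + Z).supp x = min ((Q + Z).supp x) ((D + Y).supp x) := by
    intro x
    simp only [supp_add_body]
    have h1 := hD x
    have h2 := hZ x
    rcases hor x with h | h
    · rw [h, min_eq_left (by linarith)]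
    · rw [h, min_eq_right (by linarith)]
  refine h _ _ _ _ (coe_eq_union_of_supp (fun x => ?_) hI) (coe_eq_inter_of_supp hI)
  simp only [supp_add_body]
  have h1 := hD x
  have h2 := hZ x
  rcases hor x with h | h
  · rw [h, max_eq_right (by linarith)]
  · rw [h, max_eq_left (by linarith)]

theorem IsValuation.sub_eq_sub_of_supp {μ : ConvexBody V → ℝ} (h : IsValuation μ)
    {Q D Z Y : ConvexBody V} (hD : ∀ x, D.supp x ≤ Q.supp x)
    (hor : ∀ x, Q.supp x = D.supp x ∨ Z.supp x = Y.supp x) :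
    μ (Q + Z) - μ (D + Z) = μ (Q + Y) - μ (D + Y) := by
  obtain ⟨X, hX⟩ : ∃ X : ConvexBody V, ∀ x, X.supp x = max (Z.supp x) (Y.supp x) := by
    refine exists_supp_eq (fun t ht x => ?_) fun x y => ?_
    · rw [supp_smul _ ht.le, supp_smul _ ht.le, mul_max_of_nonneg _ _ ht.le]
    · exact max_le
        ((supp_add_le _ _ _).trans (add_le_add (le_max_left _ _) (le_max_left _ _)))
        ((supp_add_le _ _ _).trans (add_le_add (le_max_right _ _) (le_max_right _ _)))
  have h1 := h.exchange hD (fun x => hX x ▸ le_max_left _ _)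
    (fun x => (hor x).imp_right fun e => by rw [hX, e, max_self])
  have h2 := h.exchange hD (fun x => hX x ▸ le_max_right _ _)
    (fun x => (hor x).imp_right fun e => by rw [hX, e, max_self])
  linarith

/-- The convex hull of a ball and a symmetric segment, through its support function. -/
theorem exists_cap {t : ℝ} (ht : 0 ≤ t) (n : V) :
    ∃ K : ConvexBody V, ∀ x, K.supp x = max (‖n‖ * ‖x‖) (t * |inner ℝ n x|) := by
  refine exists_supp_eq (fun s hs x => ?_) fun x y => ?_
  · rw [norm_smul, inner_smul_right, abs_mul, abs_of_pos hs, Real.norm_of_nonneg hs.le,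
      mul_max_of_nonneg _ _ hs.le]
    congr 1 <;> ring
  · have h1 : ‖n‖ * ‖x + y‖ ≤ ‖n‖ * ‖x‖ + ‖n‖ * ‖y‖ := by
      rw [← mul_add]; gcongr; exact norm_add_le _ _
    have h2 : t * |inner ℝ n (x + y)| ≤ t * |inner ℝ n x| + t * |inner ℝ n y| := by
      rw [← mul_add, inner_add_right]; gcongr; exact abs_add_le _ _
    exact max_le (h1.trans (add_le_add (le_max_left _ _) (le_max_left _ _)))
      (h2.trans (add_le_add (le_max_right _ _) (le_max_right _ _)))

/-- The convex hull of the ball of radius `‖n‖` and the points `± t • n`. -/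
def cap (t : ℝ≥0) (n : V) : ConvexBody V := (exists_cap t.2 n).choose

theorem supp_cap (t : ℝ≥0) (n x : V) :
    (cap t n).supp x = max (‖n‖ * ‖x‖) (t * |inner ℝ n x|) := (exists_cap t.2 n).choose_spec x

theorem supp_cap_neg (t : ℝ≥0) (n x : V) : (cap t n).supp (-x) = (cap t n).supp x := by
  simp [supp_cap, inner_neg_right]

theorem supp_cap_zero (n x : V) : (cap 0 n).supp x = ‖n‖ * ‖x‖ := by
  rw [supp_cap, NNReal.coe_zero, zero_mul, max_eq_left (by positivity)]

theorem cap_smul {a : ℝ} (ha : 0 ≤ a) (t : ℝ≥0) (n : V) : cap t (a • n) = a • cap t n := by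
  refine ext_supp fun x => ?_
  rw [supp_smul_body, supp_smul _ ha, supp_cap, supp_cap, mul_max_of_nonneg _ _ ha, norm_smul,
    inner_smul_left, Real.norm_of_nonneg ha, conj_trivial, abs_mul, abs_of_nonneg ha]
  congr 1 <;> ring

theorem map_cap {W : Type*} [NormedAddCommGroup W] [InnerProductSpace ℝ W]
    [FiniteDimensional ℝ W] (f : V ≃ₗᵢ[ℝ] W) (t : ℝ≥0) (n : V) :
    (cap t n).map f.toContinuousLinearEquiv.toContinuousLinearMap = cap t (f n) := by
  refine ext_supp fun x => ?_
  rw [supp_map' (y := f.symm x), supp_cap, supp_cap, f.norm_map, f.symm.norm_map,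
    ← f.inner_map_map n, f.apply_symm_apply]
  intro v
  have := f.inner_map_map v (f.symm x)
  rw [f.apply_symm_apply] at this
  exact this

theorem continuous_cap (t : ℝ≥0) : Continuous (cap t : V → ConvexBody V) := by
  have : LipschitzWith (max 1 t) (cap t : V → ConvexBody V) := by
    apply LipschitzWith.of_dist_le_mul
    intro n m
    apply dist_le_of_supp (by positivity)
    intro x
    rw [supp_cap, supp_cap, NNReal.coe_max, NNReal.coe_one]
    refine (abs_max_sub_max_le_max _ _ _ _).trans (max_le ?_ ?_)
    · rw [← sub_mul, abs_mul, abs_norm]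
      gcongr
      calc |‖n‖ - ‖m‖| ≤ ‖n - m‖ := abs_norm_sub_norm_le _ _
        _ = 1 * dist n m := by rw [one_mul, dist_eq_norm]
        _ ≤ _ := by gcongr; exact le_max_left _ _
    · rw [← mul_sub, abs_mul, NNReal.abs_eq, mul_assoc]
      refine mul_le_mul (le_max_right _ _) ?_ (abs_nonneg _) (by positivity)
      refine (abs_abs_sub_abs_le _ _).trans ?_
      rw [← inner_sub_left, dist_eq_norm]
      exact abs_real_inner_le_norm _ _
  exact this.continuous

/-- The change of `K ↦ μ (Q + K) - μ (D + K)` caused by a zonoid. -/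
def mixDiff (μ : ConvexBody V → ℝ) (Q D K : ConvexBody V) : ℝ :=
  μ (Q + K) - μ (D + K) - (μ Q - μ D)

omit [FiniteDimensional ℝ V] in
theorem mixDiff_zero (μ : ConvexBody V → ℝ) (Q D : ConvexBody V) : mixDiff μ Q D 0 = 0 := by
  simp [mixDiff]

omit [FiniteDimensional ℝ V] in
theorem mixDiff_seg (μ : ConvexBody V → ℝ) (Q D : ConvexBody V) (v : V) :
    mixDiff μ Q D (seg v) = segDiff v μ Q - segDiff v μ D := by
  simp [mixDiff, segDiff]; ring

theorem IsVal.continuous_mixDiff {μ : ConvexBody V → ℝ} {k : ℕ} (h : IsVal k μ)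
    (Q D : ConvexBody V) : Continuous (mixDiff μ Q D) := by
  have := h.cont
  unfold mixDiff
  fun_prop

theorem IsVal.mixDiff_add {μ : ConvexBody V → ℝ} (h : IsVal 2 μ) (Q D : ConvexBody V)
    {Z Y : ConvexBody V} (hZ : Z ∈ zonoids V) (hY : Y ∈ zonoids V) :
    mixDiff μ Q D (Z + Y) = mixDiff μ Q D Z + mixDiff μ Q D Y := by
  have hs : ∀ {Z}, Z ∈ zonoids V → ∀ v,
      mixDiff μ Q D (Z + seg v) = mixDiff μ Q D Z + mixDiff μ Q D (seg v) := by
    intro Z hZ v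
    have h1 := (h.isVal_segDiff v).add_of_mem_zonoids Q hZ
    have h2 := (h.isVal_segDiff v).add_of_mem_zonoids D hZ
    simp only [segDiff, mixDiff, add_assoc] at h1 h2 ⊢
    linarith
  have hc := h.continuous_mixDiff Q D
  refine zonoid_induction (P := fun Y => mixDiff μ Q D (Z + Y) = mixDiff μ Q D Z + mixDiff μ Q D Y)
    (isClosed_eq (by fun_prop) (by fun_prop)) (fun l => ?_) hY
  induction l with
  | nil => simp [mixDiff_zero]
  | cons v l ih =>
    rw [zon_cons, add_comm (seg v), ← add_assoc,
      hs (isBodyCone_zonoids.add_mem hZ (zon_mem_zonoids l)), hs (zon_mem_zonoids l), ih]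
    ring

theorem IsVal.isLinOn_mixDiff {μ : ConvexBody V → ℝ} (h : IsVal 2 μ) (Q D : ConvexBody V) :
    IsLinOn (zonoids V) (mixDiff μ Q D) where
  cont := h.continuous_mixDiff Q D
  add := h.mixDiff_add Q D
  smul {t K} ht hK := by
    have := linear_of_additive_of_nonneg (f := fun t : ℝ => mixDiff μ Q D (t • K))
      ((h.continuous_mixDiff Q D).comp (continuous_smul_left K)) (fun a b ha hb => ?_) ht
    · simpa using this
    · rw [← h.mixDiff_add Q D (isBodyCone_zonoids.smul_mem ha hK)
        (isBodyCone_zonoids.smul_mem hb hK)]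
      congr 1
      refine ext_supp fun x => ?_
      simp only [supp_add_body, supp_smul_body]
      rw [supp_smul _ ha, supp_smul _ hb, supp_smul _ (by positivity)]
      ring

theorem map_mem_zonoids {W : Type*} [NormedAddCommGroup W] [InnerProductSpace ℝ W]
    [FiniteDimensional ℝ W] (f : V →L[ℝ] W) {Z : ConvexBody V} (hZ : Z ∈ zonoids V) :
    Z.map f ∈ zonoids W :=
  map_mem_closure (continuous_map f) hZ (by
    rintro _ ⟨l, rfl⟩
    exact ⟨l.map f, (map_zon f l).symm⟩)

theorem IsVal.segDiff_map_proj {μ : ConvexBody V → ℝ} (h : IsVal 2 μ) (v : V) {K : ConvexBody V}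
    (hK : ∀ x, K.supp (-x) = K.supp x) :
    segDiff v μ (K.map (Submodule.span ℝ {v})ᗮ.starProjection) = segDiff v μ K := by
  set π : V →L[ℝ] V := (Submodule.span ℝ {v})ᗮ.starProjection with hπ
  have hT := h.isVal_segDiff v
  have hc := hT.cont
  have hm := continuous_map π
  have hs : ∀ u, segDiff v μ (seg (π u)) = segDiff v μ (seg u) := by
    intro u
    obtain ⟨c, hc⟩ : ∃ c : ℝ, π u = u + c • v := by
      obtain ⟨c, hc⟩ := Submodule.mem_span_singleton.1
        (Submodule.starProjection_apply_mem (Submodule.span ℝ {v}) u)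
      refine ⟨-c, ?_⟩
      rw [hπ, Submodule.starProjection_orthogonal_val, ← hc, neg_smul, sub_eq_add_neg]
    have h1 : ∀ w, μ (seg w) = 0 := fun w => by simpa using h.zon_eq_zero (l := [w]) (by simp)
    rw [segDiff, segDiff, h1, h1, hc, h.shear]
  have hz : ∀ Z ∈ zonoids V, segDiff v μ (Z.map π) = segDiff v μ Z := by
    intro Z hZ
    refine zonoid_induction (P := fun Z => segDiff v μ (Z.map π) = segDiff v μ Z)
      (isClosed_eq (hc.comp hm) hc) (fun l => ?_) hZ
    rw [map_zon]
    induction l with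
    | nil => rfl
    | cons u l ih =>
      rw [List.map_cons, zon_cons, zon_cons, hT.add_of_mem_zonoids _ (zon_mem_zonoids _),
        hT.add_of_mem_zonoids _ (zon_mem_zonoids _), ih, hs]
  refine symm_induction (P := fun K => segDiff v μ (K.map π) = segDiff v μ K)
    (isClosed_eq (hc.comp hm) hc) (fun K _ Z hZ hKZ => ?_) hK
  have h1 := hz _ hKZ
  rw [ConvexBody.map_add, hT.add_of_mem_zonoids _ (map_mem_zonoids π hZ),
    hT.add_of_mem_zonoids _ hZ, hz Z hZ] at h1
  linarith

theorem IsVal.segDiff_eq_of_supp {μ : ConvexBody V → ℝ} (h : IsVal 2 μ) (v : V)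
    {K L : ConvexBody V} (hK : ∀ x, K.supp (-x) = K.supp x) (hL : ∀ x, L.supp (-x) = L.supp x)
    (hKL : ∀ x, inner ℝ v x = 0 → K.supp x = L.supp x) : segDiff v μ K = segDiff v μ L := by
  rw [← h.segDiff_map_proj v hK, ← h.segDiff_map_proj v hL]
  congr 1
  refine ext_supp fun x => ?_
  have hi : ∀ w, inner ℝ ((Submodule.span ℝ {v})ᗮ.starProjection w) x
      = inner ℝ w ((Submodule.span ℝ {v})ᗮ.starProjection x) :=
    fun w => Submodule.inner_starProjection_left_eq_right _ _ _
  rw [supp_map' hi, supp_map' hi]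
  exact hKL _ (Submodule.mem_orthogonal_singleton_iff_inner_right.1
    (Submodule.starProjection_apply_mem _ x))

end Locality

section Kernel
open ConvexBody Set

section Slab

variable (E : Type*) [NormedAddCommGroup E] [InnerProductSpace ℝ E] [FiniteDimensional ℝ E]
  [MeasurableSpace E] [BorelSpace E]

/-- The measure on the product of the unit ball and the interval `[-2, 2]`. -/
def slab : Measure (E × ℝ) :=
  (volume.restrict (Metric.closedBall (0 : E) 1)).prod (volume.restrict (Icc (-2 : ℝ) 2))

instance : IsFiniteMeasure (volume.restrict (Metric.closedBall (0 : E) 1)) :=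
  isFiniteMeasure_restrict.2 (isCompact_closedBall _ _).measure_ne_top

instance : IsFiniteMeasure (slab E) := by unfold slab; infer_instance

theorem slab_eq : slab E
    = (volume : Measure (E × ℝ)).restrict (Metric.closedBall (0 : E) 1 ×ˢ Icc (-2 : ℝ) 2) :=
  Measure.prod_restrict _ _

variable {E}

theorem integrable_slab {F : Type*} [NormedAddCommGroup F] {f : E × ℝ → F} (hf : Continuous f) :
    Integrable f (slab E) := by
  rw [slab_eq]
  exact hf.continuousOn.integrableOn_compact ((isCompact_closedBall _ _).prod isCompact_Icc)

theorem integral_ball_comp (R : E ≃ₗᵢ[ℝ] E) (f : E → ℝ) :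
    ∫ m in Metric.closedBall (0 : E) 1, f (R m) = ∫ m in Metric.closedBall (0 : E) 1, f m := by
  have := R.measurePreserving.setIntegral_preimage_emb R.toHomeomorph.measurableEmbedding f
    (Metric.closedBall 0 1)
  simpa using this

theorem integral_slab_comp (R : E ≃ₗᵢ[ℝ] E) (f : E × ℝ → ℝ) :
    ∫ ω, f (R ω.1, ω.2) ∂slab E = ∫ ω, f ω ∂slab E := by
  have h1 : MeasurePreserving R (volume.restrict (Metric.closedBall (0 : E) 1))
      (volume.restrict (Metric.closedBall (0 : E) 1)) := by
    have := R.measurePreserving.restrict_preimage (s := Metric.closedBall (0 : E) 1)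
      Metric.isClosed_closedBall.measurableSet
    simpa using this
  have h2 : MeasurePreserving (Prod.map R id) (slab E) (slab E) := h1.prod (.id _)
  exact h2.integral_comp ((R.toHomeomorph.prodCongr (.refl ℝ)).measurableEmbedding) f

/-- The height of a cap over the ball, integrated over a family of caps. -/
def capKer (t : ℝ) (u : E) (ω : E × ℝ) : ℝ :=
  max 0 (t * |inner ℝ u ω.1| - Real.sqrt (1 + ω.2 ^ 2) * ‖u‖ * ‖ω.1‖)

omit [FiniteDimensional ℝ E] [MeasurableSpace E] [BorelSpace E] in
theorem capKer_nonneg (t : ℝ) (u : E) (ω : E × ℝ) : 0 ≤ capKer t u ω := le_max_left _ _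

omit [FiniteDimensional ℝ E] [MeasurableSpace E] [BorelSpace E] in
theorem continuous_capKer (t : ℝ) (u : E) : Continuous (capKer t u) := by
  unfold capKer; fun_prop

omit [FiniteDimensional ℝ E] [MeasurableSpace E] [BorelSpace E] in
theorem capKer_smul (t : ℝ) {a : ℝ} (ha : 0 ≤ a) (u : E) (ω : E × ℝ) :
    capKer t (a • u) ω = a * capKer t u ω := by
  rw [capKer, capKer, mul_max_of_nonneg _ _ ha, inner_smul_left, norm_smul, abs_mul,
    conj_trivial, Real.norm_of_nonneg ha, abs_of_nonneg ha]
  congr 1 <;> ring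

omit [FiniteDimensional ℝ E] [MeasurableSpace E] [BorelSpace E] in
theorem capKer_isometry (t : ℝ) (R : E ≃ₗᵢ[ℝ] E) (u m : E) (s : ℝ) :
    capKer t (R u) (R m, s) = capKer t u (m, s) := by
  simp [capKer]

omit [FiniteDimensional ℝ E] [MeasurableSpace E] [BorelSpace E] in
theorem exists_isometry_swap {u v : E} (h : ‖u‖ = ‖v‖) : ∃ R : E ≃ₗᵢ[ℝ] E, R u = v ∧ R v = u := by
  refine ⟨Submodule.reflection (Submodule.span ℝ {u - v})ᗮ, Submodule.reflection_sub h, ?_⟩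
  have := Submodule.reflection_reflection (Submodule.span ℝ {u - v})ᗮ u
  rwa [Submodule.reflection_sub h] at this

theorem integral_capKer_comm (t : ℝ) (u v : E) :
    ∫ ω, |inner ℝ u ω.1| * ‖ω.1‖ * capKer t v ω ∂slab E
      = ∫ ω, capKer t u ω * ‖ω.1‖ * |inner ℝ v ω.1| ∂slab E := by
  have key : ∀ u v : E, ‖u‖ = ‖v‖ → ∫ ω, |inner ℝ u ω.1| * ‖ω.1‖ * capKer t v ω ∂slab E
      = ∫ ω, capKer t u ω * ‖ω.1‖ * |inner ℝ v ω.1| ∂slab E := by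
    intro u v h
    obtain ⟨R, h1, h2⟩ := exists_isometry_swap h
    rw [← integral_slab_comp R]
    congr 1; ext ω
    have e1 := capKer_isometry t R u ω.1 ω.2
    have e2 := R.inner_map_map v ω.1
    rw [h1] at e1
    rw [h2] at e2
    rw [e1, e2, R.norm_map]
    ring
  rcases eq_or_ne v 0 with rfl | hv
  · simp [capKer]
  have hv := norm_ne_zero_iff.2 hv
  obtain ⟨a, w, ha, hw, rfl⟩ : ∃ (a : ℝ) (w : E), 0 ≤ a ∧ ‖w‖ = ‖v‖ ∧ u = a • w := by
    rcases eq_or_ne u 0 with rfl | hu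
    · exact ⟨0, v, le_rfl, rfl, by simp⟩
    have hu := norm_ne_zero_iff.2 hu
    refine ⟨‖u‖ / ‖v‖, (‖v‖ / ‖u‖) • u, by positivity, ?_, ?_⟩
    · rw [norm_smul, norm_div, norm_norm, norm_norm]; field_simp
    · rw [smul_smul, div_mul_div_comm, mul_comm, div_self (by positivity), one_smul]
  have := congrArg (a * ·) (key w v hw)
  simp only [← integral_const_mul] at this
  have e1 : ∀ ω : E × ℝ, |inner ℝ (a • w) ω.1| * ‖ω.1‖ * capKer t v ω
      = a * (|inner ℝ w ω.1| * ‖ω.1‖ * capKer t v ω) := fun ω => by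
    rw [inner_smul_left, abs_mul, conj_trivial, abs_of_nonneg ha]; ring
  have e2 : ∀ ω : E × ℝ, capKer t (a • w) ω * ‖ω.1‖ * |inner ℝ v ω.1|
      = a * (capKer t w ω * ‖ω.1‖ * |inner ℝ v ω.1|) := fun ω => by
    rw [capKer_smul t ha]; ring
  simp only [e1, e2, this]

theorem integral_capKer_pos {t : ℝ} (ht : 1 < t) {u : E} (hu : ‖u‖ = 1) :
    0 < ∫ ω, capKer t u ω * ‖ω.1‖ * ‖ω.1‖ ∂slab E := by
  have hc : Continuous fun ω : E × ℝ => capKer t u ω * ‖ω.1‖ * ‖ω.1‖ := by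
    have := continuous_capKer t u
    fun_prop
  rw [integral_pos_iff_support_of_nonneg (fun ω => by have := capKer_nonneg t u ω; positivity)
    (integrable_slab hc)]
  have ho : IsOpen (Function.support (fun ω : E × ℝ => capKer t u ω * ‖ω.1‖ * ‖ω.1‖) ∩
      Metric.ball (0 : E) 1 ×ˢ Ioo (-2 : ℝ) 2) :=
    (hc.isOpen_support).inter (Metric.isOpen_ball.prod isOpen_Ioo)
  have hne : (Function.support (fun ω : E × ℝ => capKer t u ω * ‖ω.1‖ * ‖ω.1‖) ∩
      Metric.ball (0 : E) 1 ×ˢ Ioo (-2 : ℝ) 2).Nonempty := by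
    refine ⟨((1 / 2 : ℝ) • u, 0), ?_, ?_⟩
    · simp only [Function.mem_support]
      refine (mul_pos (mul_pos ?_ ?_) ?_).ne'
      · rw [capKer, inner_smul_right, real_inner_self_eq_norm_sq, norm_smul, hu]
        refine lt_max_of_lt_right ?_
        norm_num
        linarith
      all_goals rw [norm_smul, hu]; norm_num
    · simp [norm_smul, hu]; norm_num
  rw [slab_eq]
  refine (ho.measure_pos volume hne).trans_le ?_
  calc _ = volume.restrict (Metric.closedBall (0 : E) 1 ×ˢ Icc (-2 : ℝ) 2) _ :=
        (Measure.restrict_eq_self _ (inter_subset_right.trans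
          (prod_mono Metric.ball_subset_closedBall Ioo_subset_Icc_self))).symm
    _ ≤ _ := measure_mono inter_subset_left

theorem integral_quadratic {e e' u : E} {a b : ℝ} (he : ‖e‖ = 1) (he' : ‖e'‖ = 1)
    (hee : inner ℝ e e' = 0) (hab : a ^ 2 + b ^ 2 = 1) (hu : u = a • e + b • e') (β γ : ℝ) :
    ∫ m in Metric.closedBall (0 : E) 1, |inner ℝ u m| * (β * ‖m‖ ^ 2 + γ * inner ℝ e m ^ 2)
      = a ^ 2 * (∫ m in Metric.closedBall (0 : E) 1,
          |inner ℝ e m| * (β * ‖m‖ ^ 2 + γ * inner ℝ e m ^ 2))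
        + b ^ 2 * ∫ m in Metric.closedBall (0 : E) 1,
          |inner ℝ e' m| * (β * ‖m‖ ^ 2 + γ * inner ℝ e m ^ 2) := by
  have h_int : ∀ {f : E → ℝ}, Continuous f →
      Integrable f (volume.restrict (Metric.closedBall (0 : E) 1)) := fun hf =>
    hf.continuousOn.integrableOn_compact (isCompact_closedBall _ _)
  have hu1 : ‖e‖ = ‖u‖ := by
    rw [he, eq_comm, ← sq_eq_sq₀ (norm_nonneg _) zero_le_one, hu, norm_add_sq_real, norm_smul,
      norm_smul, inner_smul_left, inner_smul_right, hee, he, he', mul_pow, mul_pow]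
    simpa using hab
  have hsw : ∀ w : E, ‖e‖ = ‖w‖ → ∫ m in Metric.closedBall (0 : E) 1,
        |inner ℝ w m| * (β * ‖m‖ ^ 2 + γ * inner ℝ e m ^ 2)
      = ∫ m in Metric.closedBall (0 : E) 1,
        |inner ℝ e m| * (β * ‖m‖ ^ 2 + γ * inner ℝ w m ^ 2) := by
    intro w hw
    obtain ⟨R, h1, h2⟩ := exists_isometry_swap hw
    rw [← integral_ball_comp R]
    congr 1; ext m
    have e1 := R.inner_map_map e m
    have e2 := R.inner_map_map w m
    rw [h1] at e1
    rw [h2] at e2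
    rw [e1, e2, R.norm_map]
  have hcross : ∫ m in Metric.closedBall (0 : E) 1,
      |inner ℝ e m| * (inner ℝ e m * inner ℝ e' m) = 0 := by
    let R := Submodule.reflection (Submodule.span ℝ {e'})ᗮ
    have h1 : R e = e := by
      refine Submodule.reflection_mem_subspace_eq_self ?_
      rw [Submodule.mem_orthogonal_singleton_iff_inner_left]
      exact hee
    have h2 : R e' = -e' := Submodule.reflection_orthogonalComplement_singleton_eq_neg e'
    have h3 : ∀ m, inner ℝ e (R m) = inner ℝ e m := fun m => by
      rw [← R.inner_map_map e m, h1]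
    have h4 : ∀ m, inner ℝ e' (R m) = -inner ℝ e' m := fun m => by
      rw [← R.inner_map_map e' m, h2, inner_neg_left, neg_neg]
    have := integral_ball_comp R fun m => |inner ℝ e m| * (inner ℝ e m * inner ℝ e' m)
    simp only [h3, h4, mul_neg, integral_neg] at this
    linarith
  rw [hsw u hu1, hsw e' (he.trans he'.symm), ← integral_const_mul, ← integral_const_mul,
    ← integral_add (h_int (by fun_prop)) (h_int (by fun_prop))]
  have h0 : (0 : ℝ) = (2 * a * b * γ) * 0 := by ring
  rw [← sub_eq_zero, ← integral_sub (h_int (by fun_prop)) (h_int (by fun_prop)), h0, ← hcross,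
    ← integral_const_mul]
  congr 1; ext m
  rw [hu, inner_add_left, inner_smul_left, inner_smul_left, conj_trivial, conj_trivial]
  linear_combination (|inner ℝ e m| * (β * ‖m‖ ^ 2)) * (-hab)

end Slab

end Kernel

section KernelIdentity
open ConvexBody Set

variable {V : Type*} [NormedAddCommGroup V] [InnerProductSpace ℝ V] [FiniteDimensional ℝ V]

/-- The difference of the values of `segDiff v μ` on a cap body and the ball inside. -/
def capDiff (μ : ConvexBody V → ℝ) (t : ℝ≥0) (n v : V) : ℝ :=
  segDiff v μ (cap t n) - segDiff v μ (cap 0 n)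

omit [FiniteDimensional ℝ V] in
theorem isBodyCone_symm : IsBodyCone {K : ConvexBody V | ∀ x, K.supp (-x) = K.supp x} where
  zero_mem x := by simp
  add_mem hK hL x := by rw [supp_add_body, supp_add_body, hK, hL]
  smul_mem {t K} ht hK x := by
    rw [supp_smul_body, supp_smul_body, smul_neg]; exact hK _
  closed := by
    simp only [Set.ofPred_forall]
    refine isClosed_iInter fun x => isClosed_eq ?_ ?_
    all_goals
      refine LipschitzWith.continuous (K := ‖x‖₊) (LipschitzWith.of_dist_le_mul fun K L => ?_)
      rw [Real.dist_eq, mul_comm, coe_nnnorm]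
    · simpa using abs_supp_sub_le K L (-x)
    · exact abs_supp_sub_le K L x

theorem IsVal.isLinOn_symm {T : ConvexBody V → ℝ} (h : IsVal 1 T) :
    IsLinOn {K : ConvexBody V | ∀ x, K.supp (-x) = K.supp x} T where
  cont := h.cont
  add _ hL := h.add_of_symm _ hL
  smul {t K} ht _ := by
    rcases ht.eq_or_lt with rfl | ht
    · have h0 : (0 : ℝ) • K = 0 := ext_supp fun x => by simp [supp_smul_body]
      rw [h0, h.apply_zero, zero_mul]
    · have := h.hom K t ht
      rwa [dilate_eq, pow_one] at this

theorem continuous_smul_of_bodies {X : Type*} [TopologicalSpace X] {f : X → ℝ}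
    {K : X → ConvexBody V} (hf : Continuous f) (hK : Continuous K) (h0 : ∀ x, 0 ≤ f x) :
    Continuous fun x => suppOn (f x • K x) := by
  have : (fun x => suppOn (f x • K x)) = fun x => f x • suppOn (K x) :=
    funext fun x => suppOn_smul (h0 x) _
  rw [this]
  exact hf.smul (continuous_suppOn.comp hK)

variable {E : Type*} [NormedAddCommGroup E] [InnerProductSpace ℝ E] [FiniteDimensional ℝ E]
  [MeasurableSpace E] [BorelSpace E]

theorem IsVal.integral_capDiff {μ : ConvexBody V → ℝ} (h : IsVal 2 μ) {p : V} (hp : ‖p‖ = 1)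
    (ι : E →ₗᵢ[ℝ] V) (hι : ∀ x, inner ℝ p x = 0 ↔ ∃ m, ι m = x) (t : ℝ≥0) (u : E) :
    ∫ ω, |inner ℝ u ω.1| * ‖ω.1‖ * capDiff μ t (ι ω.1 + (ω.2 * ‖ω.1‖) • p) p ∂slab E
      = ∫ ω, capKer t u ω * ‖ω.1‖ * segDiff p μ (symSeg (ι ω.1)) ∂slab E := by
  set T := segDiff p μ
  have hT : IsVal 1 T := h.isVal_segDiff p
  have hTc := hT.cont
  let n : E × ℝ → V := fun ω => ι ω.1 + (ω.2 * ‖ω.1‖) • p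
  have hn : Continuous n := by
    have := ι.continuous
    fun_prop
  have hpι : ∀ m, inner ℝ p (ι m) = 0 := fun m => (hι _).2 ⟨m, rfl⟩
  have hnn : ∀ ω, ‖n ω‖ = Real.sqrt (1 + ω.2 ^ 2) * ‖ω.1‖ := by
    intro ω
    rw [← sq_eq_sq₀ (norm_nonneg _) (by positivity), norm_add_sq_real, inner_smul_right,
      real_inner_comm, hpι, norm_smul, hp, ι.norm_map, mul_pow, mul_pow,
      Real.sq_sqrt (by positivity), Real.norm_eq_abs, sq_abs]
    ring
  have hni : ∀ ω m, inner ℝ (n ω) (ι m) = inner ℝ m ω.1 := by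
    intro ω m
    simp only [n]
    rw [inner_add_left, inner_smul_left, hpι, ι.inner_map_map, mul_zero, add_zero, real_inner_comm]
  have hw0 : ∀ ω : E × ℝ, 0 ≤ |inner ℝ u ω.1| * ‖ω.1‖ := fun ω => by positivity
  have hwc : Continuous fun ω : E × ℝ => |inner ℝ u ω.1| * ‖ω.1‖ := by fun_prop
  have hk0 : ∀ ω : E × ℝ, 0 ≤ capKer t u ω * ‖ω.1‖ := fun ω =>
    mul_nonneg (capKer_nonneg _ _ _) (norm_nonneg _)
  have hkc : Continuous fun ω : E × ℝ => capKer t u ω * ‖ω.1‖ := by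
    have := continuous_capKer (t : ℝ) u
    fun_prop
  have hcapc : ∀ t, Continuous fun ω => cap t (n ω) := fun t => (continuous_cap t).comp hn
  have hsegc : Continuous fun ω : E × ℝ => symSeg (ι ω.1) :=
    continuous_symSeg.comp (ι.continuous.comp continuous_fst)
  have hcs := isBodyCone_symm (V := V)
  have hlin := hT.isLinOn_symm
  have hsymm : ∀ (t : ℝ≥0) ω, cap t (n ω) ∈ {K : ConvexBody V | ∀ x, K.supp (-x) = K.supp x} :=
    fun t ω x => supp_cap_neg _ _ _
  have hsegs : ∀ ω : E × ℝ, symSeg (ι ω.1) ∈ {K : ConvexBody V | ∀ x, K.supp (-x) = K.supp x} :=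
    fun ω x => by rw [supp_symSeg, supp_symSeg, inner_neg_right, abs_neg]
  have hcapint : ∀ t : ℝ≥0, ∃ L ∈ {K : ConvexBody V | ∀ x, K.supp (-x) = K.supp x},
      (∀ x, L.supp x = ∫ ω, |inner ℝ u ω.1| * ‖ω.1‖ * (cap t (n ω)).supp x ∂slab E) ∧
      T L = ∫ ω, |inner ℝ u ω.1| * ‖ω.1‖ * T (cap t (n ω)) ∂slab E := by
    intro t
    have h1 : ∀ ω, T ((|inner ℝ u ω.1| * ‖ω.1‖) • cap t (n ω))
        = |inner ℝ u ω.1| * ‖ω.1‖ * T (cap t (n ω)) := fun ω => hlin.smul (hw0 ω) (hsymm t ω)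
    obtain ⟨L, hL, h2, h3⟩ := hcs.exists_integral hlin
      (K := fun ω => (|inner ℝ u ω.1| * ‖ω.1‖) • cap t (n ω))
      (fun ω => hcs.smul_mem (hw0 ω) (hsymm t ω))
      (integrable_slab (continuous_smul_of_bodies hwc (hcapc t) hw0)) (by
        simp only [h1]
        exact integrable_slab (hwc.mul (hTc.comp (hcapc t))))
    simp only [h1] at h3
    refine ⟨L, hL, fun x => ?_, h3⟩
    rw [h2]
    congr 1; ext ω
    rw [supp_smul_body, supp_smul _ (hw0 ω)]
  obtain ⟨K₁, hK₁, hs₁, hT₁⟩ := hcapint t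
  obtain ⟨K₀, hK₀, hs₀, hT₀⟩ := hcapint 0
  have h1 : ∀ ω, T ((capKer t u ω * ‖ω.1‖) • symSeg (ι ω.1))
      = capKer t u ω * ‖ω.1‖ * T (symSeg (ι ω.1)) := fun ω => hlin.smul (hk0 ω) (hsegs ω)
  obtain ⟨K₂, hK₂, hs₂, hT₂⟩ := hcs.exists_integral hlin
    (K := fun ω : E × ℝ => (capKer t u ω * ‖ω.1‖) • symSeg (ι ω.1))
    (fun ω => hcs.smul_mem (hk0 ω) (hsegs ω))
    (integrable_slab (continuous_smul_of_bodies hkc hsegc hk0)) (by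
      simp only [h1]
      exact integrable_slab (hkc.mul (hTc.comp hsegc)))
  simp only [h1] at hT₂
  have hdec : ∫ ω, |inner ℝ u ω.1| * ‖ω.1‖ * capDiff μ t (n ω) p ∂slab E = T K₁ - T K₀ := by
    have hi : ∀ t, Integrable (fun ω => |inner ℝ u ω.1| * ‖ω.1‖ * T (cap t (n ω))) (slab E) :=
      fun t => integrable_slab (hwc.mul (hTc.comp (hcapc t)))
    rw [hT₁, hT₀, ← integral_sub (hi t) (hi 0)]
    congr 1; ext ω
    rw [← mul_sub]; rfl
  rw [hdec, ← hT₂, sub_eq_iff_eq_add', ← hT.add_of_symm _ hK₂]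
  refine h.segDiff_eq_of_supp p hK₁ (hcs.add_mem hK₀ hK₂) fun x hx => ?_
  obtain ⟨v, rfl⟩ := (hι x).1 hx
  have hi₂ : ∀ ω : E × ℝ, ((capKer t u ω * ‖ω.1‖) • symSeg (ι ω.1)).supp (ι v)
      = capKer t u ω * ‖ω.1‖ * |inner ℝ v ω.1| := by
    intro ω
    rw [supp_smul_body, supp_smul _ (hk0 ω), supp_symSeg, ι.inner_map_map, real_inner_comm]
  have hsc : ∀ t, Continuous fun ω => (cap t (n ω)).supp (ι v) := by
    intro t
    simp only [supp_cap, hni]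
    fun_prop
  have hi : ∀ t, Integrable (fun ω => |inner ℝ u ω.1| * ‖ω.1‖ * (cap t (n ω)).supp (ι v))
      (slab E) := fun t => integrable_slab (hwc.mul (hsc t))
  rw [supp_add_body, hs₁, hs₀, hs₂, ← sub_eq_iff_eq_add', ← integral_sub (hi t) (hi 0)]
  simp only [hi₂]
  rw [← integral_capKer_comm]
  congr 1; ext ω
  rw [← mul_sub, supp_cap, supp_cap_zero, hni, hnn, ι.norm_map, capKer, ← max_sub_sub_right,
    sub_self, mul_right_comm _ ‖v‖]

theorem quadratic_of_capDiff {μ : ConvexBody V → ℝ} (h : IsVal 2 μ) {p : V} (hp : ‖p‖ = 1)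
    (ι : E →ₗᵢ[ℝ] V) (hι : ∀ x, inner ℝ p x = 0 ↔ ∃ m, ι m = x)
    {e e' u : E} {a b : ℝ} (he : ‖e‖ = 1) (he' : ‖e'‖ = 1)
    (hee : inner ℝ e e' = 0) (hab : a ^ 2 + b ^ 2 = 1) (hu : u = a • e + b • e')
    (hg : ∀ t : ℝ≥0, 1 < t → t < 2 → ∃ β γ : ℝ, ∀ m : E,
      ‖m‖ * ∫ s in Icc (-2 : ℝ) 2, capDiff μ t (ι m + (s * ‖m‖) • p) p
        = β * ‖m‖ ^ 2 + γ * inner ℝ e m ^ 2) :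
    segDiff p μ (symSeg (ι u))
      = a ^ 2 * segDiff p μ (symSeg (ι e)) + b ^ 2 * segDiff p μ (symSeg (ι e')) := by
  have hT := h.isVal_segDiff p
  have hTc := hT.cont
  set κ : E → ℝ := fun m => segDiff p μ (symSeg (ι m)) with hκ
  have hκc : Continuous κ := hTc.comp (continuous_symSeg.comp ι.continuous)
  have hκn : ∀ m, κ (-m) = κ m := by
    intro m
    simp only [hκ, map_neg, symSeg, neg_neg]
    rw [add_comm]
  have hκs : ∀ (r : ℝ) m, 0 ≤ r → κ (r • m) = r * κ m := by
    intro r m hr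
    simp only [hκ]
    rw [← hT.isLinOn_symm.smul hr fun x => by
      rw [supp_symSeg, supp_symSeg, inner_neg_right, abs_neg]]
    congr 1
    refine ext_supp fun x => ?_
    rw [supp_smul_body, supp_symSeg, supp_symSeg, _root_.map_smul, inner_smul_left,
      inner_smul_right, conj_trivial]
  have hu1 : ‖u‖ = 1 := by
    rw [← sq_eq_sq₀ (norm_nonneg _) zero_le_one, hu, norm_add_sq_real, norm_smul,
      norm_smul, inner_smul_left, inner_smul_right, hee, he, he', mul_pow, mul_pow]
    simpa using hab
  have hI : ∀ t : ℝ≥0, 1 < t → t < 2 → ∫ ω, capKer t u ω * ‖ω.1‖ * κ ω.1 ∂slab E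
      = a ^ 2 * (∫ ω, capKer t e ω * ‖ω.1‖ * κ ω.1 ∂slab E)
        + b ^ 2 * ∫ ω, capKer t e' ω * ‖ω.1‖ * κ ω.1 ∂slab E := by
    intro t h1 h2
    obtain ⟨β, γ, hg⟩ := hg t h1 h2
    have key : ∀ u : E, ∫ ω, capKer t u ω * ‖ω.1‖ * κ ω.1 ∂slab E
        = ∫ m in Metric.closedBall (0 : E) 1,
          |inner ℝ u m| * (β * ‖m‖ ^ 2 + γ * inner ℝ e m ^ 2) := by
      intro u
      rw [← h.integral_capDiff hp ι hι t u, slab, integral_prod]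
      · congr 1; ext m
        rw [← hg m, ← mul_assoc, ← integral_const_mul]
      · refine integrable_slab ?_
        have h3 := (h.isVal_segDiff p).cont
        have h4 := continuous_cap (V := V) t
        have h5 := continuous_cap (V := V) 0
        have h6 := ι.continuous
        unfold capDiff
        fun_prop
    rw [key, key, key, integral_quadratic he he' hee hab hu]
  have hN : ∀ (t : ℝ≥0) (w : E), ‖w‖ = 1 → ∫ ω, capKer t w ω * ‖ω.1‖ * ‖ω.1‖ ∂slab E
      = ∫ ω, capKer t u ω * ‖ω.1‖ * ‖ω.1‖ ∂slab E := by
    intro t w hw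
    obtain ⟨R, h1, h2⟩ := exists_isometry_swap (hu1.trans hw.symm)
    rw [← integral_slab_comp R]
    congr 1; ext ω
    have e1 := capKer_isometry t R u ω.1 ω.2
    rw [h1] at e1
    rw [e1, R.norm_map]
  have hlim : ∀ ε > 0, ∀ w : E, ‖w‖ = 1 → ∃ δ > 0, ∀ t : ℝ≥0, 1 < t → (t : ℝ) < 1 + δ →
      |∫ ω, capKer t w ω * ‖ω.1‖ * κ ω.1 ∂slab E
          - κ w * ∫ ω, capKer t u ω * ‖ω.1‖ * ‖ω.1‖ ∂slab E|
        ≤ ε * ∫ ω, capKer t u ω * ‖ω.1‖ * ‖ω.1‖ ∂slab E := by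
    intro ε hε w hw
    obtain ⟨η, hη, hκη⟩ := Metric.continuousAt_iff.1 (hκc.continuousAt (x := w)) ε hε
    refine ⟨η ^ 2 / 2, by positivity, fun t ht1 ht => ?_⟩
    have hkc := continuous_capKer (t : ℝ) w
    rw [← hN t w hw, ← integral_const_mul, ← integral_const_mul, ← integral_sub
      (integrable_slab (by fun_prop)) (integrable_slab (by fun_prop))]
    refine abs_integral_le_integral_abs.trans (integral_mono (integrable_slab (by fun_prop))
      (integrable_slab (by fun_prop)) fun ω => ?_)
    have hk0 := capKer_nonneg t w ω
    rcases hk0.eq_or_lt with h0 | h0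
    · simp [← h0]
    obtain ⟨m, s⟩ := ω
    have ht1' : (1 : ℝ) < t := by exact_mod_cast ht1
    have hm : ‖m‖ < t * |inner ℝ w m| := by
      rw [capKer, lt_max_iff] at h0
      replace h0 := h0.resolve_left (lt_irrefl _)
      have : ‖m‖ ≤ Real.sqrt (1 + s ^ 2) * ‖w‖ * ‖m‖ := by
        rw [hw, mul_one]
        exact le_mul_of_one_le_left (norm_nonneg _)
          (Real.one_le_sqrt.2 (by linarith [sq_nonneg s]))
      simp only at h0
      linarith
    have hm0 : 0 < ‖m‖ := by
      rw [norm_pos_iff]; rintro rfl; simp at hm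
    have hest : |κ m - κ w * ‖m‖| ≤ ε * ‖m‖ := by
      have main : ∀ m : E, 0 < ‖m‖ → ‖m‖ < t * inner ℝ w m → |κ m - κ w * ‖m‖| ≤ ε * ‖m‖ := by
        intro m hm0 hm
        have e1 : κ m = ‖m‖ * κ (‖m‖⁻¹ • m) := by
          rw [hκs _ _ (by positivity)]; field_simp
        have e2 : dist (‖m‖⁻¹ • m) w < η := by
          rw [dist_eq_norm, ← sq_lt_sq₀ (norm_nonneg _) hη.le, norm_sub_sq_real, norm_smul,
            norm_inv, norm_norm, inv_mul_cancel₀ hm0.ne', hw, inner_smul_left, conj_trivial,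
            real_inner_comm]
          have e3 : 1 < t * (‖m‖⁻¹ * inner ℝ w m) := by
            rw [← mul_assoc, mul_comm (t : ℝ), mul_assoc, ← div_eq_inv_mul, one_lt_div hm0]
            exact hm
          have e4 : ‖m‖⁻¹ * inner ℝ w m ≤ 1 := by
            rw [← div_eq_inv_mul, div_le_one hm0]
            simpa [hw] using real_inner_le_norm w m
          nlinarith
        have e5 := hκη e2
        rw [Real.dist_eq] at e5
        rw [e1, mul_comm (κ w), ← mul_sub, abs_mul, abs_norm, mul_comm]
        gcongr
      rcases abs_choice (inner ℝ w m) with h | h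
      · exact main m hm0 (h ▸ hm)
      · have := main (-m) (by rwa [norm_neg]) (by rwa [norm_neg, inner_neg_right, ← h])
        rwa [norm_neg, hκn] at this
    calc |capKer t w (m, s) * ‖m‖ * κ m - κ w * (capKer t w (m, s) * ‖m‖ * ‖m‖)|
        = capKer t w (m, s) * ‖m‖ * |κ m - κ w * ‖m‖| := by
          rw [← abs_of_nonneg (mul_nonneg hk0 hm0.le), ← abs_mul,
            abs_of_nonneg (mul_nonneg hk0 hm0.le)]
          congr 1; ring
      _ ≤ capKer t w (m, s) * ‖m‖ * (ε * ‖m‖) := by gcongr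
      _ = _ := by ring
  change κ u = a ^ 2 * κ e + b ^ 2 * κ e'
  rw [← sub_eq_zero]
  by_contra hne
  set d := |κ u - (a ^ 2 * κ e + b ^ 2 * κ e')| with hd
  have hd0 : 0 < d := abs_pos.2 hne
  obtain ⟨δ₁, hδ₁, h₁⟩ := hlim (d / 3) (by positivity) u hu1
  obtain ⟨δ₂, hδ₂, h₂⟩ := hlim (d / 3) (by positivity) e he
  obtain ⟨δ₃, hδ₃, h₃⟩ := hlim (d / 3) (by positivity) e' he'
  obtain ⟨δ, hδ, hδ'⟩ := exists_between (show (0 : ℝ) < min (min δ₁ δ₂) (min δ₃ 1) by positivity)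
  simp only [lt_min_iff] at hδ'
  obtain ⟨t, ht⟩ : ∃ t : ℝ≥0, (t : ℝ) = 1 + δ := ⟨⟨1 + δ, by positivity⟩, rfl⟩
  have ht1 : 1 < t := by rw [← NNReal.coe_lt_coe, ht]; simpa using hδ
  have ht2 : t < 2 := by rw [← NNReal.coe_lt_coe, ht]; norm_num; linarith
  have hNp := integral_capKer_pos (t := t) (by exact_mod_cast ht1) hu1
  replace h₁ := abs_le.1 (h₁ t ht1 (by linarith))
  replace h₂ := abs_le.1 (h₂ t ht1 (by linarith))
  replace h₃ := abs_le.1 (h₃ t ht1 (by linarith))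
  have hIt := hI t ht1 ht2
  set N := ∫ ω, capKer t u ω * ‖ω.1‖ * ‖ω.1‖ ∂slab E
  have hb : b ^ 2 = 1 - a ^ 2 := by linarith
  have ha0 := sq_nonneg a
  have hb0 := sq_nonneg b
  have hfin : |(κ u - (a ^ 2 * κ e + b ^ 2 * κ e')) * N| ≤ 2 * (d / 3) * N := by
    rw [abs_le]
    constructor <;>
    nlinarith [mul_le_mul_of_nonneg_left h₂.1 ha0, mul_le_mul_of_nonneg_left h₂.2 ha0,
      mul_le_mul_of_nonneg_left h₃.1 hb0, mul_le_mul_of_nonneg_left h₃.2 hb0]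
  rw [abs_mul, abs_of_pos hNp, ← hd] at hfin
  nlinarith [mul_pos hd0 hNp]

end KernelIdentity

section CapIntegral
open ConvexBody Set

variable {V : Type*} [NormedAddCommGroup V] [InnerProductSpace ℝ V] [FiniteDimensional ℝ V]

theorem integral_abs_affine {α β : ℝ} (hβ : 0 < |β|) (h : |α| ≤ 2 * |β|) :
    ∫ s in Icc (-2 : ℝ) 2, |α + s * β| = α ^ 2 / |β| + 4 * |β| := by
  have main : ∀ {α β : ℝ}, 0 < β → |α| ≤ 2 * β →
      ∫ s in Icc (-2 : ℝ) 2, |α + s * β| = α ^ 2 / β + 4 * β := by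
    intro α β hβ h
    rw [abs_le] at h
    have e0 : -α / β * β = -α := by field_simp
    have h1 : -2 ≤ -α / β := by rw [le_div_iff₀ hβ]; linarith
    have h2 : -α / β ≤ 2 := by rw [div_le_iff₀ hβ]; linarith
    have hc : Continuous fun s : ℝ => |α + s * β| := by fun_prop
    rw [integral_Icc_eq_integral_Ioc, ← intervalIntegral.integral_of_le (by norm_num),
      ← intervalIntegral.integral_add_adjacent_intervals (hc.intervalIntegrable _ (-α / β))
        (hc.intervalIntegrable _ _)]
    have i1 : ∫ s in (-2 : ℝ)..(-α / β), |α + s * β| = ∫ s in (-2 : ℝ)..(-α / β), (-α - s * β) := by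
      refine intervalIntegral.integral_congr fun s hs => ?_
      rw [uIcc_of_le h1] at hs
      have := mul_le_mul_of_nonneg_right hs.2 hβ.le
      rw [abs_of_nonpos (by linarith)]
      ring
    have i2 : ∫ s in (-α / β)..2, |α + s * β| = ∫ s in (-α / β)..2, (α + s * β) := by
      refine intervalIntegral.integral_congr fun s hs => ?_
      rw [uIcc_of_le h2] at hs
      have := mul_le_mul_of_nonneg_right hs.1 hβ.le
      rw [abs_of_nonneg (by linarith)]
    rw [i1, i2, intervalIntegral.integral_sub (by simp)
        (Continuous.intervalIntegrable (by fun_prop) _ _),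
      intervalIntegral.integral_add (by simp)
        (Continuous.intervalIntegrable (by fun_prop) _ _)]
    simp only [intervalIntegral.integral_const, intervalIntegral.integral_mul_const, integral_id,
      smul_eq_mul]
    field_simp
    ring
  rcases lt_or_ge 0 β with hb | hb
  · rw [abs_of_pos hb] at h ⊢
    exact main hb h
  · have hb' : 0 < -β := by rwa [abs_of_nonpos hb] at hβ
    rw [abs_of_nonpos hb] at h ⊢
    rw [← abs_neg α] at h
    have := main hb' h
    rw [neg_sq] at this
    rw [← this]
    congr 1; ext s
    rw [← abs_neg]
    congr 1; ring

/-- The integral of `capDiff μ t p` over a segment of directions parallel to `p`. -/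
def capInt (μ : ConvexBody V → ℝ) (t : ℝ≥0) (p c : V) : ℝ :=
  ∫ s in Icc (-2 : ℝ) 2, capDiff μ t p (c + s • p)

theorem IsVal.exists_capInt {μ : ConvexBody V → ℝ} (h : IsVal 2 μ) (t : ℝ≥0) (p c : V) :
    ∃ Z ∈ zonoids V, (∀ x, Z.supp x = ∫ s in Icc (-2 : ℝ) 2, |inner ℝ c x + s * inner ℝ p x|) ∧
      mixDiff μ (cap t p) (cap 0 p) Z = 2 * capInt μ t p c := by
  have hlin := h.isLinOn_mixDiff (cap t p) (cap 0 p)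
  have hsym : ∀ w : V, mixDiff μ (cap t p) (cap 0 p) (symSeg w) = 2 * capDiff μ t p w := by
    intro w
    rw [symSeg, hlin.add (seg_mem_zonoids _) (seg_mem_zonoids _), mixDiff_seg, mixDiff_seg,
      segDiff_neg h.ti, segDiff_neg h.ti, capDiff]
    ring
  have hc : Continuous fun s : ℝ => symSeg (c + s • p) :=
    continuous_symSeg.comp (by fun_prop)
  obtain ⟨Z, hZ, h1, h2⟩ := isBodyCone_zonoids.exists_integral hlin
    (K := fun s : ℝ => symSeg (c + s • p)) (P := volume.restrict (Icc (-2 : ℝ) 2))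
    (fun s => symSeg_mem_zonoids _)
    ((continuous_suppOn.comp hc).continuousOn.integrableOn_compact isCompact_Icc)
    ((hlin.cont.comp hc).continuousOn.integrableOn_compact isCompact_Icc)
  refine ⟨Z, hZ, fun x => ?_, ?_⟩
  · rw [h1]
    congr 1; ext s
    rw [supp_symSeg, inner_add_left, inner_smul_left, conj_trivial]
  · rw [h2, capInt, ← integral_const_mul]
    simp only [hsym]

theorem IsVal.capInt_add_capInt {μ : ConvexBody V → ℝ} (h : IsVal 2 μ) {t : ℝ≥0} (ht : t ≤ 2)
    {p q w : V} {a b : ℝ} (hab : a ^ 2 + b ^ 2 = 1) (hq : ‖q‖ ≤ 1) (hw : ‖w‖ ≤ 1)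
    (hc : ‖a • q + b • w‖ ≤ 1)
    (hc' : ‖a • q - b • w‖ ≤ 1) (hp : ‖p‖ = 1) :
    capInt μ t p (a • q + b • w) + capInt μ t p (a • q - b • w)
      = 2 * a ^ 2 * capInt μ t p q + 2 * b ^ 2 * capInt μ t p w := by
  have hlin := h.isLinOn_mixDiff (cap t p) (cap 0 p)
  have hcone := isBodyCone_zonoids (V := V)
  obtain ⟨Z₁, hZ₁, s₁, m₁⟩ := h.exists_capInt t p (a • q + b • w)
  obtain ⟨Z₂, hZ₂, s₂, m₂⟩ := h.exists_capInt t p (a • q - b • w)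
  obtain ⟨Z₃, hZ₃, s₃, m₃⟩ := h.exists_capInt t p q
  obtain ⟨Z₄, hZ₄, s₄, m₄⟩ := h.exists_capInt t p w
  have ha : 0 ≤ 2 * a ^ 2 := by positivity
  have hb : 0 ≤ 2 * b ^ 2 := by positivity
  have key : mixDiff μ (cap t p) (cap 0 p) (Z₁ + Z₂)
      = mixDiff μ (cap t p) (cap 0 p) ((2 * a ^ 2) • Z₃ + (2 * b ^ 2) • Z₄) := by
    unfold mixDiff
    rw [h.val.sub_eq_sub_of_supp (Q := cap t p) (D := cap 0 p)
      (Y := (2 * a ^ 2) • Z₃ + (2 * b ^ 2) • Z₄) (fun x => ?_) fun x => ?_]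
    · rw [supp_cap_zero, supp_cap]; exact le_max_left _ _
    rw [supp_cap_zero, supp_cap, hp, one_mul, max_eq_left_iff, or_iff_not_imp_left, not_le]
    intro hx
    have hx2 : ‖x‖ < 2 * |inner ℝ p x| := hx.trans_le (by
      have : (t : ℝ) ≤ 2 := by exact_mod_cast ht
      gcongr)
    have hβ : 0 < |inner ℝ p x| := by linarith [norm_nonneg x]
    have hin : ∀ {c : V}, ‖c‖ ≤ 1 → |inner ℝ c x| ≤ 2 * |inner ℝ p x| := fun {c} hc =>
      ((abs_real_inner_le_norm c x).trans (mul_le_of_le_one_left (norm_nonneg _) hc)).trans hx2.le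
    rw [supp_add_body, supp_add_body, supp_smul_body, supp_smul_body, supp_smul _ ha,
      supp_smul _ hb, s₁, s₂, s₃, s₄, integral_abs_affine hβ (hin hc),
      integral_abs_affine hβ (hin hc'), integral_abs_affine hβ (hin hq),
      integral_abs_affine hβ (hin hw)]
    rw [inner_add_left, inner_sub_left, inner_smul_left, inner_smul_left]
    simp only [conj_trivial]
    field_simp
    linear_combination (-8 * |inner ℝ p x| ^ 2) * hab
  rw [hlin.add hZ₁ hZ₂, hlin.add (hcone.smul_mem ha hZ₃) (hcone.smul_mem hb hZ₄),
    hlin.smul ha hZ₃, hlin.smul hb hZ₄, m₁, m₂, m₃, m₄] at key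
  linarith

end CapIntegral

section Hermitian
open ConvexBody Set

variable {n m : ℕ}

theorem Ecl.inner_eq_re (x y : Ecl n) : inner ℝ x y = (inner ℂ x y).re := by
  simp [PiLp.inner_apply, Complex.inner]

theorem Ecl.inner_I_smul (x y : Ecl n) : inner ℝ (Complex.I • x) y = (inner ℂ x y).im := by
  rw [Ecl.inner_eq_re, inner_smul_left]
  simp

/-- A unitary map as a real linear isometry. -/
def realIso (U : Ecl n ≃ₗᵢ[ℂ] Ecl n) : Ecl n ≃ₗᵢ[ℝ] Ecl n :=
  ⟨U.toLinearEquiv.restrictScalars ℝ, U.norm_map⟩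

/-- The image of a convex body under a unitary map. -/
def unitaryBody (U : Ecl n ≃ₗᵢ[ℂ] Ecl n) (K : ConvexBody (Ecl n)) : ConvexBody (Ecl n) :=
  K.map (realIso U).toContinuousLinearEquiv.toContinuousLinearMap

theorem coe_unitaryBody (U : Ecl n ≃ₗᵢ[ℂ] Ecl n) (K : ConvexBody (Ecl n)) :
    (unitaryBody U K : Set (Ecl n)) = U '' K := rfl

theorem unitaryBody_add (U : Ecl n ≃ₗᵢ[ℂ] Ecl n) (K L : ConvexBody (Ecl n)) :
    unitaryBody U (K + L) = unitaryBody U K + unitaryBody U L := ConvexBody.map_add _ _ _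

theorem unitaryBody_seg (U : Ecl n ≃ₗᵢ[ℂ] Ecl n) (v : Ecl n) :
    unitaryBody U (seg v) = seg (U v) := map_seg _ _

theorem unitaryBody_cap (U : Ecl n ≃ₗᵢ[ℂ] Ecl n) (t : ℝ≥0) (v : Ecl n) :
    unitaryBody U (cap t v) = cap t (U v) := map_cap (realIso U) t v

/-- Invariance under all unitary maps. -/
def UnitInv (μ : ConvexBody (Ecl n) → ℝ) : Prop :=
  ∀ (U : Ecl n ≃ₗᵢ[ℂ] Ecl n) (K : ConvexBody (Ecl n)), μ (unitaryBody U K) = μ K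

theorem UInv.unitInv {μ : ConvexBody (Ecl n) → ℝ} (h : UInv μ) : UnitInv μ := by
  intro U K
  have hA : Matrix.toEuclideanLin.symm U.toLinearMap ∈ Matrix.unitaryGroup (Fin n) ℂ := by
    rw [Matrix.mem_unitaryGroup_iff']
    refine Matrix.toEuclideanLin.injective (LinearMap.ext fun x => ext_inner_left ℂ fun y => ?_)
    have h1 : ∀ A B : Matrix (Fin n) (Fin n) ℂ, Matrix.toEuclideanLin (A * B) x
        = Matrix.toEuclideanLin A (Matrix.toEuclideanLin B x) := fun A B => by simp
    have h2 : Matrix.toEuclideanLin (1 : Matrix (Fin n) (Fin n) ℂ) x = x := by simp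
    rw [h1, h2, Matrix.star_eq_conjTranspose, Matrix.toEuclideanLin_conjTranspose_eq_adjoint,
      LinearMap.adjoint_inner_right, LinearEquiv.apply_symm_apply]
    exact U.inner_map_map y x
  rw [← h _ hA K]
  congr 1
  ext1
  simp [coe_unitaryBody, matBodyC]

theorem UnitInv.segDiff {μ : ConvexBody (Ecl n) → ℝ} (h : UnitInv μ) (U : Ecl n ≃ₗᵢ[ℂ] Ecl n)
    (v : Ecl n) (K : ConvexBody (Ecl n)) :
    segDiff (U v) μ (unitaryBody U K) = segDiff v μ K := by
  rw [_root_.segDiff, ← unitaryBody_seg, ← unitaryBody_add, h, h, _root_.segDiff]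

theorem UnitInv.capDiff {μ : ConvexBody (Ecl n) → ℝ} (h : UnitInv μ) (U : Ecl n ≃ₗᵢ[ℂ] Ecl n)
    (t : ℝ≥0) (w v : Ecl n) : capDiff μ t (U w) (U v) = capDiff μ t w v := by
  rw [_root_.capDiff, ← unitaryBody_cap, ← unitaryBody_cap, h.segDiff, h.segDiff, _root_.capDiff]

theorem IsVal.capDiff_smul_left {μ : ConvexBody (Ecl n) → ℝ} (h : IsVal 2 μ) (t : ℝ≥0) {a : ℝ}
    (ha : 0 ≤ a) (w v : Ecl n) : capDiff μ t (a • w) v = a * capDiff μ t w v := by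
  have hl := (h.isVal_segDiff v).isLinOn_symm
  rw [capDiff, cap_smul ha, cap_smul ha, hl.smul ha (supp_cap_neg _ _),
    hl.smul ha (supp_cap_neg _ _), capDiff, mul_sub]

theorem IsVal.capDiff_smul_right {μ : ConvexBody (Ecl n) → ℝ} (h : IsVal 2 μ) (t : ℝ≥0) {a : ℝ}
    (ha : 0 ≤ a) (w v : Ecl n) : capDiff μ t w (a • v) = a * capDiff μ t w v := by
  rw [capDiff, segDiff_smul_abs h.val h.cont h.ti, segDiff_smul_abs h.val h.cont h.ti,
    abs_of_nonneg ha, capDiff, mul_sub]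

/-- An isometry extending a given assignment on an orthonormal family. -/
theorem exists_unitary {ι : Type*} [Fintype ι] {u v : ι → Ecl n} (hu : Orthonormal ℂ u)
    (hv : Orthonormal ℂ v) : ∃ U : Ecl n ≃ₗᵢ[ℂ] Ecl n, ∀ i, U (u i) = v i := by
  let b := Module.Basis.span hu.linearIndependent
  have hb : ∀ i, (b i : Ecl n) = u i := fun i => by simp [b, Module.Basis.span_apply]
  have hb' : Orthonormal ℂ b := by
    classical
    rw [orthonormal_iff_ite] at hu ⊢
    intro i j
    rw [← hu i j, Submodule.coe_inner, hb, hb]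
  let f := (b.constr ℂ v)
  have hf : ∀ i, f (b i) = v i := fun i => b.constr_basis ℂ v i
  let L := f.isometryOfOrthonormal hb' (by
    have : f ∘ b = v := funext hf
    rwa [this])
  refine ⟨L.extend.toLinearIsometryEquiv rfl, fun i => ?_⟩
  have := L.extend_apply (b i)
  rw [hb] at this
  rw [LinearIsometry.toLinearIsometryEquiv_apply, this]
  exact hf i

theorem exists_unitary_extend (j : Ecl m →ₗᵢ[ℂ] Ecl n) (U : Ecl m ≃ₗᵢ[ℂ] Ecl m) :
    ∃ U' : Ecl n ≃ₗᵢ[ℂ] Ecl n, (∀ x, U' (j x) = j (U x)) ∧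
      ∀ y, (∀ x, inner ℂ (j x) y = 0) → U' y = y := by
  let J := LinearMap.adjoint j.toLinearMap
  have hJ : ∀ x y, inner ℂ x (J y) = inner ℂ (j x) y := fun x y =>
    LinearMap.adjoint_inner_right j.toLinearMap x y
  have hJj : ∀ x, J (j x) = x := fun x => ext_inner_left ℂ fun y => by
    rw [hJ, j.inner_map_map]
  have ho : ∀ x y, inner ℂ (j x) (y - j (J y)) = 0 := fun x y => by
    rw [inner_sub_right, j.inner_map_map, hJ, sub_self]
  let T : Ecl n →ₗ[ℂ] Ecl n :=
    j.toLinearMap ∘ₗ U.toLinearMap ∘ₗ J + (LinearMap.id - j.toLinearMap ∘ₗ J)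
  have hT : ∀ y, T y = j (U (J y)) + (y - j (J y)) := fun y => rfl
  have hnorm : ∀ y, ‖T y‖ = ‖y‖ := fun y => by
    have e1 := norm_add_sq_eq_norm_sq_add_norm_sq_of_inner_eq_zero _ _ (ho (U (J y)) y)
    have e2 := norm_add_sq_eq_norm_sq_add_norm_sq_of_inner_eq_zero _ _ (ho (J y) y)
    rw [j.norm_map, U.norm_map] at e1
    rw [j.norm_map, add_sub_cancel] at e2
    rw [← mul_self_inj (norm_nonneg _) (norm_nonneg _), hT, e1, e2]
  refine ⟨LinearIsometry.toLinearIsometryEquiv ⟨T, hnorm⟩ rfl, fun x => ?_, fun y hy => ?_⟩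
  · rw [LinearIsometry.toLinearIsometryEquiv_apply]
    change T _ = _
    rw [hT, hJj, sub_self, add_zero]
  · have : J y = 0 := ext_inner_left ℂ fun x => by rw [hJ, hy, inner_zero_right]
    rw [LinearIsometry.toLinearIsometryEquiv_apply]
    change T _ = _
    rw [hT, this]
    simp

end Hermitian

section Plane
open ConvexBody Set Complex

theorem orthonormal_pair {W : Type*} [NormedAddCommGroup W] [InnerProductSpace ℂ W] {x y : W}
    (hx : ‖x‖ = 1) (hy : ‖y‖ = 1) (h : inner ℂ x y = 0) : Orthonormal ℂ ![x, y] := by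
  refine ⟨fun i => ?_, fun i j hij => ?_⟩
  · fin_cases i <;> simpa
  · have h' := inner_eq_zero_symm.1 h
    fin_cases i <;> fin_cases j <;> first | exact absurd rfl hij | simpa

theorem Ecl.norm_pair_sq (z w : ℂ) : ‖(!₂[z, w] : Ecl 2)‖ ^ 2 = ‖z‖ ^ 2 + ‖w‖ ^ 2 := by
  rw [EuclideanSpace.norm_sq_eq]; simp [Fin.sum_univ_two]

theorem Ecl.norm_pair {z w : ℂ} (h : ‖z‖ ^ 2 + ‖w‖ ^ 2 = 1) : ‖(!₂[z, w] : Ecl 2)‖ = 1 := by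
  rw [← sq_eq_sq₀ (norm_nonneg _) zero_le_one, Ecl.norm_pair_sq, h, one_pow]

theorem Ecl.pair_eq (z w : ℂ) :
    (!₂[z, w] : Ecl 2) = z • (!₂[1, 0] : Ecl 2) + w • (!₂[0, 1] : Ecl 2) := by
  ext i; fin_cases i <;> simp

theorem Ecl.exists_unitary_pair {x y : Ecl 2} (hx : ‖x‖ = 1) (hy : ‖y‖ = 1)
    (h : inner ℂ x y = 0) :
    ∃ U : Ecl 2 ≃ₗᵢ[ℂ] Ecl 2, ∀ z w : ℂ, U !₂[z, w] = z • x + w • y := by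
  obtain ⟨U, hU⟩ := exists_unitary (u := ![(!₂[1, 0] : Ecl 2), !₂[0, 1]])
    (orthonormal_pair (Ecl.norm_pair (by simp)) (Ecl.norm_pair (by simp))
      (by simp [PiLp.inner_apply])) (orthonormal_pair hx hy h)
  refine ⟨U, fun z w => ?_⟩
  have h0 := hU 0
  have h1 := hU 1
  simp only [Matrix.cons_val_zero, Matrix.cons_val_one] at h0 h1
  rw [Ecl.pair_eq, _root_.map_add, _root_.map_smul, _root_.map_smul, h0, h1]

theorem Ecl.exists_phase {ω : ℂ} (hω : ‖ω‖ = 1) :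
    ∃ U : Ecl 2 ≃ₗᵢ[ℂ] Ecl 2, ∀ z w : ℂ, U !₂[z, w] = !₂[z, ω * w] := by
  obtain ⟨U, hU⟩ := Ecl.exists_unitary_pair (x := !₂[1, 0]) (y := !₂[0, ω])
    (Ecl.norm_pair (by simp)) (Ecl.norm_pair (by simp [hω])) (by simp [PiLp.inner_apply])
  refine ⟨U, fun z w => ?_⟩
  rw [hU]
  ext i; fin_cases i <;> simp [mul_comm]

variable {ψ : ConvexBody (Ecl 2) → ℝ}

theorem capDiff_pair (hU : UnitInv ψ) (h : IsVal 2 ψ) (t : ℝ≥0) (z w : ℂ) :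
    capDiff ψ t !₂[z, w] !₂[1, 0] = capDiff ψ t !₂[1, 0] !₂[(starRingEnd ℂ) z, w] := by
  set r := ‖(!₂[z, w] : Ecl 2)‖ with hr
  have hr2 : r ^ 2 = ‖z‖ ^ 2 + ‖w‖ ^ 2 := Ecl.norm_pair_sq z w
  rcases (norm_nonneg (!₂[z, w] : Ecl 2)).eq_or_lt with h0 | h0
  · rw [← hr] at h0
    rw [← h0] at hr2
    have hz : z = 0 := by
      have : ‖z‖ = 0 := by nlinarith [norm_nonneg z, norm_nonneg w]
      simpa using this
    have hw : w = 0 := by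
      have : ‖w‖ = 0 := by nlinarith [norm_nonneg z, norm_nonneg w]
      simpa using this
    have e0 : (!₂[0, 0] : Ecl 2) = (0 : ℝ) • !₂[0, 0] := by ext i; fin_cases i <;> simp
    rw [hz, hw, _root_.map_zero, e0, h.capDiff_smul_left t le_rfl, h.capDiff_smul_right t le_rfl,
      zero_mul, zero_mul]
  rw [← hr] at h0
  have hb : ‖((r⁻¹ : ℝ) : ℂ) * z‖ ^ 2 + ‖((r⁻¹ : ℝ) : ℂ) * w‖ ^ 2 = 1 := by
    rw [norm_mul, norm_mul, mul_pow, mul_pow, ← mul_add, ← hr2, Complex.norm_real, norm_inv,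
      Real.norm_of_nonneg h0.le]
    field_simp
  set b₁ := ((r⁻¹ : ℝ) : ℂ) * z
  set b₂ := ((r⁻¹ : ℝ) : ℂ) * w
  have hz : z = r * b₁ := by
    simp only [b₁, ofReal_inv]
    rw [mul_inv_cancel_left₀ (by exact_mod_cast h0.ne')]
  have hw : w = r * b₂ := by
    simp only [b₂, ofReal_inv]
    rw [mul_inv_cancel_left₀ (by exact_mod_cast h0.ne')]
  obtain ⟨U, hU'⟩ := Ecl.exists_unitary_pair (x := !₂[b₁, b₂])
    (y := !₂[(starRingEnd ℂ) b₂, -(starRingEnd ℂ) b₁]) (Ecl.norm_pair hb)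
    (Ecl.norm_pair (by simpa [add_comm] using hb)) (by simp [PiLp.inner_apply]; ring)
  have e1 : (!₂[z, w] : Ecl 2) = r • U !₂[1, 0] := by
    rw [hU']
    ext i; fin_cases i <;> simp [hz, hw]
  have e2 : (!₂[1, 0] : Ecl 2) = U !₂[(starRingEnd ℂ) b₁, b₂] := by
    have hb' : (starRingEnd ℂ) b₁ * b₁ + b₂ * (starRingEnd ℂ) b₂ = 1 := by
      rw [mul_comm, mul_conj, mul_conj, normSq_eq_norm_sq, normSq_eq_norm_sq]
      exact_mod_cast hb
    rw [hU']
    ext i; fin_cases i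
    · simpa using hb'.symm
    · simp; ring
  have e3 : (!₂[(starRingEnd ℂ) z, w] : Ecl 2) = r • !₂[(starRingEnd ℂ) b₁, b₂] := by
    ext i; fin_cases i <;> simp [hz, hw]
  have e4 : capDiff ψ t (U !₂[1, 0]) !₂[1, 0]
      = capDiff ψ t (U !₂[1, 0]) (U !₂[(starRingEnd ℂ) b₁, b₂]) := by rw [← e2]
  rw [e1, h.capDiff_smul_left t h0.le, e3, h.capDiff_smul_right t h0.le, e4, hU.capDiff]

theorem capInt_phase (hU : UnitInv ψ) (t : ℝ≥0) (z w : ℂ) {ω : ℂ} (hω : ‖ω‖ = 1) :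
    capInt ψ t !₂[1, 0] !₂[z, ω * w] = capInt ψ t !₂[1, 0] !₂[z, w] := by
  obtain ⟨U, hU'⟩ := Ecl.exists_phase hω
  unfold capInt
  congr 1; ext s
  have e1 : U !₂[1, 0] = !₂[1, 0] := by rw [hU', mul_zero]
  have e2 : U (!₂[z, w] + s • !₂[1, 0]) = !₂[z, ω * w] + s • !₂[1, 0] := by
    have : (!₂[z, w] + s • !₂[1, 0] : Ecl 2) = !₂[z + s, w] := by
      ext i; fin_cases i <;> simp
    rw [this, hU']
    ext i; fin_cases i <;> simp
  rw [← e2]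
  have := hU.capDiff U t !₂[1, 0] (!₂[z, w] + s • !₂[1, 0])
  rwa [e1] at this

theorem capInt_eq (hU : UnitInv ψ) (h : IsVal 2 ψ) {t : ℝ≥0} (ht : t ≤ 2) {a : ℝ} {z : ℂ}
    (haz : a ^ 2 + ‖z‖ ^ 2 = 1) :
    capInt ψ t !₂[1, 0] !₂[I * a, z] = a ^ 2 * capInt ψ t !₂[1, 0] !₂[I, 0]
      + (1 - a ^ 2) * capInt ψ t !₂[1, 0] !₂[0, 1] := by
  obtain ⟨ω, hω, hz⟩ : ∃ ω : ℂ, ‖ω‖ = 1 ∧ z = ω * (‖z‖ : ℝ) := by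
    rcases eq_or_ne z 0 with rfl | hz
    · exact ⟨1, by simp, by simp⟩
    · have : ‖z‖ ≠ 0 := by simpa
      exact ⟨z / ‖z‖, by simp [this], (div_mul_cancel₀ _ (by exact_mod_cast this)).symm⟩
  set b := ‖z‖
  have e1 : (a • !₂[I, 0] + b • !₂[0, 1] : Ecl 2) = !₂[I * a, b] := by
    ext i; fin_cases i <;> simp [mul_comm]
  have e2 : (a • !₂[I, 0] - b • !₂[0, 1] : Ecl 2) = !₂[I * a, -1 * b] := by
    ext i; fin_cases i <;> simp [mul_comm]
  have hn : ‖(!₂[I * a, (b : ℂ)] : Ecl 2)‖ = 1 := Ecl.norm_pair (by simpa using haz)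
  have hn' : ‖(!₂[I * a, -1 * (b : ℂ)] : Ecl 2)‖ = 1 := Ecl.norm_pair (by simpa using haz)
  have key := h.capInt_add_capInt ht haz (p := !₂[1, 0]) (q := !₂[I, 0]) (w := !₂[0, 1])
    (Ecl.norm_pair (by simp)).le (Ecl.norm_pair (by simp)).le (e1 ▸ hn.le) (e2 ▸ hn'.le)
    (Ecl.norm_pair (by simp))
  rw [e1, e2, capInt_phase hU t _ _ (by simp)] at key
  rw [hz, capInt_phase hU t _ _ hω]
  have : b ^ 2 = 1 - a ^ 2 := by linarith
  rw [this] at key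
  linarith

/-- The isometry of `ℝ³` onto the orthogonal complement of `(1, 0)` in `ℂ²`. -/
def complIso : Eucl 3 →ₗᵢ[ℝ] Ecl 2 where
  toFun m := !₂[I * m 0, m 1 + I * m 2]
  map_add' x y := by ext i; fin_cases i <;> simp <;> ring
  map_smul' r x := by ext i; fin_cases i <;> simp <;> ring
  norm_map' x := by
    rw [← sq_eq_sq₀ (norm_nonneg _) (norm_nonneg _)]
    change ‖(!₂[I * (x 0 : ℂ), (x 1 : ℂ) + I * x 2] : Ecl 2)‖ ^ 2 = _
    rw [Ecl.norm_pair_sq, EuclideanSpace.norm_sq_eq, ← normSq_eq_norm_sq, ← normSq_eq_norm_sq]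
    simp [Fin.sum_univ_three, normSq_apply]
    ring

theorem complIso_apply (m : Eucl 3) : complIso m = !₂[I * m 0, m 1 + I * m 2] := rfl

theorem inner_eq_zero_iff_complIso (x : Ecl 2) :
    inner ℝ (!₂[1, 0] : Ecl 2) x = 0 ↔ ∃ m, complIso m = x := by
  have h : inner ℝ (!₂[1, 0] : Ecl 2) x = (x 0).re := by
    rw [Ecl.inner_eq_re]; simp [PiLp.inner_apply, Fin.sum_univ_two]
  rw [h]
  constructor
  · intro h0
    refine ⟨!₂[(x 0).im, (x 1).re, (x 1).im], ?_⟩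
    rw [complIso_apply]
    ext i; fin_cases i
    · apply Complex.ext <;> simp [h0]
    · apply Complex.ext <;> simp
  · rintro ⟨m, rfl⟩
    simp [complIso_apply]

theorem segDiff_quadratic (hU : UnitInv ψ) (h : IsVal 2 ψ) {a b : ℝ} (hab : a ^ 2 + b ^ 2 = 1) :
    segDiff !₂[1, 0] ψ (symSeg !₂[I * a, (b : ℂ)])
      = a ^ 2 * segDiff !₂[1, 0] ψ (symSeg !₂[I, 0])
        + b ^ 2 * segDiff !₂[1, 0] ψ (symSeg !₂[0, 1]) := by
  have e0 : complIso !₂[1, 0, 0] = !₂[I, 0] := by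
    rw [complIso_apply]; ext i; fin_cases i <;> simp
  have e1 : complIso !₂[0, 1, 0] = !₂[0, 1] := by
    rw [complIso_apply]; ext i; fin_cases i <;> simp
  have e2 : complIso !₂[a, b, 0] = !₂[I * a, (b : ℂ)] := by
    rw [complIso_apply]; ext i; fin_cases i <;> simp
  have hn : ∀ x : Eucl 3, ‖x‖ ^ 2 = x 0 ^ 2 + x 1 ^ 2 + x 2 ^ 2 := fun x => by
    rw [EuclideanSpace.norm_sq_eq]; simp [Fin.sum_univ_three]
  have hn1 : ∀ x : Eucl 3, x 0 ^ 2 + x 1 ^ 2 + x 2 ^ 2 = 1 → ‖x‖ = 1 := fun x hx => by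
    rw [← sq_eq_sq₀ (norm_nonneg _) zero_le_one, hn, hx, one_pow]
  rw [← e0, ← e1, ← e2]
  refine quadratic_of_capDiff h (Ecl.norm_pair (by simp)) complIso inner_eq_zero_iff_complIso
    (hn1 _ (by simp)) (hn1 _ (by simp)) (by simp [PiLp.inner_apply, Fin.sum_univ_three]) hab
    (by ext i; fin_cases i <;> simp) fun t ht1 ht2 => ?_
  refine ⟨capInt ψ t !₂[1, 0] !₂[0, 1],
    capInt ψ t !₂[1, 0] !₂[I, 0] - capInt ψ t !₂[1, 0] !₂[0, 1], fun m => ?_⟩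
  have hi : inner ℝ (!₂[1, 0, 0] : Eucl 3) m = m 0 := by
    simp [PiLp.inner_apply, Fin.sum_univ_three]
  rw [hi]
  have hnm := hn m
  rcases (norm_nonneg m).eq_or_lt with h0 | h0
  · rw [← h0] at hnm ⊢
    have : m 0 = 0 := by nlinarith [sq_nonneg (m 0), sq_nonneg (m 1), sq_nonneg (m 2)]
    rw [this]; ring
  set r := ‖m‖
  have h_int : ∫ s in Icc (-2 : ℝ) 2, capDiff ψ t (complIso m + (s * r) • !₂[1, 0]) !₂[1, 0]
      = r * capInt ψ t !₂[1, 0] !₂[I * ((-(r⁻¹ * m 0) : ℝ) : ℂ),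
        (r⁻¹ : ℝ) * ((m 1 : ℂ) + I * m 2)] := by
    rw [capInt, ← integral_const_mul]
    congr 1; ext s
    have f1 : (complIso m + (s * r) • !₂[1, 0] : Ecl 2)
        = !₂[(s * r : ℝ) + I * m 0, m 1 + I * m 2] := by
      rw [complIso_apply]; ext i; fin_cases i <;> simp [add_comm]
    have hr : (r : ℂ) ≠ 0 := by exact_mod_cast h0.ne'
    have f2 : (!₂[(starRingEnd ℂ) ((s * r : ℝ) + I * m 0), m 1 + I * m 2] : Ecl 2)
        = r • (!₂[I * ((-(r⁻¹ * m 0) : ℝ) : ℂ), (r⁻¹ : ℝ) * ((m 1 : ℂ) + I * m 2)]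
          + s • !₂[1, 0]) := by
      ext i; fin_cases i
      · simp; field_simp; ring
      · simp; field_simp
    rw [f1, capDiff_pair hU h, f2, h.capDiff_smul_right t h0.le]
  rw [h_int, capInt_eq hU h ht2.le]
  · field_simp
    ring
  · rw [norm_mul, mul_pow, ← normSq_eq_norm_sq ((m 1 : ℂ) + _), norm_real, Real.norm_eq_abs,
      sq_abs]
    simp [normSq_apply]
    field_simp
    linarith

end Plane

section Frames
open ConvexBody Set Complex

section Iterated

variable {V : Type*} [NormedAddCommGroup V] [InnerProductSpace ℝ V] [FiniteDimensional ℝ V]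

/-- The iterated difference operator along the vectors of a list. -/
def iterDiff (T : List V) (μ : ConvexBody V → ℝ) : ConvexBody V → ℝ := T.foldr segDiff μ

theorem IsVal.iterDiff {k : ℕ} {μ : ConvexBody V → ℝ} {T : List V} (h : IsVal (k + T.length) μ) :
    IsVal k (iterDiff T μ) := by
  induction T generalizing k with
  | nil => exact h
  | cons v T ih =>
    refine (ih (k := k + 1) ?_).isVal_segDiff v
    rwa [List.length_cons, add_comm T.length, ← add_assoc] at h

theorem IsVal.iterDiff_zon {k : ℕ} {μ : ConvexBody V → ℝ} {T l : List V}
    (h : IsVal (k + T.length) μ) (hl : l.length = k) :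
    _root_.iterDiff T μ (zon l) = μ (zon (l ++ T)) := by
  induction T generalizing k l with
  | nil => rw [List.append_nil]; rfl
  | cons v T ih =>
    rw [List.length_cons, add_comm T.length, ← add_assoc] at h
    change segDiff v (_root_.iterDiff T μ) (zon l) = _
    rw [← h.iterDiff.apply_zon_cons (by omega), ih h (by simpa using hl)]
    exact congrArg μ (zon_perm (by simpa using List.perm_middle.symm))

theorem IsVal.zon_eq_zero_of_span {k : ℕ} {μ : ConvexBody V → ℝ} (h : IsVal k μ) {l l' : List V}
    (hl : l.length = k) (hl' : l'.length = k) (hz : μ (zon l') = 0)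
    (hs : ∀ v ∈ l, v ∈ Submodule.span ℝ {x | x ∈ l'}) : μ (zon l) = 0 := by
  have e : ∀ {l : List V} (hl : l.length = k),
      ∑ i : Fin k, seg (l.get (i.cast hl.symm)) = zon l := by
    intro l hl
    subst hl
    simp [zon, ← List.sum_ofFn, List.ofFn_getElem_eq_map]
  rw [← e hl]
  refine h.sum_seg_eq_zero_of_mem_span (w := fun i => l'.get (i.cast hl'.symm)) (by rw [e hl', hz])
    fun i => ?_
  convert hs _ (List.get_mem l _) using 2
  ext x
  simp only [mem_range, mem_ofPred_eq, List.mem_iff_get]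
  subst hl'
  rfl

theorem IsVal.segDiff_symSeg {μ : ConvexBody V → ℝ} (h : IsVal 2 μ) (v w : V) :
    segDiff v μ (symSeg w) = 2 * μ (zon [v, w]) := by
  have hT := h.isVal_segDiff v
  have e : ∀ w : V, zon [w] = seg w := fun w => by simp
  have e1 := IsVal.zon_smul (l := []) hT w (-1)
  rw [e, e] at e1
  rw [symSeg, hT.add_of_mem_zonoids _ (seg_mem_zonoids _), ← neg_one_smul ℝ w, e1,
    h.apply_zon_cons (by simp), e]
  simp
  ring

end Iterated

variable {n : ℕ}

theorem iterDiff_unitaryBody {Φ : ConvexBody (Ecl n) → ℝ} (hU : UnitInv Φ)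
    (U : Ecl n ≃ₗᵢ[ℂ] Ecl n) {T : List (Ecl n)} (hT : ∀ v ∈ T, U v = v) (K : ConvexBody (Ecl n)) :
    iterDiff T Φ (unitaryBody U K) = iterDiff T Φ K := by
  induction T generalizing K with
  | nil => exact hU U K
  | cons v T ih =>
    have h1 := ih fun w hw => hT w (List.mem_cons_of_mem _ hw)
    have h2 : seg v = unitaryBody U (seg v) := by
      rw [unitaryBody_seg, hT v List.mem_cons_self]
    change segDiff v (iterDiff T Φ) _ = segDiff v (iterDiff T Φ) _
    rw [segDiff, h2, ← unitaryBody_add, h1, h1, segDiff]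

theorem UnitInv.zon_quadratic {Φ : ConvexBody (Ecl n) → ℝ} (hU : UnitInv Φ) {T : List (Ecl n)}
    (h : IsVal (2 + T.length) Φ) {v e : Ecl n} (hv : ‖v‖ = 1) (he : ‖e‖ = 1)
    (hve : inner ℂ v e = 0) (hTv : ∀ w ∈ T, inner ℂ v w = 0) (hTe : ∀ w ∈ T, inner ℂ e w = 0)
    {a b : ℝ} (hab : a ^ 2 + b ^ 2 = 1) :
    Φ (zon (v :: (a • I • v + b • e) :: T))
      = a ^ 2 * Φ (zon (v :: I • v :: T)) + b ^ 2 * Φ (zon (v :: e :: T)) := by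
  have hb : Orthonormal ℂ ![(!₂[1, 0] : Ecl 2), !₂[0, 1]] :=
    orthonormal_pair (Ecl.norm_pair (by simp)) (Ecl.norm_pair (by simp))
      (by simp [PiLp.inner_apply])
  let f : Ecl 2 →ₗ[ℂ] Ecl n :=
    { toFun := fun x => x 0 • v + x 1 • e
      map_add' := fun x y => by simp [add_smul]; abel
      map_smul' := fun r x => by simp [mul_smul] }
  have hf : ∀ z w : ℂ, f !₂[z, w] = z • v + w • e := fun z w => rfl
  let j : Ecl 2 →ₗᵢ[ℂ] Ecl n := ⟨f, fun x => by
    rw [← mul_self_inj (norm_nonneg _) (norm_nonneg _)]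
    change ‖x 0 • v + x 1 • e‖ * ‖x 0 • v + x 1 • e‖ = _
    rw [norm_add_sq_eq_norm_sq_add_norm_sq_of_inner_eq_zero (𝕜 := ℂ) _ _
      (by rw [inner_smul_left, inner_smul_right, hve]; simp), norm_smul, norm_smul, hv, he,
      ← sq ‖x‖, EuclideanSpace.norm_sq_eq]
    simp [Fin.sum_univ_two, sq]⟩
  have hj : ∀ z w : ℂ, j !₂[z, w] = z • v + w • e := fun z w => rfl
  let jr : Ecl 2 →L[ℝ] Ecl n := j.toContinuousLinearMap.restrictScalars ℝ
  have hjr : ∀ x, jr x = j x := fun x => rfl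
  let ψ : ConvexBody (Ecl 2) → ℝ := fun K => iterDiff T Φ (K.map jr)
  have hψ : IsVal 2 ψ := h.iterDiff.map (f := jr) j.injective
  have hψU : UnitInv ψ := by
    intro U K
    obtain ⟨U', h1, h2⟩ := exists_unitary_extend j U
    have : (unitaryBody U K).map jr = unitaryBody U' (K.map jr) := by
      ext1
      rw [coe_map, coe_unitaryBody, coe_unitaryBody, coe_map, image_image, image_image]
      exact image_congr fun x _ => (h1 x).symm
    change iterDiff T Φ _ = iterDiff T Φ _
    rw [this]
    refine iterDiff_unitaryBody hU U' (fun w hw => h2 w fun x => ?_) _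
    change inner ℂ (x 0 • v + x 1 • e) w = 0
    rw [inner_add_left, inner_smul_left, inner_smul_left, hTv w hw, hTe w hw]
    simp
  have hval : ∀ x y, ψ (zon [x, y]) = Φ (zon (j x :: j y :: T)) := fun x y => by
    change iterDiff T Φ _ = _
    rw [map_zon, h.iterDiff_zon (by simp)]
    rfl
  have key := segDiff_quadratic hψU hψ hab
  rw [hψ.segDiff_symSeg, hψ.segDiff_symSeg, hψ.segDiff_symSeg, hval, hval, hval, hj, hj, hj, hj]
    at key
  have e1 : (I * a) • v + (b : ℂ) • e = a • I • v + b • e := by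
    rw [mul_comm, mul_smul]; rfl
  rw [e1] at key
  simp only [one_smul, zero_smul, add_zero, zero_add] at key
  linarith

end Frames

section HermitianFrames
open ConvexBody Set Complex

variable {n : ℕ}

/-- A list of unit vectors which are pairwise orthogonal for the hermitian product. -/
def IsOrtho (l : List (Ecl n)) : Prop :=
  l.Pairwise (fun x y => inner ℂ x y = 0) ∧ ∀ x ∈ l, ‖x‖ = 1

theorem IsOrtho.perm {l l' : List (Ecl n)} (h : IsOrtho l) (hl : l.Perm l') : IsOrtho l' :=
  ⟨(hl.pairwise_iff fun h => inner_eq_zero_symm.1 h).1 h.1, fun x hx => h.2 x (hl.mem_iff.2 hx)⟩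

theorem IsOrtho.cons {l : List (Ecl n)} (h : IsOrtho l) {v : Ecl n} (hv : ‖v‖ = 1)
    (hvl : ∀ x ∈ l, inner ℂ x v = 0) : IsOrtho (v :: l) :=
  ⟨List.pairwise_cons.2 ⟨fun x hx => inner_eq_zero_symm.1 (hvl x hx), h.1⟩, by
    simpa using ⟨hv, h.2⟩⟩

/-- The frame formed by the vectors of `A`, their multiples by `i`, and the vectors of `B`. -/
def hermFrame (A B : List (Ecl n)) : List (Ecl n) := A ++ A.map (I • ·) ++ B

theorem length_hermFrame (A B : List (Ecl n)) :
    (hermFrame A B).length = 2 * A.length + B.length := by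
  simp [hermFrame]; ring

theorem zon_hermFrame_cons_left (v : Ecl n) (A B R : List (Ecl n)) :
    zon (hermFrame (v :: A) B ++ R) = zon (v :: I • v :: (hermFrame A B ++ R)) := by
  simp only [hermFrame, List.map_cons, List.cons_append, zon_cons, zon_append]
  abel

theorem zon_hermFrame_cons_right (v : Ecl n) (A B R : List (Ecl n)) :
    zon (hermFrame A (v :: B) ++ R) = zon (v :: (hermFrame A B ++ R)) := by
  simp only [hermFrame, zon_cons, zon_append]
  abel

theorem inner_hermFrame {A B : List (Ecl n)} {r : Ecl n} (h : ∀ x ∈ A ++ B, inner ℂ x r = 0) :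
    ∀ x ∈ hermFrame A B, inner ℂ x r = 0 := by
  intro x hx
  simp only [hermFrame, List.mem_append, List.mem_map] at hx h
  rcases hx with (hx | ⟨y, hy, rfl⟩) | hx
  · exact h x (Or.inl hx)
  · rw [inner_smul_left, h y (Or.inl hy), mul_zero]
  · exact h x (Or.inr hx)

theorem Ecl.inner_eq_zero_iff (x y : Ecl n) :
    inner ℂ x y = 0 ↔ inner ℝ x y = 0 ∧ inner ℝ (I • x) y = 0 := by
  rw [Ecl.inner_I_smul, Ecl.inner_eq_re, Complex.ext_iff]; rfl

theorem Ecl.inner_I_smul_swap (x y : Ecl n) : inner ℝ (I • x) y = -inner ℝ x (I • y) := by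
  rw [Ecl.inner_I_smul, Ecl.inner_eq_re, inner_smul_right]
  simp

theorem Ecl.inner_I_smul_self (x : Ecl n) : inner ℝ (I • x) x = 0 := by
  have := Ecl.inner_I_smul_swap x x
  rw [real_inner_comm (I • x) x] at this
  linarith

/-- A skew map has an invariant plane on which it is a multiple of a rotation. -/
theorem exists_skew_pair {F : Type*} [NormedAddCommGroup F] [InnerProductSpace ℝ F]
    [FiniteDimensional ℝ F] (hF : 0 < Module.finrank ℝ F) (J : F →ₗ[ℝ] F)
    (hskew : ∀ s s', inner ℝ (J s) s' = -inner ℝ s (J s')) :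
    ∃ v : F, ‖v‖ = 1 ∧ (J v = 0 ∨ ∃ w : F, ∃ c : ℝ, 0 < c ∧ ‖w‖ = 1 ∧ J v = c • w ∧
      J w = (-c) • v) := by
  have hsym : (J ∘ₗ J).IsSymmetric := fun s s' => by
    rw [LinearMap.comp_apply, LinearMap.comp_apply, hskew, hskew, neg_neg]
  let v : F := hsym.eigenvectorBasis rfl ⟨0, hF⟩
  have hv : ‖v‖ = 1 := (hsym.eigenvectorBasis rfl).orthonormal.1 _
  obtain ⟨d, hd⟩ : ∃ d : ℝ, J (J v) = d • v :=
    ⟨_, hsym.apply_eigenvectorBasis rfl ⟨0, hF⟩⟩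
  refine ⟨v, hv, ?_⟩
  by_cases h0 : J v = 0
  · exact Or.inl h0
  right
  have hc : 0 < ‖J v‖ := norm_pos_iff.2 h0
  have hd' : d = -‖J v‖ ^ 2 := by
    have := hskew (J v) v
    rw [hd, real_inner_smul_left, real_inner_self_eq_norm_sq, real_inner_self_eq_norm_sq, hv]
      at this
    simpa using this
  refine ⟨‖J v‖⁻¹ • J v, ‖J v‖, hc, ?_, ?_, ?_⟩
  · rw [norm_smul, norm_inv, norm_norm, inv_mul_cancel₀ hc.ne']
  · rw [smul_inv_smul₀ hc.ne']
  · rw [_root_.map_smul, hd, hd', smul_smul]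
    congr 1
    field_simp

/-- A normal form for the Kähler form on a real subspace: one plane can be split off. -/
theorem exists_kahler_pair {S : Submodule ℝ (Ecl n)} (hS : 0 < Module.finrank ℝ S) :
    ∃ v ∈ S, ‖v‖ = 1 ∧ ((∀ s ∈ S, inner ℝ (I • v) s = 0) ∨
      ∃ w ∈ S, ∃ c : ℝ, 0 < c ∧ ‖w‖ = 1 ∧
        ∀ s ∈ S, inner ℝ (I • v) s = c * inner ℝ w s ∧ inner ℝ (I • w) s = -c * inner ℝ v s) := by
  let iL : Ecl n →ₗ[ℝ] Ecl n :=
    { toFun := fun x => I • x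
      map_add' := fun x y => smul_add _ _ _
      map_smul' := fun r x => smul_comm _ _ _ }
  let J : S →ₗ[ℝ] S := S.orthogonalProjectionOnto.toLinearMap ∘ₗ iL ∘ₗ S.subtype
  have hJ : ∀ s s' : S, inner ℝ (J s) s' = inner ℝ (I • (s : Ecl n)) (s' : Ecl n) := fun s s' =>
    Submodule.inner_orthogonalProjectionOnto_eq_of_mem_right s' _
  have hskew : ∀ s s' : S, inner ℝ (J s) s' = -inner ℝ s (J s') := fun s s' => by
    rw [hJ, Ecl.inner_I_smul_swap, real_inner_comm (I • (s' : Ecl n)), ← hJ s' s,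
      real_inner_comm (J s') s]
  obtain ⟨v, hv, h⟩ := exists_skew_pair (F := S) hS J hskew
  refine ⟨v, v.2, hv, ?_⟩
  rcases h with h0 | ⟨w, c, hc, hw, hvw, hwv⟩
  · left
    intro s hs
    rw [← hJ v ⟨s, hs⟩, h0, inner_zero_left]
  · refine Or.inr ⟨w, w.2, c, hc, hw, fun s hs => ⟨?_, ?_⟩⟩
    · rw [← hJ v ⟨s, hs⟩, hvw]
      exact real_inner_smul_left w (⟨s, hs⟩ : S) c
    · rw [← hJ w ⟨s, hs⟩, hwv]
      exact real_inner_smul_left v (⟨s, hs⟩ : S) (-c)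

theorem exists_list_span {V : Type*} [AddCommGroup V] [Module ℝ V] [FiniteDimensional ℝ V]
    (S : Submodule ℝ V) : ∃ L : List V, L.length = Module.finrank ℝ S ∧ (∀ x ∈ L, x ∈ S) ∧
      S ≤ Submodule.span ℝ {x | x ∈ L} := by
  let b := Module.finBasis ℝ S
  refine ⟨List.ofFn fun i => (b i : V), by simp, ?_, ?_⟩
  · intro x hx
    obtain ⟨i, rfl⟩ := (List.mem_ofFn' _ _).1 hx
    exact (b i).2
  · intro s hs
    have h1 := b.sum_repr ⟨s, hs⟩
    have h2 : s = ∑ i, b.repr ⟨s, hs⟩ i • (b i : V) := by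
      have h3 := congrArg S.subtype h1
      rw [map_sum] at h3
      exact h3.symm
    rw [h2]
    refine Submodule.sum_mem _ fun i _ => Submodule.smul_mem _ _ (Submodule.subset_span ?_)
    exact (List.mem_ofFn' _ _).2 ⟨i, rfl⟩

theorem span_sup_inf_orthogonal {V : Type*} [NormedAddCommGroup V] [InnerProductSpace ℝ V]
    [FiniteDimensional ℝ V] {P S : Submodule ℝ V} (hPS : P ≤ S) :
    ∃ L : List V, L.length + Module.finrank ℝ P = Module.finrank ℝ S ∧
      (∀ x ∈ L, x ∈ S ∧ ∀ p ∈ P, inner ℝ p x = 0) ∧ S ≤ P ⊔ Submodule.span ℝ {x | x ∈ L} := by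
  obtain ⟨L, hL, hLS, hSL⟩ := exists_list_span (Pᗮ ⊓ S)
  refine ⟨L, ?_, fun x hx => ⟨(hLS x hx).2, fun p hp => (hLS x hx).1 p hp⟩, ?_⟩
  · rw [hL, add_comm, Submodule.finrank_add_inf_finrank_orthogonal hPS]
  · conv_lhs => rw [← Submodule.sup_orthogonal_inf_of_hasOrthogonalProjection hPS]
    exact sup_le_sup_left hSL _

theorem UnitInv.zon_hermFrame_append_eq_zero {k : ℕ} {Φ : ConvexBody (Ecl n) → ℝ} (h : IsVal k Φ)
    (hU : UnitInv Φ)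
    (hG : ∀ A B, IsOrtho (A ++ B) → 2 * A.length + B.length = k → Φ (zon (hermFrame A B)) = 0)
    (m : ℕ) : ∀ A B R, IsOrtho (A ++ B) → R.length = m → 2 * A.length + B.length + m = k →
      (∀ r ∈ R, ∀ x ∈ A ++ B, inner ℂ x r = 0) → Φ (zon (hermFrame A B ++ R)) = 0 := by
  induction m using Nat.strong_induction_on with
  | _ m ih =>
  intro A B R hAB hR hk hperp
  rcases Nat.eq_zero_or_pos m with rfl | hm
  · rw [List.length_eq_zero_iff.1 hR, List.append_nil]
    exact hG A B hAB (by omega)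
  set G := hermFrame A B with hGdef
  have hGl : G.length = 2 * A.length + B.length := length_hermFrame A B
  have hGR : (G ++ R).length = k := by rw [List.length_append]; omega
  set S := Submodule.span ℝ {x | x ∈ R} with hSdef
  have hSperp : ∀ s ∈ S, ∀ x ∈ A ++ B, inner ℂ x s = 0 := by
    intro s hs x hx
    induction hs using Submodule.span_induction with
    | mem r hr => exact hperp r hr x hx
    | zero => exact inner_zero_right _
    | add s t _ _ hs ht => rw [inner_add_right, hs, ht, add_zero]
    | smul a s _ hs => rw [← Complex.coe_smul, inner_smul_right, hs, mul_zero]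
  have hSm : Module.finrank ℝ S ≤ m := by
    classical
    have := finrank_span_finset_le_card (R := ℝ) R.toFinset
    rw [List.coe_toFinset] at this
    exact this.trans (R.toFinset_card_le.trans hR.le)
  have key : ∀ l' : List (Ecl n), l'.length = k → Φ (zon l') = 0 → (∀ x ∈ G, x ∈ l') →
      S ≤ Submodule.span ℝ {x | x ∈ l'} → Φ (zon (G ++ R)) = 0 := fun l' hl' hz hG' hS' =>
    h.zon_eq_zero_of_span hGR hl' hz fun v hv => by
      rcases List.mem_append.1 hv with hv | hv
      · exact Submodule.subset_span (hG' v hv)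
      · exact hS' (Submodule.subset_span hv)
  rcases hSm.lt_or_eq with hlt | heq
  · obtain ⟨L, hL, -, hSL⟩ := exists_list_span S
    refine key (G ++ L ++ List.replicate (m - L.length) 0) ?_ ?_ ?_ ?_
    · simp only [List.length_append, List.length_replicate]; omega
    · have e : zon (G ++ L ++ List.replicate (m - L.length) (0 : Ecl n)) = zon (G ++ L) := by
        rw [zon_append _ (List.replicate _ _)]
        simp [zon]
      rw [e]
      refine h.zon_eq_zero ?_
      rw [List.length_append]; omega
    · intro x hx; simp [hx]
    · refine hSL.trans (Submodule.span_mono fun x hx => ?_)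
      simp only [mem_ofPred_eq] at hx
      simp [hx]
  obtain ⟨v, hvS, hv, hcase⟩ := exists_kahler_pair (S := S) (by omega)
  rcases hcase with h0 | ⟨w, hwS, c, hc, hw, hvw⟩
  · obtain ⟨L, hLl, hLS, hSL⟩ := span_sup_inf_orthogonal
      ((Submodule.span_singleton_le_iff_mem v S).2 hvS)
    rw [finrank_span_singleton (norm_ne_zero_iff.1 (by rw [hv]; exact one_ne_zero))] at hLl
    refine key (v :: (G ++ L)) ?_ ?_ ?_ ?_
    · simp only [List.length_append, List.length_cons]; omega
    · rw [← zon_hermFrame_cons_right]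
      refine ih L.length (by omega) _ _ _
        ((hAB.cons hv (hSperp v hvS)).perm List.perm_middle.symm) rfl
        (by simp only [List.length_cons]; omega) fun r hr x hx => ?_
      rcases List.mem_cons.1 (List.perm_middle.mem_iff.1 hx) with rfl | hx
      · exact (Ecl.inner_eq_zero_iff _ _).2
          ⟨(hLS r hr).2 _ (Submodule.mem_span_singleton_self _), h0 r (hLS r hr).1⟩
      · exact hSperp r (hLS r hr).1 x hx
    · intro x hx; simp [hx]
    · refine hSL.trans (sup_le (Submodule.span_mono ?_) (Submodule.span_mono ?_))
      · intro x hx; rw [mem_singleton_iff] at hx; simp [hx]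
      · intro x hx; simp only [mem_ofPred_eq] at hx; simp [hx]
  · have hwv : inner ℝ w v = 0 := by
      have := (hvw v hvS).1
      rw [Ecl.inner_I_smul_self] at this
      rcases mul_eq_zero.1 this.symm with h | h
      · exact absurd h hc.ne'
      · exact h
    have hPS : Submodule.span ℝ {v, w} ≤ S := Submodule.span_le.2 (by
      rintro x (rfl | rfl)
      exacts [hvS, hwS])
    obtain ⟨L, hLl, hLS, hSL⟩ := span_sup_inf_orthogonal hPS
    have hP2 : Module.finrank ℝ (Submodule.span ℝ {v, w}) = 2 := by
      have hon : Orthonormal ℝ ![v, w] := by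
        rw [orthonormal_iff_ite]
        intro i j
        fin_cases i <;> fin_cases j <;>
          simp [hv, hw, hwv, real_inner_comm w v]
      have := finrank_span_eq_card hon.linearIndependent
      rwa [Matrix.range_cons_cons_empty, Fintype.card_fin] at this
    rw [hP2] at hLl
    have hvP : v ∈ Submodule.span ℝ {v, w} := Submodule.subset_span (by simp)
    have hwP : w ∈ Submodule.span ℝ {v, w} := Submodule.subset_span (by simp)
    have hvL : ∀ r ∈ L, inner ℂ v r = 0 := fun r hr => (Ecl.inner_eq_zero_iff _ _).2
      ⟨(hLS r hr).2 _ hvP, by rw [(hvw r (hLS r hr).1).1, (hLS r hr).2 _ hwP, mul_zero]⟩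
    have hwL : ∀ r ∈ L, inner ℂ w r = 0 := fun r hr => (Ecl.inner_eq_zero_iff _ _).2
      ⟨(hLS r hr).2 _ hwP, by rw [(hvw r (hLS r hr).1).2, (hLS r hr).2 _ hvP, mul_zero]⟩
    set T := G ++ L with hT
    have hTl : 2 + T.length = k := by rw [hT, List.length_append]; omega
    set e : Ecl n := w - c • I • v with he
    have hve : inner ℂ v e = 0 := by
      rw [Ecl.inner_eq_zero_iff, he, inner_sub_right, inner_sub_right, real_inner_smul_right,
        real_inner_smul_right, real_inner_comm w v, hwv, real_inner_comm (I • v) v,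
        Ecl.inner_I_smul_self, (hvw w hwS).1, real_inner_self_eq_norm_sq,
        real_inner_self_eq_norm_sq, norm_smul, hw, hv]
      simp
    have heG : ∀ x ∈ A ++ B, inner ℂ x e = 0 := fun x hx => by
      rw [he, inner_sub_right, hSperp w hwS x hx, ← Complex.coe_smul, inner_smul_right,
        inner_smul_right, hSperp v hvS x hx]
      simp
    have heL : ∀ r ∈ L, inner ℂ e r = 0 := fun r hr => by
      rw [he, inner_sub_left, hwL r hr, ← Complex.coe_smul, inner_smul_left,
        inner_smul_left, hvL r hr]
      simp
    have hvT : ∀ x ∈ T, inner ℂ v x = 0 := fun x hx => by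
      rcases List.mem_append.1 hx with hx | hx
      · exact inner_eq_zero_symm.1 (inner_hermFrame (hSperp v hvS) x hx)
      · exact hvL x hx
    have heT : ∀ x ∈ T, inner ℂ e x = 0 := fun x hx => by
      rcases List.mem_append.1 hx with hx | hx
      · exact inner_eq_zero_symm.1 (inner_hermFrame heG x hx)
      · exact heL x hx
    have hw' : w = c • I • v + e := by rw [he]; abel
    have hne : c ^ 2 + ‖e‖ ^ 2 = 1 := by
      have h1 : inner ℝ (c • I • v) e = 0 := by
        rw [real_inner_smul_left, ((Ecl.inner_eq_zero_iff _ _).1 hve).2, mul_zero]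
      have h2 := norm_add_sq_real (c • I • v) e
      rw [← hw', h1, hw, norm_smul, norm_smul, hv] at h2
      simp [abs_of_pos hc] at h2
      linarith
    have c1 : Φ (zon (v :: I • v :: T)) = 0 := by
      rw [hT, ← zon_hermFrame_cons_left]
      refine ih L.length (by omega) (v :: A) B L (hAB.cons hv (hSperp v hvS)) rfl
        (by simp only [List.length_cons]; omega) fun r hr x hx => ?_
      rcases List.mem_cons.1 hx with rfl | hx
      · exact hvL r hr
      · exact hSperp r (hLS r hr).1 x hx
    have c2 : Φ (zon (v :: w :: T)) = 0 := by
      rcases eq_or_ne e 0 with he0 | he0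
      · rw [he0, norm_zero] at hne
        have : c = 1 := by nlinarith
        rw [he0, this, one_smul, add_zero] at hw'
        rw [hw', c1]
      · have hen : 0 < ‖e‖ := norm_pos_iff.2 he0
        set e2 : Ecl n := ((‖e‖⁻¹ : ℝ) : ℂ) • e with he2
        have he21 : ‖e2‖ = 1 := by
          rw [he2, norm_smul, Complex.norm_real, norm_inv, norm_norm, inv_mul_cancel₀ hen.ne']
        have hee : ‖e‖ • e2 = e := by
          rw [he2, Complex.coe_smul, smul_inv_smul₀ hen.ne']
        have c3 : Φ (zon (v :: e2 :: T)) = 0 := by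
          have e1 : zon (v :: e2 :: T) = zon (hermFrame A (e2 :: v :: B) ++ L) := by
            rw [zon_hermFrame_cons_right, zon_cons e2, zon_hermFrame_cons_right]
            simp only [zon_cons, hT, zon_append]
            abel
          rw [e1]
          have hp : (A ++ e2 :: v :: B).Perm (e2 :: v :: (A ++ B)) :=
            List.perm_middle.trans (List.perm_middle.cons _)
          refine ih L.length (by omega) A (e2 :: v :: B) L
            (((hAB.cons hv (hSperp v hvS)).cons he21 ?_).perm hp.symm) rfl
            (by simp only [List.length_cons]; omega) fun r hr x hx => ?_
          · intro x hx
            rw [he2, inner_smul_right]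
            rcases List.mem_cons.1 hx with rfl | hx
            · rw [hve, mul_zero]
            · rw [heG x hx, mul_zero]
          · have hx := hp.mem_iff.1 hx
            simp only [List.mem_cons] at hx
            rcases hx with rfl | rfl | hx
            · rw [he2, inner_smul_left, heL r hr, mul_zero]
            · exact hvL r hr
            · exact hSperp r (hLS r hr).1 x hx
        have hq := hU.zon_quadratic (T := T) (hTl ▸ h) hv he21
          (by rw [he2, inner_smul_right, hve, mul_zero]) hvT
          (fun x hx => by rw [he2, inner_smul_left, heT x hx, mul_zero]) hne
        rwa [hee, ← hw', c1, c3, mul_zero, mul_zero, add_zero] at hq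
    refine key (v :: w :: T) (by simp only [List.length_cons]; omega) c2 ?_ ?_
    · intro x hx; simp [hT, hx]
    · refine hSL.trans (sup_le (Submodule.span_mono ?_) (Submodule.span_mono ?_))
      · rintro x (rfl | rfl) <;> simp
      · intro x hx; simp only [mem_ofPred_eq] at hx; simp [hT, hx]

theorem UnitInv.zon_eq_zero_of_hermFrame {k : ℕ} {Φ : ConvexBody (Ecl n) → ℝ} (h : IsVal k Φ)
    (hU : UnitInv Φ)
    (hG : ∀ A B, IsOrtho (A ++ B) → 2 * A.length + B.length = k → Φ (zon (hermFrame A B)) = 0)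
    {l : List (Ecl n)} (hl : l.length = k) : Φ (zon l) = 0 :=
  hU.zon_hermFrame_append_eq_zero h hG k [] [] l ⟨List.Pairwise.nil, by simp⟩ hl (by simp)
    (by simp)

end HermitianFrames

section Zonotopes
open ConvexBody Set

variable {V : Type*} [NormedAddCommGroup V] [InnerProductSpace ℝ V]

theorem supp_zon (l : List V) (y : V) :
    (zon l).supp y = (l.map fun v => max 0 (inner ℝ v y)).sum := by
  induction l with
  | nil => simp
  | cons v l ih => rw [zon_cons, supp_add_body, ih, supp_seg, List.map_cons, List.sum_cons]

theorem zon_subset_span (l : List V) : (zon l : Set V) ⊆ Submodule.span ℝ {x | x ∈ l} := by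
  induction l with
  | nil => simp
  | cons v l ih =>
    rw [zon_cons]
    rintro _ ⟨a, ha, b, hb, rfl⟩
    refine add_mem ?_ (Submodule.span_mono (fun x hx => List.mem_cons_of_mem _ hx) (ih hb))
    obtain ⟨t, -, -, rfl⟩ := mem_seg.1 ha
    exact Submodule.smul_mem _ _ (Submodule.subset_span List.mem_cons_self)

/-- The unit cube, as a convex body. -/
def unitCube (k : ℕ) : ConvexBody (Eucl k) := zon (List.ofFn fun i => EuclideanSpace.single i 1)

theorem hausdorffMeasure_unitCube (k : ℕ) :
    (μH[(k : ℝ)] (unitCube k : Set (Eucl k))).toReal ≠ 0 := by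
  have hH : Measure.IsAddHaarMeasure (μH[(k : ℝ)] : Measure (Eucl k)) := by
    have := isAddHaarMeasure_hausdorffMeasure (E := Eucl k)
    rwa [finrank_euclideanSpace_fin] at this
  refine ENNReal.toReal_ne_zero.2 ⟨ne_of_gt ?_, (unitCube k).isCompact.measure_lt_top.ne⟩
  have ho : IsOpen {x : Eucl k | ∀ i, 0 < x i ∧ x i < 1} := by
    simp only [ofPred_forall, ofPred_and]
    refine isOpen_iInter_of_finite fun i => (isOpen_lt ?_ ?_).inter (isOpen_lt ?_ ?_) <;> fun_prop
  refine (ho.measure_pos _ ⟨WithLp.toLp 2 fun _ => 1 / 2, fun i => ?_⟩).trans_le (measure_mono ?_)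
  · norm_num
  · intro x hx
    refine mem_of_inner_le_supp fun y => ?_
    rw [unitCube, supp_zon, List.map_ofFn, List.sum_ofFn, PiLp.inner_apply]
    refine Finset.sum_le_sum fun i _ => ?_
    have := hx i
    simp only [Function.comp_apply, EuclideanSpace.inner_single_left, RCLike.inner_apply,
      conj_trivial, map_one, one_mul]
    rcases le_total 0 (y i) with h | h
    · rw [max_eq_right h]; nlinarith
    · rw [max_eq_left h]; nlinarith

theorem orthonormal_get {𝕜 F : Type*} [RCLike 𝕜] [NormedAddCommGroup F] [InnerProductSpace 𝕜 F]
    {l : List F} (h : l.Pairwise fun x y => inner 𝕜 x y = 0) (h1 : ∀ x ∈ l, ‖x‖ = 1) :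
    Orthonormal 𝕜 l.get := by
  refine ⟨fun i => h1 _ (List.get_mem _ _), fun i j hij => ?_⟩
  rcases lt_or_gt_of_ne hij with hij | hij
  · exact List.pairwise_iff_get.1 h i j hij
  · exact inner_eq_zero_symm.1 (List.pairwise_iff_get.1 h j i hij)

theorem finrank_span_of_pairwise {l : List V} (h : l.Pairwise fun x y => inner ℝ x y = 0)
    (h1 : ∀ x ∈ l, ‖x‖ = 1) : Module.finrank ℝ (Submodule.span ℝ {x | x ∈ l}) = l.length := by
  have := finrank_span_eq_card (orthonormal_get h h1).linearIndependent
  rwa [Set.range_list_get, Fintype.card_fin] at this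

theorem hausdorffMeasure_zon [MeasurableSpace V] [BorelSpace V] {l : List V}
    (h : l.Pairwise fun x y => inner ℝ x y = 0) (h1 : ∀ x ∈ l, ‖x‖ = 1) :
    (μH[(l.length : ℝ)] (zon l : Set V)).toReal ≠ 0 := by
  let b := EuclideanSpace.basisFun (Fin l.length) ℝ
  have hT : ∀ i, b.toBasis.constr ℝ l.get (b.toBasis i) = l.get i := b.toBasis.constr_basis ℝ l.get
  let T := LinearMap.isometryOfOrthonormal (b.toBasis.constr ℝ l.get) (v := b.toBasis)
    (by rw [b.coe_toBasis]; exact b.orthonormal)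
    (by rw [show _ ∘ _ = l.get from funext hT]; exact orthonormal_get h h1)
  have e : (zon l : Set V) = T '' (unitCube l.length : Set _) := by
    have h2 : zon l = (unitCube l.length).map T.toContinuousLinearMap := by
      rw [unitCube, map_zon, List.map_ofFn]
      conv_lhs => rw [← List.ofFn_get l]
      congr 2
      funext i
      have := hT i
      rw [b.coe_toBasis, EuclideanSpace.basisFun_apply] at this
      exact this.symm
    rw [h2]
    rfl
  rw [e, T.isometry.hausdorffMeasure_image (Or.inl (Nat.cast_nonneg _))]
  exact hausdorffMeasure_unitCube _

theorem inner_eq_zero_of_mem_span {s : Set V} {w : V} (h : ∀ x ∈ s, inner ℝ x w = 0) {v : V}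
    (hv : v ∈ Submodule.span ℝ s) : inner ℝ v w = 0 := by
  induction hv using Submodule.span_induction with
  | mem x hx => exact h x hx
  | zero => exact inner_zero_left _
  | add x y _ _ hx hy => rw [inner_add_left, hx, hy, add_zero]
  | smul a x _ hx => rw [real_inner_smul_left, hx, mul_zero]

end Zonotopes

section Basis
open ConvexBody Set Complex

variable {n : ℕ}

theorem IsOrtho.sublist {l l' : List (Ecl n)} (h : IsOrtho l) (hl : l'.Sublist l) : IsOrtho l' :=
  ⟨h.1.sublist hl, fun x hx => h.2 x (hl.subset hx)⟩

theorem IsOrtho.inner_I_smul {l : List (Ecl n)} (h : IsOrtho l) {x y : Ecl n} (hx : x ∈ l)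
    (hy : y ∈ l) : inner ℝ (I • x) y = 0 := by
  rcases eq_or_ne x y with rfl | hxy
  · exact Ecl.inner_I_smul_self x
  · have : Std.Symm fun x y : Ecl n => inner ℂ x y = 0 := ⟨fun _ _ h => inner_eq_zero_symm.1 h⟩
    exact ((Ecl.inner_eq_zero_iff x y).1 (h.1.forall hx hy hxy)).2

theorem IsOrtho.pairwise_real {l : List (Ecl n)} (h : IsOrtho l) :
    l.Pairwise fun x y => inner ℝ x y = 0 :=
  h.1.imp fun h => ((Ecl.inner_eq_zero_iff _ _).1 h).1

theorem IsOrtho.length_le {l : List (Ecl n)} (h : IsOrtho l) : l.length ≤ n := by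
  have := (orthonormal_get h.1 h.2).linearIndependent.fintype_card_le_finrank
  simpa using this

theorem IsOrtho.pairwise_complex {A : List (Ecl n)} (h : IsOrtho A) :
    (A ++ A.map (I • ·)).Pairwise fun x y => inner ℝ x y = 0 := by
  rw [List.pairwise_append, List.pairwise_map]
  refine ⟨h.pairwise_real, h.1.imp fun {x y} hxy => ?_, fun x hx y hy => ?_⟩
  · rw [Ecl.inner_I_smul, inner_smul_right, hxy, mul_zero, zero_im]
  · obtain ⟨z, hz, rfl⟩ := List.mem_map.1 hy
    rw [real_inner_comm]
    exact h.inner_I_smul hz hx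

theorem IsOrtho.norm_complex {A : List (Ecl n)} (h : IsOrtho A) :
    ∀ x ∈ A ++ A.map (I • ·), ‖x‖ = 1 := by
  intro x hx
  rcases List.mem_append.1 hx with hx | hx
  · exact h.2 x hx
  · obtain ⟨y, hy, rfl⟩ := List.mem_map.1 hx
    rw [norm_smul, h.2 y hy, norm_I, one_mul]

theorem IsOrtho.inner_complex {A B : List (Ecl n)} (h : IsOrtho (A ++ B)) :
    ∀ x ∈ A ++ A.map (I • ·), ∀ y ∈ B, inner ℝ x y = 0 := by
  intro x hx y hy
  rcases List.mem_append.1 hx with hx | hx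
  · exact ((Ecl.inner_eq_zero_iff _ _).1 ((List.pairwise_append.1 h.1).2.2 x hx y hy)).1
  · obtain ⟨z, hz, rfl⟩ := List.mem_map.1 hx
    exact h.inner_I_smul (List.mem_append_left _ hz) (List.mem_append_right _ hy)

theorem IsOrtho.pairwise_hermFrame {A B : List (Ecl n)} (h : IsOrtho (A ++ B)) :
    (hermFrame A B).Pairwise fun x y => inner ℝ x y = 0 :=
  List.pairwise_append.2 ⟨(h.sublist (List.sublist_append_left A B)).pairwise_complex,
    (h.sublist (List.sublist_append_right A B)).pairwise_real, h.inner_complex⟩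

theorem IsOrtho.norm_hermFrame {A B : List (Ecl n)} (h : IsOrtho (A ++ B)) :
    ∀ x ∈ hermFrame A B, ‖x‖ = 1 := by
  intro x hx
  rcases List.mem_append.1 hx with hx | hx
  · exact (h.sublist (List.sublist_append_left A B)).norm_complex x hx
  · exact h.2 x (List.mem_append_right _ hx)

theorem IsOrtho.isTypeSubspace {A B : List (Ecl n)} (h : IsOrtho (A ++ B)) {k : ℕ}
    (hk : 2 * A.length + B.length = k) :
    IsTypeSubspace k A.length (Submodule.span ℝ {x | x ∈ hermFrame A B}) := by
  have hA := h.sublist (List.sublist_append_left A B)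
  have hB := h.sublist (List.sublist_append_right A B)
  refine ⟨?_, Submodule.span ℝ {x | x ∈ A ++ A.map (I • ·)}, Submodule.span ℝ {x | x ∈ B},
    fun v hv => ?_, ?_, fun v hv w hw => ?_, ?_, fun v hv w hw => ?_, ?_⟩
  · rw [finrank_span_of_pairwise h.pairwise_hermFrame h.norm_hermFrame, length_hermFrame, hk]
  · induction hv using Submodule.span_induction with
    | mem x hx =>
      rcases List.mem_append.1 hx with hx | hx
      · exact Submodule.subset_span (List.mem_append_right _ (List.mem_map_of_mem hx))
      · obtain ⟨z, hz, rfl⟩ := List.mem_map.1 hx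
        rw [smul_smul, I_mul_I, neg_one_smul]
        exact Submodule.neg_mem _ (Submodule.subset_span (List.mem_append_left _ hz))
    | zero => rw [smul_zero]; exact Submodule.zero_mem _
    | add x y _ _ hx hy => rw [smul_add]; exact Submodule.add_mem _ hx hy
    | smul a x _ hx => rw [smul_comm]; exact Submodule.smul_mem _ _ hx
  · rw [finrank_span_of_pairwise hA.pairwise_complex hA.norm_complex, List.length_append,
      List.length_map, two_mul]
  · rw [real_inner_comm]
    refine inner_eq_zero_of_mem_span (fun y hy => ?_) hw
    rw [real_inner_comm, Ecl.inner_I_smul_swap, neg_eq_zero]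
    refine inner_eq_zero_of_mem_span (fun x hx => ?_) hv
    rw [real_inner_comm]
    exact hB.inner_I_smul hy hx
  · rw [finrank_span_of_pairwise hB.pairwise_real hB.2]
    omega
  · refine inner_eq_zero_of_mem_span (fun x hx => ?_) hv
    rw [real_inner_comm]
    refine inner_eq_zero_of_mem_span (fun y hy => ?_) hw
    rw [real_inner_comm]
    exact h.inner_complex x hx y hy
  · rw [← Submodule.span_union]
    congr 1
    ext x
    simp only [hermFrame, List.mem_append, mem_ofPred_eq, mem_union]

theorem UnitInv.zon_hermFrame_eq {φ : ConvexBody (Ecl n) → ℝ} (hU : UnitInv φ)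
    {A B A' B' : List (Ecl n)} (h : IsOrtho (A ++ B)) (h' : IsOrtho (A' ++ B'))
    (hA : A.length = A'.length) (hB : B.length = B'.length) :
    φ (zon (hermFrame A B)) = φ (zon (hermFrame A' B')) := by
  have hl : (A ++ B).length = (A' ++ B').length := by simp [hA, hB]
  obtain ⟨U, hUl⟩ := exists_unitary (orthonormal_get h.1 h.2)
    ((orthonormal_get h'.1 h'.2).comp (Fin.cast hl) (Fin.cast_injective hl))
  have hm : (A ++ B).map U = A' ++ B' := by
    refine List.ext_get (by rw [List.length_map, hl]) fun i h1 h2 => ?_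
    have := hUl ⟨i, by simpa using h1⟩
    simpa [-List.map_append] using this
  rw [List.map_append] at hm
  obtain ⟨rfl, rfl⟩ := List.append_inj hm (by rw [List.length_map, hA])
  rw [← hU U (zon (hermFrame A B)), unitaryBody, map_zon]
  congr 2
  simp only [hermFrame, List.map_append, List.map_map]
  congr 2
  refine List.map_congr_left fun x _ => ?_
  exact U.map_smul I x

theorem exists_hermFrame {k q : ℕ} (h1 : k - n ≤ q) (h2 : q ≤ k / 2) (hk : k ≤ 2 * n) :
    ∃ A B : List (Ecl n), IsOrtho (A ++ B) ∧ A.length = q ∧ 2 * A.length + B.length = k := by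
  let E : List (Ecl n) := List.ofFn fun i => EuclideanSpace.single i 1
  have hE : IsOrtho E := by
    refine ⟨List.pairwise_ofFn.2 fun i j hij => ?_, fun x hx => ?_⟩
    · simp [EuclideanSpace.inner_single_left, hij.ne]
    · obtain ⟨i, rfl⟩ := (List.mem_ofFn' _ _).1 hx
      simp
  have hEl : E.length = n := List.length_ofFn
  refine ⟨E.take q, (E.drop q).take (k - 2 * q), ?_, ?_, ?_⟩
  · rw [← List.take_add]
    exact hE.sublist (List.take_sublist _ _)
  · rw [List.length_take, hEl]
    omega
  · rw [List.length_take, List.length_take, List.length_drop, hEl]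
    omega

theorem UnitInv.eq_zero_of_hermFrame {k : ℕ} {Φ : ConvexBody (Ecl n) → ℝ} (h : IsVal k Φ)
    (hU : UnitInv Φ)
    (hG : ∀ A B, IsOrtho (A ++ B) → 2 * A.length + B.length = k → Φ (zon (hermFrame A B)) = 0)
    (K : ConvexBody (Ecl n)) : Φ K = 0 := by
  refine eq_zero_of_even_of_symm h.val h.cont h.ti (fun K => ?_) (fun K hK => ?_) K
  · rw [← hU (LinearIsometryEquiv.neg ℂ) K]
    congr 1
    ext1
    rw [coe_unitaryBody]
    exact (image_neg_eq_neg (s := (K : Set (Ecl n)))).symm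
  · refine h.eq_zero_of_zon (fun l hl => hU.zon_eq_zero_of_hermFrame h hG hl) fun x => ?_
    rw [← supp_reflect, hK]

theorem HermKlainCond.zon_hermFrame {k q : ℕ} {μ : ConvexBody (Ecl n) → ℝ}
    (h : HermKlainCond k q μ) {A B : List (Ecl n)} (hAB : IsOrtho (A ++ B))
    (hk : 2 * A.length + B.length = k) :
    μ (zon (hermFrame A B)) = if A.length = q then
      (μH[(k : ℝ)] (zon (hermFrame A B) : Set (Ecl n))).toReal else 0 := by
  have := hAB.length_le
  rw [List.length_append] at this
  exact h A.length (by omega) (by omega) _ (hAB.isTypeSubspace hk) _ (zon_subset_span _)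

end Basis

/-- The hermitian intrinsic volumes `μ_{k,q}`, `max(0, k−n) ≤ q ≤ ⌊k/2⌋`, form a basis of
`Val_k^{U(n)}`: every continuous, translation invariant, `U(n)`-invariant valuation on `ℂⁿ`
homogeneous of degree `k` is a unique linear combination of them. -/
theorem hermitian_intrinsic_volumes_basis (n k : ℕ) (hn : 1 ≤ n) (hk : k ≤ 2 * n)
    (μf : ℕ → ConvexBody (Ecl n) → ℝ)
    (hμf : ∀ q : ℕ, k - n ≤ q → q ≤ k / 2 →
      (IsValuation (μf q) ∧ Continuous (μf q) ∧ TransInv (μf q) ∧ UInv (μf q) ∧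
        Homog k (μf q)) ∧ HermKlainCond k q (μf q)) :
    ∀ φ : ConvexBody (Ecl n) → ℝ,
      IsValuation φ → Continuous φ → TransInv φ → UInv φ → Homog k φ →
        ∃! c : Fin (k / 2 - (k - n) + 1) → ℝ,
          ∀ K : ConvexBody (Ecl n), φ K = ∑ j, c j * μf ((k - n) + (j : ℕ)) K := by
  intro φ hval hcont hti hui hhom
  have hle : ∀ j : Fin (k / 2 - (k - n) + 1), k - n + (j : ℕ) ≤ k / 2 := fun j => by
    have := j.2
    omega
  have hμ := fun j : Fin (k / 2 - (k - n) + 1) => hμf _ (Nat.le_add_right (k - n) j) (hle j)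
  choose A B hAB hA hABk using fun j : Fin (k / 2 - (k - n) + 1) =>
    exists_hermFrame (n := n) (Nat.le_add_right (k - n) j) (hle j) hk
  let Z := fun j => zon (hermFrame (A j) (B j))
  let m := fun j => (μH[(k : ℝ)] (Z j : Set (Ecl n))).toReal
  have hm : ∀ j, m j ≠ 0 := fun j => by
    have := hausdorffMeasure_zon (hAB j).pairwise_hermFrame (hAB j).norm_hermFrame
    rwa [length_hermFrame, hABk] at this
  have hZ : ∀ i j : Fin (k / 2 - (k - n) + 1),
      μf (k - n + (i : ℕ)) (Z j) = if j = i then m j else 0 := fun i j => by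
    rw [(hμ i).2.zon_hermFrame (hAB j) (hABk j), hA]
    simp only [Nat.add_left_cancel_iff, Fin.val_inj]
    rfl
  have hsum : ∀ (c : Fin (k / 2 - (k - n) + 1) → ℝ) j,
      ∑ i, c i * μf (k - n + (i : ℕ)) (Z j) = c j * m j := fun c j => by
    simp [hZ]
  refine ⟨fun j => φ (Z j) / m j, ?_, fun c hc => ?_⟩
  · let Φ : ConvexBody (Ecl n) → ℝ := fun K =>
      φ K - ∑ j, φ (Z j) / m j * μf (k - n + (j : ℕ)) K
    have hΦ : IsVal k Φ := by
      refine ⟨fun K L M J hM hJ => ?_, ?_, fun K x => ?_, fun K t ht => ?_⟩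
      · have h1 := hval K L M J hM hJ
        have h2 : ∑ j, φ (Z j) / m j * μf (k - n + (j : ℕ)) M
            + ∑ j, φ (Z j) / m j * μf (k - n + (j : ℕ)) J
            = ∑ j, φ (Z j) / m j * μf (k - n + (j : ℕ)) K
            + ∑ j, φ (Z j) / m j * μf (k - n + (j : ℕ)) L := by
          rw [← Finset.sum_add_distrib, ← Finset.sum_add_distrib]
          refine Finset.sum_congr rfl fun j _ => ?_
          rw [← mul_add, (hμ j).1.1 K L M J hM hJ, mul_add]
        simp only [Φ]
        linarith
      · exact hcont.sub (continuous_finsetSum _ fun j _ => continuous_const.mul (hμ j).1.2.1)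
      · simp only [Φ]
        rw [hti]
        congr 1
        exact Finset.sum_congr rfl fun j _ => by rw [(hμ j).1.2.2.1]
      · simp only [Φ]
        rw [hhom K t ht, mul_sub, Finset.mul_sum]
        congr 1
        exact Finset.sum_congr rfl fun j _ => by rw [(hμ j).1.2.2.2.2 K t ht, mul_left_comm]
    have hΦU : UnitInv Φ := fun U K => by
      simp only [Φ]
      rw [hui.unitInv U]
      congr 1
      exact Finset.sum_congr rfl fun j _ => by rw [(hμ j).1.2.2.2.1.unitInv U]
    have hzero := hΦU.eq_zero_of_hermFrame hΦ fun A' B' hAB' hk' => by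
      have hl := hAB'.length_le
      rw [List.length_append] at hl
      let j : Fin (k / 2 - (k - n) + 1) := ⟨A'.length - (k - n), by omega⟩
      have hj : (A j).length = A'.length := by
        rw [hA]
        simp only [j]
        omega
      have hj' : (B j).length = B'.length := by
        have := hABk j
        omega
      rw [← hΦU.zon_hermFrame_eq (hAB j) hAB' hj hj']
      change φ (Z j) - ∑ i, φ (Z i) / m i * μf (k - n + (i : ℕ)) (Z j) = 0
      rw [hsum (fun i => φ (Z i) / m i), div_mul_cancel₀ _ (hm j), sub_self]
    exact fun K => sub_eq_zero.1 (hzero K)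
  · funext j
    rw [eq_div_iff (hm j), ← hsum, ← hc]
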